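/- Let g be a root-reductive Lie algebra with splitting maximal toral subalgebra h and Dynkin Borel subalgebra b ⊇ h. For λ, μ ∈ h*, the vector space Hom_{U(g)}(M(λ), M(μ)) is 0- or 1-dimensional over K, every nonzero element of Hom_{U(g)}(M(λ), M(μ)) is an embedding, and if a nonzero homomorphism exists then λ ≼ μ. -/

import Mathlib

noncomputable section
namespace Paper

variable (K : Type) [Field K] [IsAlgClosed K] [CharZero K]
variable (g : Type) [LieRing g] [LieAlgebra K g]

def adWeightSpace (h : LieSubalgebra K g) (α : Module.Dual K h) : Submodule K g where
  carrier := {x | ∀ H : h, ⁅(H : g), x⁆ = α H • x}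
  add_mem' := by intro a b ha hb H; rw [lie_add, ha H, hb H, smul_add]
  zero_mem' := by intro H; rw [lie_zero, smul_zero]
  smul_mem' := by intro c x hx H; rw [lie_smul, hx H, smul_comm]

def IsRootOf (h : LieSubalgebra K g) (α : Module.Dual K h) : Prop :=
  α ≠ 0 ∧ adWeightSpace K g h α ≠ ⊥

def IsToralIn (s t : LieSubalgebra K g) : Prop :=
  t ≤ s ∧ IsLieAbelian t ∧
    s.toSubmodule ≤ ⨆ α : Module.Dual K t, s.toSubmodule ⊓ adWeightSpace K g t α

def IsMaxToralIn (s t : LieSubalgebra K g) : Prop :=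
  IsToralIn K g s t ∧ ∀ t' : LieSubalgebra K g, IsToralIn K g s t' → t ≤ t' → t' = t

/-- A root-reductive Lie algebra `g` together with a splitting maximal toral subalgebra `h`
and a splitting Borel subalgebra `b ⊇ h` determined by a set `pos` of positive roots. -/
structure Setup where
  /-- the exhausting chain of finite-dimensional reductive subalgebras -/
  F : ℕ → LieSubalgebra K g
  F_mono : Monotone F
  F_exhaust : ∀ x : g, ∃ n, x ∈ F n
  F_findim : ∀ n, FiniteDimensional K (F n)
  /-- each `F n` is reductive: every abelian ideal is central -/
  F_reductive : ∀ n, ∀ I : LieIdeal K (F n), IsLieAbelian I → I ≤ LieAlgebra.center K (F n)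
  /-- the nested chain of Cartan subalgebras witnessing the root inclusions -/
  C : ℕ → LieSubalgebra K g
  C_mono : Monotone C
  C_le : ∀ n, C n ≤ F n
  C_cartan : ∀ n, (LieSubalgebra.comap (F n).incl (C n)).IsCartanSubalgebra
  /-- each inclusion `F n ↪ F (n+1)` is a root inclusion with respect to `C (n+1)`:
  every root space of `F n` relative to `C n` is a root space of `F (n+1)` -/
  C_rootIncl : ∀ n, ∀ α : Module.Dual K (C n), α ≠ 0 →
    (F n).toSubmodule ⊓ adWeightSpace K g (C n) α ≠ ⊥ →
    ∃ β : Module.Dual K (C (n + 1)),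
      (F n).toSubmodule ⊓ adWeightSpace K g (C n) α
        = (F (n + 1)).toSubmodule ⊓ adWeightSpace K g (C (n + 1)) β
  /-- the splitting maximal toral subalgebra -/
  h : LieSubalgebra K g
  h_maxToral : ∀ n, IsMaxToralIn K g (F n) (h ⊓ F n)
  /-- `g` is the direct sum of its `h`-weight spaces -/
  h_indep : iSupIndep fun α : Module.Dual K h => adWeightSpace K g h α
  h_span : (⨆ α : Module.Dual K h, adWeightSpace K g h α) = ⊤
  /-- the set `Δ⁺` of positive roots -/
  pos : Set (Module.Dual K h)
  pos_root : ∀ α ∈ pos, IsRootOf K g h α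
  pos_add : ∀ α ∈ pos, ∀ β ∈ pos, IsRootOf K g h (α + β) → α + β ∈ pos
  pos_polar : ∀ α : Module.Dual K h, IsRootOf K g h α → (α ∈ pos ↔ ¬(-α ∈ pos))
  neg_add : ∀ α β : Module.Dual K h, IsRootOf K g h α → IsRootOf K g h β →
    α ∉ pos → β ∉ pos → IsRootOf K g h (α + β) → α + β ∉ pos
  /-- the splitting Borel subalgebra -/
  b : LieSubalgebra K g
  b_eq : b.toSubmodule = h.toSubmodule ⊔ ⨆ α ∈ pos, adWeightSpace K g h α


variable {K g}

namespace Setup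

variable (S : Setup K g)

/-- `h ∩ g_n`. -/
def hn (n : ℕ) : LieSubalgebra K g := S.h ⊓ S.F n

/-- restriction of a functional on `h` to `h ∩ g_n`. -/
def resDual (n : ℕ) (lam : Module.Dual K S.h) : Module.Dual K (S.hn n) :=
  lam.comp (LieSubalgebra.inclusion (inf_le_left : S.hn n ≤ S.h)).toLinearMap

/-- the `α`-root space of `g_n` relative to `h ∩ g_n`. -/
def rootSpaceN (n : ℕ) (α : Module.Dual K (S.hn n)) : Submodule K g :=
  (S.F n).toSubmodule ⊓ adWeightSpace K g (S.hn n) α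

/-- the set of `b`-positive roots of `g_n`. -/
def posRootsN (n : ℕ) : Set (Module.Dual K (S.hn n)) :=
  {α | α ≠ 0 ∧ S.rootSpaceN n α ≠ ⊥ ∧ S.rootSpaceN n α ≤ S.b.toSubmodule}

/-- `ρ_n`, the half sum of the positive roots of `g_n` with respect to `b ∩ g_n`. -/
def rhoN (n : ℕ) : Module.Dual K (S.hn n) :=
  (2 : K)⁻¹ • ∑ᶠ α ∈ S.posRootsN n, α

/-- `α` is a simple `b`-positive root: it is positive and cannot be written as a sum of
two or more positive roots. -/
def IsSimpleRoot (α : Module.Dual K S.h) : Prop :=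
  α ∈ S.pos ∧ ¬∃ s : Multiset (Module.Dual K S.h),
    2 ≤ Multiset.card s ∧ (∀ β ∈ s, β ∈ S.pos) ∧ s.sum = α

/-- `b` is a Dynkin Borel subalgebra: it is generated, as a Lie subalgebra, by `h` together
with the simple root spaces. -/
def IsDynkin : Prop :=
  S.b = LieSubalgebra.lieSpan K g
    ((S.h : Set g) ∪ ⋃ α ∈ {α | S.IsSimpleRoot α}, (adWeightSpace K g S.h α : Set g))

/-- the partial order `≼` on `h^*`: `lam ≼ mu` iff `mu - lam` is a `ℤ≥0`-linear combination
of positive roots. -/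
def wle (lam mu : Module.Dual K S.h) : Prop :=
  ∃ s : Multiset (Module.Dual K S.h), (∀ β ∈ s, β ∈ S.pos) ∧ mu - lam = s.sum

/-- `g` is locally semisimple: each `g_n` is a semisimple Lie algebra. -/
def IsLocallySemisimple : Prop := ∀ n, LieAlgebra.IsSemisimple K (S.F n)

end Setup


/-- the universal enveloping algebra of `g`. -/
abbrev Env (K g : Type) [Field K] [LieRing g] [LieAlgebra K g] : Type :=
  UniversalEnvelopingAlgebra K g

namespace Setup

variable {K : Type} [Field K] [IsAlgClosed K] [CharZero K]
variable {g : Type} [LieRing g] [LieAlgebra K g]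
variable (S : Setup K g)

/-- the nilpotent radical `n⁺ = ⨁_{α ∈ Δ⁺} g^α` of `b`, as a subspace of `g`. -/
def nplus : Submodule K g := ⨆ α ∈ S.pos, adWeightSpace K g S.h α

/-- the left ideal of `U(g)` generated by `n⁺` and the elements `H - lam(H)`, `H ∈ h`. -/
def vermaIdeal (lam : Module.Dual K S.h) : Submodule (Env K g) (Env K g) :=
  Submodule.span (Env K g)
    ((UniversalEnvelopingAlgebra.ι K '' (S.nplus : Set g)) ∪
      Set.range fun H : S.h =>
        UniversalEnvelopingAlgebra.ι K (H : g) - algebraMap K (Env K g) (lam H))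

/-- the Verma module `M(lam) = U(g)/I`. -/
abbrev Verma (lam : Module.Dual K S.h) : Type := Env K g ⧸ S.vermaIdeal lam

/-- the maximal proper submodule of the Verma module `M(lam)`,
i.e. the sum of all proper submodules. -/
def maxSub (lam : Module.Dual K S.h) : Submodule (Env K g) (S.Verma lam) :=
  sSup {N : Submodule (Env K g) (S.Verma lam) | N ≠ ⊤}

/-- the simple module `L(lam)`, the unique simple quotient of `M(lam)`. -/
abbrev SimpleL (lam : Module.Dual K S.h) : Type := S.Verma lam ⧸ S.maxSub lam

/-- `H` is the coroot `h_α` of the root `α`:  `α(H) = 2` and `H ∈ [g^α, g^{-α}]`. -/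
def IsCoroot (α : Module.Dual K S.h) (H : S.h) : Prop :=
  α H = 2 ∧ ∃ x ∈ adWeightSpace K g S.h α, ∃ y ∈ adWeightSpace K g S.h (-α),
    (H : g) = ⁅x, y⁆

/-- the dot-reflection `s_α · mu = mu - (mu + ρ)(h_α) α` associated to a root `α`
with coroot `Hα`, relative to the half sum `ρ` of positive roots. -/
def dotReflect (ρ α : Module.Dual K S.h) (Hα : S.h) (mu : Module.Dual K S.h) :
    Module.Dual K S.h :=
  mu - ((mu + ρ) Hα) • α

/-- `ρ` is the global half sum of positive roots: its restriction to each `h ∩ g_n`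
is the half sum `ρ_n` of positive roots of `g_n`. -/
def IsGlobalRho (ρ : Module.Dual K S.h) : Prop := ∀ n : ℕ, S.resDual n ρ = S.rhoN n

/-- `lam` is strongly linked to `mu` (relative to `ρ`). -/
inductive StronglyLinked (ρ : Module.Dual K S.h) :
    Module.Dual K S.h → Module.Dual K S.h → Prop
  | refl (mu : Module.Dual K S.h) : StronglyLinked ρ mu mu
  | step {lam mu : Module.Dual K S.h} (α : Module.Dual K S.h) (Hα : S.h) :
      α ∈ S.pos → S.IsCoroot α Hα →
      S.wle (S.dotReflect ρ α Hα mu) mu →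
      StronglyLinked ρ lam (S.dotReflect ρ α Hα mu) →
      StronglyLinked ρ lam mu

/-- `lam` is antidominant: `(lam + ρ)(h_α)` is not a positive integer
for any positive root `α`. -/
def IsAntidominant (ρ lam : Module.Dual K S.h) : Prop :=
  ∀ α ∈ S.pos, ∀ Hα : S.h, S.IsCoroot α Hα → ¬∃ k : ℕ, 0 < k ∧ (lam + ρ) Hα = (k : K)

/-- `lam` is almost antidominant: `(lam + ρ)(h_α)` is a positive integer
for only finitely many positive roots `α`. -/
def IsAlmostAntidominant (ρ lam : Module.Dual K S.h) : Prop :=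
  {α | α ∈ S.pos ∧ ∃ Hα : S.h, S.IsCoroot α Hα ∧
    ∃ k : ℕ, 0 < k ∧ (lam + ρ) Hα = (k : K)}.Finite

end Setup

set_option linter.unusedSectionVars false

section Rewriting

variable {K : Type} [Field K] {R : Type} [Ring R] [Algebra K R]
variable {J : Type} [LinearOrder J]

/-- The ordered monomial attached to a multiset. -/
def ordProd (x : J → R) (m : Multiset J) : R := ((m.sort (· ≤ ·)).map x).prod

/-- Ordered monomials of degree at least one and less than `n`. -/
def lowSpan (K : Type) [Field K] {R : Type} [Ring R] [Algebra K R]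
    (x : J → R) (n : ℕ) : Submodule K R :=
  Submodule.span K {r | ∃ w : List J, w ≠ [] ∧ w.length < n ∧ r = (w.map x).prod}

lemma mul_mem_lowSpan (x : J → R) {n : ℕ} (i : J) {r : R} (hr : r ∈ lowSpan K x n) :
    x i * r ∈ lowSpan K x (n + 1) := by
  induction hr using Submodule.span_induction with
  | mem r h =>
    obtain ⟨w, hw, hl, rfl⟩ := h
    exact Submodule.subset_span ⟨i :: w, by simp, by simpa using hl, by simp⟩
  | zero => simp
  | add a b _ _ ha hb => rw [mul_add]; exact add_mem ha hb
  | smul c a _ ha => rw [mul_smul_comm]; exact Submodule.smul_mem _ c ha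

lemma perm_sub_mem (x : J → R)
    (hx : ∀ i j, x i * x j - x j * x i ∈ Submodule.span K (Set.range x))
    {w w' : List J} (h : w.Perm w') :
    (w.map x).prod - (w'.map x).prod ∈ lowSpan K x w.length := by
  induction h with
  | nil => simp
  | cons i h ih =>
    simp only [List.map_cons, List.prod_cons, List.length_cons, ← mul_sub]
    exact mul_mem_lowSpan x i ih
  | swap i j l =>
    simp only [List.map_cons, List.prod_cons, List.length_cons, ← mul_assoc, ← sub_mul]
    have := hx j i
    generalize x j * x i - x i * x j = q at this
    induction this using Submodule.span_induction with
    | mem r h =>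
      obtain ⟨k, rfl⟩ := h
      exact Submodule.subset_span ⟨k :: l, by simp, by simp, by simp⟩
    | zero => simp
    | add a b _ _ ha hb => rw [add_mul]; exact add_mem ha hb
    | smul c a _ ha => rw [smul_mul_assoc]; exact Submodule.smul_mem _ c ha
  | trans h1 h2 ih1 ih2 =>
    rw [← h1.length_eq] at ih2
    simpa using add_mem ih1 ih2

lemma lowSpan_mono (x : J → R) {m n : ℕ} (h : m ≤ n) : lowSpan K x m ≤ lowSpan K x n :=
  Submodule.span_mono fun _ ⟨w, hw, hl, e⟩ => ⟨w, hw, hl.trans_le h, e⟩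

lemma prod_sub_ordProd_mem (x : J → R)
    (hx : ∀ i j, x i * x j - x j * x i ∈ Submodule.span K (Set.range x)) (w : List J) :
    (w.map x).prod - ordProd x (w : Multiset J) ∈ lowSpan K x w.length := by
  refine perm_sub_mem x hx ?_
  rw [← Multiset.coe_eq_coe, Multiset.sort_eq]

lemma lowSpan_le_span_ordProd (x : J → R)
    (hx : ∀ i j, x i * x j - x j * x i ∈ Submodule.span K (Set.range x)) (n : ℕ) :
    lowSpan K x n ≤ Submodule.span K
      {r | ∃ m : Multiset J, m ≠ 0 ∧ Multiset.card m < n ∧ r = ordProd x m} := by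
  induction n with
  | zero => exact Submodule.span_le.2 fun _ ⟨w, hw, hl, e⟩ => absurd hl (by simp)
  | succ n ih =>
    refine Submodule.span_le.2 ?_
    rintro _ ⟨w, hw, hl, rfl⟩
    have h1 := prod_sub_ordProd_mem x hx w
    have h2 := (lowSpan_mono x (Nat.lt_succ_iff.1 hl)).trans ih h1
    have h3 : Submodule.span K {r | ∃ m : Multiset J, m ≠ 0 ∧ Multiset.card m < n ∧ r = ordProd x m}
      ≤ Submodule.span K {r | ∃ m : Multiset J, m ≠ 0 ∧ Multiset.card m < n + 1 ∧ r = ordProd x m} :=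
      Submodule.span_mono fun _ ⟨m, a, b, c⟩ => ⟨m, a, b.trans (Nat.lt_succ_self _), c⟩
    rw [← sub_add_cancel (w.map x).prod (ordProd x (w : Multiset J))]
    exact add_mem (h3 h2) (Submodule.subset_span ⟨w, by simpa using hw, by simpa using hl, rfl⟩)

lemma prod_mem_span_ordProd (x : J → R)
    (hx : ∀ i j, x i * x j - x j * x i ∈ Submodule.span K (Set.range x)) {w : List J}
    (hw : w ≠ []) :
    (w.map x).prod ∈ Submodule.span K
      {r | ∃ m : Multiset J, m ≠ 0 ∧ Multiset.card m ≤ w.length ∧ r = ordProd x m} := by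
  have := lowSpan_le_span_ordProd x hx (w.length + 1)
    (Submodule.subset_span ⟨w, hw, Nat.lt_succ_self _, rfl⟩)
  simpa only [Nat.lt_succ_iff] using this

end Rewriting

section DerivationModel

variable {K : Type} [Field K] {g : Type} [LieRing g] [LieAlgebra K g]
variable {E : Type} [AddCommGroup E] [Module K E] [LieRingModule g E] [LieModule K g E]

/-- The coordinate ring used to model `U(g)` by differential operators: polynomials in matrix
coefficients. -/
abbrev CoeffRing (K E : Type) [Field K] [AddCommGroup E] [Module K E] : Type :=
  MvPolynomial (Module.Dual K E × Module.Basis.ofVectorSpaceIndex K E) K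

/-- The matrix coefficient attached to a functional and a vector. -/
def coeffMap (ψ : Module.Dual K E) : E →ₗ[K] CoeffRing K E :=
  (Module.Basis.ofVectorSpace K E).constr K fun j => MvPolynomial.X (ψ, j)

lemma coeffMap_basis (ψ : Module.Dual K E) (j : Module.Basis.ofVectorSpaceIndex K E) :
    coeffMap ψ (Module.Basis.ofVectorSpace K E j) = MvPolynomial.X (ψ, j) := by
  simp only [coeffMap, Module.Basis.constr_basis]

/-- The derivation of the coefficient ring induced by an element of `g`. -/
def coeffDer (K : Type) [Field K] {g : Type} [LieRing g] [LieAlgebra K g]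
    (E : Type) [AddCommGroup E] [Module K E] [LieRingModule g E] [LieModule K g E] (x : g) :
    Derivation K (CoeffRing K E) (CoeffRing K E) :=
  MvPolynomial.mkDerivation K fun p => coeffMap p.1 ⁅x, Module.Basis.ofVectorSpace K E p.2⁆

lemma coeffDer_coeffMap (x : g) (ψ : Module.Dual K E) (e : E) :
    coeffDer K E x (coeffMap ψ e) = coeffMap ψ ⁅x, e⁆ := by
  have : (coeffDer K E x : CoeffRing K E →ₗ[K] CoeffRing K E) ∘ₗ coeffMap ψ =
      coeffMap ψ ∘ₗ (LieModule.toEnd K g E x) := by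
    refine (Module.Basis.ofVectorSpace K E).ext fun j => ?_
    simp only [LinearMap.comp_apply, coeffMap_basis]
    simp [coeffDer, MvPolynomial.mkDerivation_X]
  exact LinearMap.congr_fun this e

/-- The action of `g` on the coefficient ring by derivations. -/
def coeffAction (K : Type) [Field K] (g : Type) [LieRing g] [LieAlgebra K g]
    (E : Type) [AddCommGroup E] [Module K E] [LieRingModule g E] [LieModule K g E] :
    g →ₗ⁅K⁆ Derivation K (CoeffRing K E) (CoeffRing K E) where
  toFun := coeffDer K E
  map_add' x y := by
    refine MvPolynomial.derivation_ext fun p => ?_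
    rw [← coeffMap_basis, Derivation.add_apply]
    simp [coeffDer_coeffMap]
  map_smul' c x := by
    refine MvPolynomial.derivation_ext fun p => ?_
    rw [← coeffMap_basis, Derivation.smul_apply]
    simp [coeffDer_coeffMap]
  map_lie' {x y} := by
    refine MvPolynomial.derivation_ext fun p => ?_
    rw [← coeffMap_basis, Derivation.commutator_apply]
    simp [coeffDer_coeffMap]

/-- The augmentation of the coefficient ring: evaluation of matrix coefficients at the identity. -/
def coeffAug (K E : Type) [Field K] [AddCommGroup E] [Module K E] : CoeffRing K E →ₐ[K] K :=
  MvPolynomial.aeval fun p => p.1 (Module.Basis.ofVectorSpace K E p.2)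

lemma coeffAug_coeffMap (ψ : Module.Dual K E) (e : E) :
    coeffAug K E (coeffMap ψ e) = ψ e := by
  have : (coeffAug K E).toLinearMap ∘ₗ coeffMap ψ = ψ := by
    refine (Module.Basis.ofVectorSpace K E).ext fun j => ?_
    simp only [LinearMap.comp_apply, coeffMap_basis]
    simp [coeffAug]
  exact LinearMap.congr_fun this e

lemma exists_coeff_separating (hE : ∀ x : g, (∀ e : E, ⁅x, e⁆ = 0) → x = 0) {x : g} (hx : x ≠ 0) :
    ∃ l : CoeffRing K E, coeffAug K E l = 0 ∧ coeffAug K E (coeffAction K g E x l) ≠ 0 := by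
  obtain ⟨e, he⟩ : ∃ e : E, ⁅x, e⁆ ≠ 0 := by
    by_contra! h; exact hx (hE x h)
  obtain ⟨ψ, hψ⟩ : ∃ ψ : Module.Dual K E, ψ ⁅x, e⁆ ≠ 0 := by
    by_contra! h; exact he ((Module.forall_dual_apply_eq_zero_iff K _).1 h)
  refine ⟨coeffMap ψ e - algebraMap K _ (ψ e), ?_, ?_⟩
  · simp [coeffAug_coeffMap]
  · rw [map_sub, Derivation.map_algebraMap, sub_zero]
    change coeffAug K E (coeffDer K E x _) ≠ 0
    rwa [coeffDer_coeffMap, coeffAug_coeffMap]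

end DerivationModel

section Symbol

variable {K : Type} [Field K] {A : Type} [CommRing A] [Algebra K A]

lemma derivation_mem_pow (D : Derivation K A A) (I : Ideal A) {n : ℕ} {a : A}
    (ha : a ∈ I ^ (n + 1)) : D a ∈ I ^ n := by
  induction n generalizing a with
  | zero => simp
  | succ n ih =>
    rw [pow_succ] at ha
    induction ha using Submodule.mul_induction_on' with
    | mem_mul_mem m hm l hl =>
      rw [D.leibniz, smul_eq_mul, smul_eq_mul]
      refine add_mem (Ideal.mul_mem_right _ _ hm) ?_
      rw [mul_comm, pow_succ]
      exact Ideal.mul_mem_mul (ih hm) hl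
    | add x _ y _ hx hy => rw [map_add]; exact add_mem hx hy

lemma derivation_word_sub_mem {J : Type} (D : J → Derivation K A A) (I : Ideal A) {l : A}
    (hl : l ∈ I) (w : List J) (k : ℕ) :
    (w.map fun j => (D j : Module.End K A)).prod (l ^ (k + w.length)) -
      ((k + w.length).descFactorial w.length : A) * (l ^ k * (w.map fun j => D j l).prod)
        ∈ I ^ (k + 1) := by
  induction w generalizing k with
  | nil => simp
  | cons j w ih =>
    have h := derivation_mem_pow (D j) I (ih (k + 1))
    have e : k + (j :: w).length = k + 1 + w.length := by simp; ring
    have e2 : ((k + (j :: w).length).descFactorial (j :: w).length : A) =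
        (k + 1) * ((k + 1 + w.length).descFactorial w.length : A) := by
      rw [e, List.length_cons, Nat.descFactorial_succ]
      push_cast [Nat.add_sub_cancel]; rfl
    rw [e2, e, List.map_cons, List.prod_cons, Module.End.mul_apply, List.map_cons, List.prod_cons]
    set W := (w.map fun j => (D j : Module.End K A)).prod (l ^ (k + 1 + w.length))
    set c := (k + 1 + w.length).descFactorial w.length
    set P := (w.map fun j => D j l).prod
    rw [map_sub, D j |>.leibniz, D j |>.leibniz, (D j).leibniz_pow, Derivation.map_natCast] at h
    have h4 : (c : A) * (l ^ (k + 1) * D j P) ∈ I ^ (k + 1) :=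
      Ideal.mul_mem_left _ _ (Ideal.mul_mem_right _ _ (Ideal.pow_mem_pow hl _))
    have h5 := add_mem h h4
    convert h5 using 1
    simp only [smul_eq_mul, nsmul_eq_mul, Nat.add_sub_cancel, mul_zero, add_zero]
    push_cast
    change D j W - _ = D j W - _ + _
    ring

end Symbol

section Envelope

attribute [local instance] LieRing.ofAssociativeRing

variable {K : Type} [Field K] {g : Type} [LieRing g] [LieAlgebra K g]

lemma ι_lie (x y : g) : UniversalEnvelopingAlgebra.ι K ⁅x, y⁆ =
    UniversalEnvelopingAlgebra.ι K x * UniversalEnvelopingAlgebra.ι K y -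
      UniversalEnvelopingAlgebra.ι K y * UniversalEnvelopingAlgebra.ι K x := by
  rw [LieHom.map_lie, LieRing.of_associative_ring_bracket]

/-- Extension of a linear map compatible with commutators to the enveloping algebra. -/
lemma exists_envelope_hom {A : Type} [Ring A] [Algebra K A] (f : g →ₗ[K] A)
    (hf : ∀ x y, f ⁅x, y⁆ = f x * f y - f y * f x) :
    ∃ F : UniversalEnvelopingAlgebra K g →ₐ[K] A,
      ∀ x, F (UniversalEnvelopingAlgebra.ι K x) = f x := by
  let f' : g →ₗ⁅K⁆ A :=
    { f with
      map_lie' := fun {x y} => by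
        simpa [LieRing.of_associative_ring_bracket] using hf x y }
  exact ⟨UniversalEnvelopingAlgebra.lift K f', fun x => UniversalEnvelopingAlgebra.lift_ι_apply K f' x⟩

lemma adjoin_range_ι :
    Algebra.adjoin K (Set.range (UniversalEnvelopingAlgebra.ι K (L := g))) = ⊤ := by
  let S := Algebra.adjoin K (Set.range (UniversalEnvelopingAlgebra.ι K (L := g)))
  let f : g →ₗ⁅K⁆ S :=
    { toFun := fun y => ⟨UniversalEnvelopingAlgebra.ι K y, Algebra.subset_adjoin ⟨y, rfl⟩⟩
      map_add' := fun a b => by ext; simp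
      map_smul' := fun c a => by ext; simp
      map_lie' := fun {a b} => by ext; simp [LieRing.of_associative_ring_bracket] }
  have h : S.val.comp (UniversalEnvelopingAlgebra.lift K f) = AlgHom.id K _ := by
    apply UniversalEnvelopingAlgebra.hom_ext
    ext y
    simp only [LieHom.comp_apply, AlgHom.coe_toLieHom, AlgHom.comp_apply,
      UniversalEnvelopingAlgebra.lift_ι_apply, AlgHom.id_apply]
    rfl
  refine Algebra.eq_top_iff.2 fun u => ?_
  have := congrArg (fun φ => φ u) h
  simp only [AlgHom.comp_apply, AlgHom.id_apply] at this
  rw [← this]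
  exact (UniversalEnvelopingAlgebra.lift K f u).2

/-- The canonical map into the enveloping algebra, as a linear map. -/
def ιLin : g →ₗ[K] UniversalEnvelopingAlgebra K g := (UniversalEnvelopingAlgebra.ι K (L := g)).toLinearMap

end Envelope

section PBW

variable {K : Type} [Field K] {g : Type} [LieRing g] [LieAlgebra K g]
variable {J : Type} (x : Module.Basis J K g)

/-- The image in `U(g)` of a word in the basis vectors. -/
def word (w : List J) : UniversalEnvelopingAlgebra K g :=
  (w.map fun j => UniversalEnvelopingAlgebra.ι K (x j)).prod

/-- The commutative monomial attached to a multiset of indices. -/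
def symMonomial (K : Type) [Field K] {J : Type} [DecidableEq J] (m : Multiset J) :
    MvPolynomial J K :=
  MvPolynomial.monomial (Multiset.toFinsupp m) 1

variable [DecidableEq J]

lemma symMonomial_add (a b : Multiset J) :
    symMonomial K (a + b) = symMonomial K a * symMonomial K b := by
  simp [symMonomial, MvPolynomial.monomial_mul]

lemma symMonomial_zero : symMonomial K (0 : Multiset J) = 1 := by
  simp [symMonomial]

lemma symMonomial_singleton (i : J) : symMonomial K {i} = MvPolynomial.X i := by
  simp [symMonomial, MvPolynomial.X]

lemma symMonomial_cons (i : J) (m : Multiset J) :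
    symMonomial K (i ::ₘ m) = MvPolynomial.X i * symMonomial K m := by
  rw [← Multiset.singleton_add, symMonomial_add, symMonomial_singleton]

lemma linearIndependent_symMonomial :
    LinearIndependent K (symMonomial K : Multiset J → MvPolynomial J K) := by
  have := (MvPolynomial.basisMonomials J K).linearIndependent.comp
    (Multiset.toFinsupp : Multiset J → J →₀ ℕ) (Multiset.toFinsupp (α := J)).injective
  rw [MvPolynomial.coe_basisMonomials] at this
  exact this

/-- The filtration of `U(g)` by word length: words of length less than `n`. -/
def filt (n : ℕ) : Submodule K (UniversalEnvelopingAlgebra K g) :=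
  Submodule.span K {r | ∃ w : List J, w.length < n ∧ r = word x w}

/-- The graph of the order `n` symbol map. -/
def symRel (n : ℕ) : Submodule K (UniversalEnvelopingAlgebra K g × MvPolynomial J K) :=
  Submodule.span K ({p | ∃ w : List J, w.length = n ∧ p = (word x w, symMonomial K (w : Multiset J))}
    ∪ {p | ∃ w : List J, w.length < n ∧ p = (word x w, 0)})

lemma word_append (v w : List J) : word x (v ++ w) = word x v * word x w := by
  simp [word]

lemma word_mem_symRel (w : List J) :
    (word x w, symMonomial K (w : Multiset J)) ∈ symRel x w.length :=
  Submodule.subset_span (Or.inl ⟨w, rfl, rfl⟩)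

lemma filt_mem_symRel {n : ℕ} {u : UniversalEnvelopingAlgebra K g} (hu : u ∈ filt x n) :
    (u, (0 : MvPolynomial J K)) ∈ symRel x n := by
  induction hu using Submodule.span_induction with
  | mem r h =>
    obtain ⟨w, hw, rfl⟩ := h
    exact Submodule.subset_span (Or.inr ⟨w, hw, rfl⟩)
  | zero => exact zero_mem _
  | add a b _ _ ha hb => simpa using add_mem ha hb
  | smul c a _ ha => simpa using Submodule.smul_mem _ c ha

lemma symRel_mul {m n : ℕ} {p q : UniversalEnvelopingAlgebra K g × MvPolynomial J K}
    (hp : p ∈ symRel x m) (hq : q ∈ symRel x n) : p * q ∈ symRel x (m + n) := by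
  have : symRel x m * symRel x n ≤ symRel x (m + n) := by
    rw [symRel, symRel, Submodule.span_mul_span, Submodule.span_le]
    rintro _ ⟨p, hp, q, hq, rfl⟩
    rcases hp with ⟨v, hv, rfl⟩ | ⟨v, hv, rfl⟩ <;> rcases hq with ⟨w, hw, rfl⟩ | ⟨w, hw, rfl⟩ <;>
      simp only [Prod.mk_mul_mk, ← word_append, mul_zero, zero_mul, ← symMonomial_add]
    · exact Submodule.subset_span (Or.inl ⟨v ++ w, by simp [hv, hw], by simp⟩)
    all_goals exact Submodule.subset_span (Or.inr ⟨v ++ w, by simp; omega, rfl⟩)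
  exact this (Submodule.mul_mem_mul hp hq)

lemma filt_mono {m n : ℕ} (h : m ≤ n) : filt x m ≤ filt x n :=
  Submodule.span_mono fun _ ⟨w, hw, e⟩ => ⟨w, hw.trans_le h, e⟩

lemma exists_symRel {n : ℕ} {u : UniversalEnvelopingAlgebra K g} (hu : u ∈ filt x (n + 1)) :
    ∃ P, (u, P) ∈ symRel x n := by
  induction hu using Submodule.span_induction with
  | mem r h =>
    obtain ⟨w, hw, rfl⟩ := h
    rcases (Nat.lt_succ_iff.1 hw).lt_or_eq with h | rfl
    · exact ⟨0, Submodule.subset_span (Or.inr ⟨w, h, rfl⟩)⟩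
    · exact ⟨_, word_mem_symRel x w⟩
  | zero => exact ⟨0, zero_mem _⟩
  | add a b _ _ ha hb =>
    obtain ⟨P, hP⟩ := ha
    obtain ⟨Q, hQ⟩ := hb
    exact ⟨P + Q, add_mem hP hQ⟩
  | smul c a _ ha =>
    obtain ⟨P, hP⟩ := ha
    exact ⟨c • P, Submodule.smul_mem _ c hP⟩

lemma ι_mem_span_words (y : g) :
    UniversalEnvelopingAlgebra.ι K y ∈
      Submodule.span K (Set.range fun j => UniversalEnvelopingAlgebra.ι K (x j)) := by
  have : y ∈ Submodule.span K (Set.range x) := by rw [x.span_eq]; trivial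
  have h := Submodule.mem_map_of_mem (f := ιLin) this
  rw [Submodule.map_span, ← Set.range_comp] at h
  exact h

lemma word_comm_mem (i j : J) :
    UniversalEnvelopingAlgebra.ι K (x i) * UniversalEnvelopingAlgebra.ι K (x j) -
      UniversalEnvelopingAlgebra.ι K (x j) * UniversalEnvelopingAlgebra.ι K (x i) ∈
      Submodule.span K (Set.range fun j => UniversalEnvelopingAlgebra.ι K (x j)) := by
  rw [← ι_lie]
  exact ι_mem_span_words x _

lemma mem_filt_of_symRel_zero {n : ℕ} {u : UniversalEnvelopingAlgebra K g}
    (hu : (u, (0 : MvPolynomial J K)) ∈ symRel x n) : u ∈ filt x n := by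
  classical
  let _ : LinearOrder J := linearOrderOfSTO (WellOrderingRel (α := J))
  let θ : MvPolynomial J K →ₗ[K] UniversalEnvelopingAlgebra K g :=
    (MvPolynomial.basisMonomials J K).constr K fun m =>
      ordProd (fun j => UniversalEnvelopingAlgebra.ι K (x j)) (Finsupp.toMultiset m)
  have hθ (m : Multiset J) : θ (symMonomial K m) =
      ordProd (fun j => UniversalEnvelopingAlgebra.ι K (x j)) m := by
    have := (MvPolynomial.basisMonomials J K).constr_basis K (fun m =>
      ordProd (fun j => UniversalEnvelopingAlgebra.ι K (x j)) (Finsupp.toMultiset m))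
      (Multiset.toFinsupp m)
    rw [MvPolynomial.coe_basisMonomials] at this
    simpa [symMonomial, θ] using this
  have key : symRel x n ≤ (filt x n).comap (LinearMap.fst K _ _ - θ ∘ₗ LinearMap.snd K _ _) := by
    refine Submodule.span_le.2 ?_
    rintro _ (⟨w, rfl, rfl⟩ | ⟨w, hw, rfl⟩)
    · simp only [Submodule.comap_coe, Set.mem_preimage, LinearMap.sub_apply, LinearMap.fst_apply,
        LinearMap.comp_apply, LinearMap.snd_apply, hθ]
      refine (?_ : lowSpan K _ _ ≤ filt x _) (prod_sub_ordProd_mem _ (word_comm_mem x) w)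
      exact Submodule.span_mono fun _ ⟨w, _, h, e⟩ => ⟨w, h, e⟩
    · simp only [Submodule.comap_coe, Set.mem_preimage, LinearMap.sub_apply, LinearMap.fst_apply,
        LinearMap.comp_apply, LinearMap.snd_apply, map_zero, sub_zero]
      exact Submodule.subset_span ⟨w, hw, rfl⟩
  simpa using key hu

lemma exists_mem_filt (u : UniversalEnvelopingAlgebra K g) : ∃ n, u ∈ filt x n := by
  have hmul : ∀ {a b}, (∃ n, a ∈ filt x n) → (∃ n, b ∈ filt x n) → ∃ n, a * b ∈ filt x n := by
    rintro a b ⟨m, ha⟩ ⟨n, hb⟩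
    refine ⟨m + n, mem_filt_of_symRel_zero x ?_⟩
    simpa using symRel_mul x (filt_mem_symRel x ha) (filt_mem_symRel x hb)
  have hsmul : ∀ c : K, ∃ n, algebraMap K (UniversalEnvelopingAlgebra K g) c ∈ filt x n := by
    intro c
    refine ⟨1, ?_⟩
    rw [Algebra.algebraMap_eq_smul_one]
    exact Submodule.smul_mem _ _ (Submodule.subset_span ⟨[], by simp, by simp [word]⟩)
  have hadd : ∀ {a b}, (∃ n, a ∈ filt x n) → (∃ n, b ∈ filt x n) → ∃ n, a + b ∈ filt x n := by
    rintro a b ⟨m, ha⟩ ⟨n, hb⟩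
    exact ⟨max m n, add_mem (filt_mono x (le_max_left _ _) ha) (filt_mono x (le_max_right _ _) hb)⟩
  have hι : ∀ y : g, ∃ n, UniversalEnvelopingAlgebra.ι K y ∈ filt x n := by
    intro y
    refine ⟨2, (Submodule.span_le.2 ?_ : _ ≤ filt x 2) (ι_mem_span_words x y)⟩
    rintro _ ⟨j, rfl⟩
    exact Submodule.subset_span ⟨[j], by simp, by simp [word]⟩
  have : u ∈ Algebra.adjoin K (Set.range (UniversalEnvelopingAlgebra.ι K (L := g))) := by
    rw [adjoin_range_ι]; trivial
  induction this using Algebra.adjoin_induction with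
  | mem r h => obtain ⟨y, rfl⟩ := h; exact hι y
  | algebraMap c => exact hsmul c
  | add a b _ _ ha hb => exact hadd ha hb
  | mul a b _ _ ha hb => exact hmul ha hb

end PBW

section PBWFaithful

variable {K : Type} [Field K] {g : Type} [LieRing g] [LieAlgebra K g]
variable {J : Type} (x : Module.Basis J K g) [DecidableEq J]
variable (E : Type) [AddCommGroup E] [Module K E] [LieRingModule g E] [LieModule K g E]

lemma eval_symMonomial (f : J → K) (w : List J) :
    MvPolynomial.eval f (symMonomial K (w : Multiset J)) = (w.map f).prod := by
  induction w with
  | nil => simp [symMonomial_zero]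
  | cons j w ih => rw [← Multiset.cons_coe, symMonomial_cons, map_mul, ih]; simp

lemma symRel_test (F : UniversalEnvelopingAlgebra K g →ₐ[K] Module.End K (CoeffRing K E))
    (hF : ∀ y, F (UniversalEnvelopingAlgebra.ι K y) =
      (coeffAction K g E y : Module.End K (CoeffRing K E)))
    {n : ℕ} {p : UniversalEnvelopingAlgebra K g × MvPolynomial J K} (hp : p ∈ symRel x n)
    {l : CoeffRing K E} (hl : coeffAug K E l = 0) :
    coeffAug K E (F p.1 (l ^ n)) =
      (n.factorial : K) * MvPolynomial.eval (fun j => coeffAug K E (coeffAction K g E (x j) l)) p.2 := by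
  have hI : l ∈ RingHom.ker (coeffAug K E) := hl
  have hword (w : List J) : F (word x w) =
      (w.map fun j => (coeffAction K g E (x j) : Module.End K (CoeffRing K E))).prod := by
    rw [word, map_list_prod, List.map_map]
    congr 1
    exact List.map_congr_left fun j _ => hF (x j)
  induction hp using Submodule.span_induction with
  | mem r h =>
    rcases h with ⟨w, rfl, rfl⟩ | ⟨w, hw, rfl⟩
    · have h := derivation_word_sub_mem (fun j => coeffAction K g E (x j)) _ hI w 0
      rw [zero_add, pow_one, RingHom.mem_ker, map_sub, sub_eq_zero, zero_add] at h
      rw [hword, h, Nat.descFactorial_self, pow_zero, one_mul, map_mul, map_natCast]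
      rw [eval_symMonomial, map_list_prod, List.map_map]
      rfl
    · obtain ⟨k, rfl⟩ := Nat.exists_eq_add_of_lt hw
      have h := derivation_word_sub_mem (fun j => coeffAction K g E (x j)) _ hI w (k + 1)
      have h2 := Ideal.pow_le_self (Nat.succ_ne_zero _) h
      rw [RingHom.mem_ker, map_sub, map_mul, map_mul, map_pow (coeffAug K E) l, hl, zero_pow (Nat.succ_ne_zero k),
        zero_mul, mul_zero, sub_zero] at h2
      rw [map_zero, mul_zero, hword, ← h2]
      congr 3
      ring
  | zero => simp
  | add a b _ _ ha hb => simp [ha, hb, mul_add]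
  | smul c a _ ha => simp [ha]; ring

lemma exists_envelope_coeffAction :
    ∃ F : UniversalEnvelopingAlgebra K g →ₐ[K] Module.End K (CoeffRing K E),
    ∀ y, F (UniversalEnvelopingAlgebra.ι K y) =
      (coeffAction K g E y : Module.End K (CoeffRing K E)) := by
  refine exists_envelope_hom
    { toFun := fun y => (coeffAction K g E y : Module.End K (CoeffRing K E))
      map_add' := fun a b => by ext; simp
      map_smul' := fun a b => by ext; simp } ?_
  intro a b
  refine LinearMap.ext fun v => ?_
  change coeffAction K g E ⁅a, b⁆ v = coeffAction K g E a (coeffAction K g E b v) -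
    coeffAction K g E b (coeffAction K g E a v)
  rw [LieHom.map_lie, Derivation.commutator_apply]

lemma exists_coeff_prescribed (hE : ∀ y : g, (∀ e : E, ⁅y, e⁆ = 0) → y = 0) (s : Finset J)
    (t : J → K) :
    ∃ l : CoeffRing K E, coeffAug K E l = 0 ∧
      ∀ j ∈ s, coeffAug K E (coeffAction K g E (x j) l) = t j := by
  let Φ : LinearMap.ker (coeffAug K E).toLinearMap →ₗ[K] (s → K) :=
    LinearMap.pi fun j => (coeffAug K E).toLinearMap ∘ₗ
      (coeffAction K g E (x j) : CoeffRing K E →ₗ[K] CoeffRing K E) ∘ₗ Submodule.subtype _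
  have hΦ : LinearMap.range Φ = ⊤ := by
    by_contra hne
    obtain ⟨f, hf0, hf⟩ := Submodule.exists_dual_map_eq_bot_of_lt_top (lt_top_iff_ne_top.2 hne)
      inferInstance
    have hfl : ∀ v : s → K, f v = ∑ j, v j * f (Pi.single j 1) := by
      intro v
      conv_lhs => rw [← Finset.univ_sum_single v, map_sum]
      refine Finset.sum_congr rfl fun j _ => ?_
      rw [← smul_eq_mul, ← map_smul]
      congr 1
      ext i
      simp [Pi.single_apply]
    have hy : ∑ j : s, f (Pi.single j 1) • x j = 0 := by
      by_contra hy
      obtain ⟨l, hl, hl2⟩ := exists_coeff_separating (K := K) (g := g) (E := E) hE hy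
      apply hl2
      have h1 : f (Φ ⟨l, hl⟩) = 0 := by
        have : f (Φ ⟨l, hl⟩) ∈ (LinearMap.range Φ).map f :=
          Submodule.mem_map_of_mem (LinearMap.mem_range_self _ _)
        rw [hf] at this
        exact this
      rw [hfl] at h1
      have hs : ∀ u : Finset s, coeffAction K g E (∑ j ∈ u, f (Pi.single j (1 : K)) • x (j : J)) l =
          ∑ j ∈ u, f (Pi.single j (1 : K)) • coeffAction K g E (x (j : J)) l := by
        intro u
        induction u using Finset.induction_on with
        | empty => simp
        | insert a u ha ih =>
          rw [Finset.sum_insert ha, Finset.sum_insert ha, map_add, Derivation.add_apply, ih,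
            map_smul, Derivation.smul_apply]
      rw [hs, ← h1, map_sum]
      refine Finset.sum_congr rfl fun j _ => ?_
      rw [map_smul, smul_eq_mul, mul_comm]
      rfl
    have hli : LinearIndependent K fun j : s => x j :=
      x.linearIndependent.comp _ Subtype.val_injective
    have h0 := Fintype.linearIndependent_iff.1 hli _ hy
    apply hf0
    refine LinearMap.ext fun v => ?_
    rw [hfl]
    simp [h0]
  obtain ⟨l, hl⟩ := LinearMap.range_eq_top.1 hΦ fun j => t j
  exact ⟨l, l.2, fun j hj => congrFun hl ⟨j, hj⟩⟩

variable [CharZero K]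

lemma symRel_zero (hE : ∀ y : g, (∀ e : E, ⁅y, e⁆ = 0) → y = 0) {n : ℕ} {P : MvPolynomial J K}
    (hP : ((0 : UniversalEnvelopingAlgebra K g), P) ∈ symRel x n) : P = 0 := by
  obtain ⟨F, hF⟩ := exists_envelope_coeffAction (K := K) (g := g) E
  refine MvPolynomial.funext fun t => ?_
  obtain ⟨l, hl, hlt⟩ := exists_coeff_prescribed x E hE P.vars t
  have h := symRel_test x E F hF hP hl
  simp only [map_zero, LinearMap.zero_apply] at h
  have h2 : MvPolynomial.eval (fun j => coeffAug K E (coeffAction K g E (x j) l)) P = 0 := by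
    rcases mul_eq_zero.1 h.symm with h | h
    · exact absurd h (by exact_mod_cast n.factorial_ne_zero)
    · exact h
  rw [map_zero, ← h2]
  refine MvPolynomial.eval₂Hom_congr' rfl (fun i hi _ => (hlt i hi).symm) rfl

/-- An enveloping algebra of a Lie algebra with a faithful representation has no zero divisors. -/
lemma envelope_mul_eq_zero (hE : ∀ y : g, (∀ e : E, ⁅y, e⁆ = 0) → y = 0)
    {u v : UniversalEnvelopingAlgebra K g} (h : u * v = 0) : u = 0 ∨ v = 0 := by
  classical
  let x := Module.Basis.ofVectorSpace K g
  by_contra! hne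
  have key : ∀ u : UniversalEnvelopingAlgebra K g, u ≠ 0 → ∃ n P, P ≠ 0 ∧ (u, P) ∈ symRel x n := by
    intro u hu
    have hex := exists_mem_filt x u
    have h1 := Nat.find_spec hex
    cases hn : Nat.find hex with
    | zero =>
      rw [hn] at h1
      refine absurd ?_ hu
      have : filt x 0 ≤ ⊥ := Submodule.span_le.2 fun _ ⟨w, hw, _⟩ => absurd hw (by simp)
      simpa using this h1
    | succ k =>
      rw [hn] at h1
      obtain ⟨P, hP⟩ := exists_symRel x h1
      refine ⟨k, P, ?_, hP⟩
      rintro rfl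
      exact Nat.find_min hex (m := k) (by omega) (mem_filt_of_symRel_zero x hP)
  obtain ⟨m, P, hP, hu⟩ := key u hne.1
  obtain ⟨n, Q, hQ, hv⟩ := key v hne.2
  have := symRel_mul x hu hv
  rw [Prod.mk_mul_mk, h] at this
  exact mul_ne_zero hP hQ (symRel_zero x E hE this)

section Triangular

variable {T : Type} (z : T → UniversalEnvelopingAlgebra K g) (d : T → Multiset J)

lemma linearIndependent_of_symRel (hE : ∀ y : g, (∀ e : E, ⁅y, e⁆ = 0) → y = 0)
    (hd : Function.Injective d)
    (hz : ∀ t, (z t, symMonomial K (d t)) ∈ symRel x (Multiset.card (d t))) :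
    LinearIndependent K z := by
  classical
  rw [linearIndependent_iff']
  by_contra! hcon
  obtain ⟨s, c, hs, i, hi, hci⟩ := hcon
  have hfilt : ∀ t n, Multiset.card (d t) < n → z t ∈ filt x n := by
    intro t n ht
    have key : ∀ p ∈ symRel x (Multiset.card (d t)), p.1 ∈ filt x (Multiset.card (d t) + 1) := by
      intro p hp
      induction hp using Submodule.span_induction with
      | mem r h =>
        rcases h with ⟨w, hw, rfl⟩ | ⟨w, hw, rfl⟩
        · exact Submodule.subset_span ⟨w, by omega, rfl⟩
        · exact Submodule.subset_span ⟨w, by omega, rfl⟩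
      | zero => exact zero_mem _
      | add a b _ _ ha hb => exact add_mem ha hb
      | smul c a _ ha => exact Submodule.smul_mem _ c ha
    exact filt_mono x (by omega) (key _ (hz t))
  obtain ⟨j, hj, hmax⟩ := (s.filter fun t => c t ≠ 0).exists_max_image
    (fun t => Multiset.card (d t)) ⟨i, by simp [hi, hci]⟩
  rw [Finset.mem_filter] at hj
  set n := Multiset.card (d j) with hn
  have h1 : (∑ t ∈ s, c t • z t, ∑ t ∈ s, (if Multiset.card (d t) = n then c t else 0) •
      symMonomial K (d t)) ∈ symRel x n := by
    have : (∑ t ∈ s, c t • z t, ∑ t ∈ s, (if Multiset.card (d t) = n then c t else 0) •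
      symMonomial K (d t)) = ∑ t ∈ s, (c t • z t, (if Multiset.card (d t) = n then c t else 0) •
      symMonomial K (d t)) := by
      ext1 <;> simp [Prod.fst_sum, Prod.snd_sum]
    rw [this]
    refine sum_mem fun t ht => ?_
    by_cases h0 : c t = 0
    · simp only [h0, zero_smul, ite_self]
      exact zero_mem (symRel x n)
    by_cases h : Multiset.card (d t) = n
    · rw [if_pos h]
      have := Submodule.smul_mem _ (c t) (hz t)
      rwa [h] at this
    · rw [if_neg h, zero_smul]
      refine filt_mem_symRel x (Submodule.smul_mem _ _ (hfilt t n ?_))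
      exact lt_of_le_of_ne (hmax t (by simp [ht, h0])) h
  rw [hs] at h1
  have h2 := symRel_zero x E hE h1
  have hli := (linearIndependent_symMonomial (K := K) (J := J)).comp d hd
  have h3 := linearIndependent_iff'.1 hli s _ h2 j hj.1
  rw [if_pos hn.symm] at h3
  exact hj.2 h3

lemma span_eq_top_of_symRel (hd : Function.Surjective d)
    (hz : ∀ t, (z t, symMonomial K (d t)) ∈ symRel x (Multiset.card (d t))) :
    Submodule.span K (Set.range z) = ⊤ := by
  have key : ∀ n, filt x n ≤ Submodule.span K (Set.range z) := by
    intro n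
    induction n with
    | zero => exact Submodule.span_le.2 fun _ ⟨w, hw, _⟩ => absurd hw (by simp)
    | succ n ih =>
      refine Submodule.span_le.2 ?_
      rintro _ ⟨w, hw, rfl⟩
      rcases (Nat.lt_succ_iff.1 hw).lt_or_eq with h | rfl
      · exact ih (Submodule.subset_span ⟨w, h, rfl⟩)
      · obtain ⟨t, ht⟩ := hd (w : Multiset J)
        have h1 := sub_mem (word_mem_symRel x w) (by simpa [ht] using hz t)
        rw [Prod.mk_sub_mk, sub_self] at h1
        have h2 := ih (mem_filt_of_symRel_zero x h1)
        rw [← sub_add_cancel (word x w) (z t)]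
        exact add_mem h2 (Submodule.subset_span ⟨t, rfl⟩)
  refine Submodule.eq_top_iff'.2 fun u => ?_
  obtain ⟨n, hn⟩ := exists_mem_filt x u
  exact key n hn

end Triangular

end PBWFaithful

section TriangularDecomposition

variable {K : Type} [Field K] {g : Type} [LieRing g] [LieAlgebra K g]

lemma ordProd_zero {R J : Type} [Ring R] [LinearOrder J] (x : J → R) : ordProd x 0 = 1 := by
  simp [ordProd]

section Words

variable {R T : Type} [Ring R] [Algebra K R]

/-- The span of all words in a family. -/
def wordSpan (K : Type) [Field K] {R T : Type} [Ring R] [Algebra K R] (y : T → R) :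
    Submodule K R :=
  Submodule.span K {r | ∃ w : List T, r = (w.map y).prod}

lemma wordSpan_mul (y : T → R) {a b : R} (ha : a ∈ wordSpan K y) (hb : b ∈ wordSpan K y) :
    a * b ∈ wordSpan K y := by
  have : wordSpan K y * wordSpan K y ≤ wordSpan K y := by
    rw [wordSpan, Submodule.span_mul_span, Submodule.span_le]
    rintro _ ⟨_, ⟨v, rfl⟩, _, ⟨w, rfl⟩, rfl⟩
    exact Submodule.subset_span ⟨v ++ w, by simp⟩
  exact this (Submodule.mul_mem_mul ha hb)

lemma adjoin_le_wordSpan (y : T → R) {s : Set R}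
    (hs : ∀ r ∈ s, r ∈ Submodule.span K (Set.range y)) {a : R} (ha : a ∈ Algebra.adjoin K s) :
    a ∈ wordSpan K y := by
  induction ha using Algebra.adjoin_induction with
  | mem r h =>
    refine (Submodule.span_le.2 ?_ : _ ≤ wordSpan K y) (hs r h)
    rintro _ ⟨t, rfl⟩
    exact Submodule.subset_span ⟨[t], by simp⟩
  | algebraMap c =>
    rw [Algebra.algebraMap_eq_smul_one]
    exact Submodule.smul_mem _ _ (Submodule.subset_span ⟨[], by simp⟩)
  | add a b _ _ ha hb => exact add_mem ha hb
  | mul a b _ _ ha hb => exact wordSpan_mul y ha hb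

lemma wordSpan_le_span_ordProd [LinearOrder T] (y : T → R)
    (hy : ∀ i j, y i * y j - y j * y i ∈ Submodule.span K (Set.range y)) :
    wordSpan K y ≤ Submodule.span K (Set.range (ordProd y)) := by
  refine Submodule.span_le.2 ?_
  rintro _ ⟨w, rfl⟩
  rcases eq_or_ne w [] with rfl | hw
  · exact Submodule.subset_span ⟨0, by simp [ordProd_zero]⟩
  · exact Submodule.span_mono (by rintro _ ⟨m, _, _, rfl⟩; exact ⟨m, rfl⟩)
      (prod_mem_span_ordProd y hy hw)

end Words

/-- The linear map `b ↦ b - χ(b)` into the enveloping algebra. -/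
def shiftMap (χ : Module.Dual K g) : g →ₗ[K] UniversalEnvelopingAlgebra K g :=
  ιLin - (Algebra.linearMap K _) ∘ₗ χ

lemma shiftMap_apply (χ : Module.Dual K g) (b : g) : shiftMap χ b =
    UniversalEnvelopingAlgebra.ι K b - algebraMap K _ (χ b) := rfl

lemma shiftMap_comm (χ : Module.Dual K g) (a b : g) (h : χ ⁅a, b⁆ = 0) :
    shiftMap χ a * shiftMap χ b - shiftMap χ b * shiftMap χ a = shiftMap χ ⁅a, b⁆ := by
  rw [shiftMap_apply χ ⁅a, b⁆, h, map_zero, sub_zero, ι_lie, shiftMap_apply, shiftMap_apply]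
  simp only [sub_mul, mul_sub, Algebra.commutes, ← map_mul, mul_comm (χ a) (χ b)]
  abel

lemma basis_map_mem_span {V W T : Type} [AddCommGroup V] [Module K V] [AddCommGroup W] [Module K W]
    (p : Submodule K V) (B : Module.Basis T K p) (f : V →ₗ[K] W) {v : V} (hv : v ∈ p) :
    f v ∈ Submodule.span K (Set.range fun t => f (B t)) := by
  have h : (⟨v, hv⟩ : p) ∈ Submodule.span K (Set.range B) := by rw [B.span_eq]; trivial
  have h := Submodule.mem_map_of_mem (f := f ∘ₗ p.subtype) h
  rw [Submodule.map_span, ← Set.range_comp] at h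
  exact h

lemma symRel_list {J T : Type} [DecidableEq J] (x : Module.Basis J K g)
    (y : T → UniversalEnvelopingAlgebra K g) (e : T → J)
    (hy : ∀ t, (y t, (MvPolynomial.X (e t) : MvPolynomial J K)) ∈ symRel x 1) (w : List T) :
    ((w.map y).prod, symMonomial K ((w : Multiset T).map e)) ∈ symRel x w.length := by
  induction w with
  | nil =>
    have := word_mem_symRel x ([] : List J)
    simpa [word] using this
  | cons t w ih =>
    have := symRel_mul x (hy t) ih
    rw [Prod.mk_mul_mk] at this
    rw [List.map_cons, List.prod_cons, ← Multiset.cons_coe, Multiset.map_cons, symMonomial_cons,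
      List.length_cons, add_comm]
    exact this

lemma symRel_ordProd {J T : Type} [DecidableEq J] [LinearOrder T] (x : Module.Basis J K g)
    (y : T → UniversalEnvelopingAlgebra K g) (e : T → J)
    (hy : ∀ t, (y t, (MvPolynomial.X (e t) : MvPolynomial J K)) ∈ symRel x 1) (m : Multiset T) :
    (ordProd y m, symMonomial K (m.map e)) ∈ symRel x (Multiset.card (m.map e)) := by
  have := symRel_list x y e hy (m.sort (· ≤ ·))
  rwa [Multiset.sort_eq, Multiset.length_sort, ← Multiset.card_map e] at this

lemma shiftMap_symRel {J : Type} [DecidableEq J] (x : Module.Basis J K g) (χ : Module.Dual K g)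
    (j : J) : (shiftMap χ (x j), (MvPolynomial.X j : MvPolynomial J K)) ∈ symRel x 1 := by
  have h1 := word_mem_symRel x [j]
  have h2 : (algebraMap K (UniversalEnvelopingAlgebra K g) (χ (x j)), (0 : MvPolynomial J K)) ∈
      symRel x 1 := by
    refine filt_mem_symRel x ?_
    rw [Algebra.algebraMap_eq_smul_one]
    exact Submodule.smul_mem _ _ (Submodule.subset_span ⟨[], by simp, by simp [word]⟩)
  have h3 := sub_mem h1 h2
  rw [Prod.mk_sub_mk, sub_zero] at h3
  convert h3 using 2
  · rfl
  · rw [shiftMap_apply, word, List.map_singleton, List.prod_singleton]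
  · exact (symMonomial_singleton j).symm

variable [CharZero K] (E : Type) [AddCommGroup E] [Module K E] [LieRingModule g E] [LieModule K g E]

/-- The left ideal generated by the elements `b - χ(b)`. -/
def inducedIdeal (bp : Submodule K g) (χ : Module.Dual K g) :
    Submodule (UniversalEnvelopingAlgebra K g) (UniversalEnvelopingAlgebra K g) :=
  Submodule.span _ (shiftMap χ '' bp)

variable {nm bp : Submodule K g} (χ : Module.Dual K g)

lemma triangular_decomposition (hE : ∀ y : g, (∀ e : E, ⁅y, e⁆ = 0) → y = 0)
    (hc : IsCompl nm bp) (hnm : ∀ a ∈ nm, ∀ b ∈ nm, ⁅a, b⁆ ∈ nm)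
    (hbp : ∀ a ∈ bp, ∀ b ∈ bp, ⁅a, b⁆ ∈ bp) (hχ : ∀ a ∈ bp, ∀ b ∈ bp, χ ⁅a, b⁆ = 0) :
    (∀ a ∈ Algebra.adjoin K (UniversalEnvelopingAlgebra.ι K '' (nm : Set g)),
      a ∈ inducedIdeal bp χ → a = 0) ∧
    ∀ u : UniversalEnvelopingAlgebra K g,
      ∃ a ∈ Algebra.adjoin K (UniversalEnvelopingAlgebra.ι K '' (nm : Set g)),
        u - a ∈ inducedIdeal bp χ := by
  classical
  let Bm := Module.Basis.ofVectorSpace K nm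
  let Bb := Module.Basis.ofVectorSpace K bp
  let _ : LinearOrder (Module.Basis.ofVectorSpaceIndex K nm) :=
    linearOrderOfSTO (WellOrderingRel (α := Module.Basis.ofVectorSpaceIndex K nm))
  let _ : LinearOrder (Module.Basis.ofVectorSpaceIndex K bp) :=
    linearOrderOfSTO (WellOrderingRel (α := Module.Basis.ofVectorSpaceIndex K bp))
  let x : Module.Basis (Module.Basis.ofVectorSpaceIndex K nm ⊕ Module.Basis.ofVectorSpaceIndex K bp) K g :=
    (Bm.prod Bb).map (Submodule.prodEquivOfIsCompl nm bp hc)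
  have hxl : ∀ j, x (Sum.inl j) = Bm j := fun j => by simp [x]
  have hxr : ∀ j, x (Sum.inr j) = Bb j := fun j => by simp [x]
  let y := fun j => ιLin (K := K) (Bm j : g)
  let β := fun j => shiftMap χ (Bb j : g)
  have hy : ∀ i j, y i * y j - y j * y i ∈ Submodule.span K (Set.range y) := by
    intro i j
    have : y i * y j - y j * y i = ιLin (K := K) ⁅(Bm i : g), (Bm j : g)⁆ := (ι_lie _ _).symm
    rw [this]
    exact basis_map_mem_span nm Bm ιLin (hnm _ (Bm i).2 _ (Bm j).2)
  have hβ : ∀ i j, β i * β j - β j * β i ∈ Submodule.span K (Set.range β) := by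
    intro i j
    rw [shiftMap_comm χ _ _ (hχ _ (Bb i).2 _ (Bb j).2)]
    exact basis_map_mem_span bp Bb _ (hbp _ (Bb i).2 _ (Bb j).2)
  let d : Multiset (Module.Basis.ofVectorSpaceIndex K nm) × Multiset (Module.Basis.ofVectorSpaceIndex K bp) →
      Multiset (Module.Basis.ofVectorSpaceIndex K nm ⊕ Module.Basis.ofVectorSpaceIndex K bp) :=
    fun p => p.1.map Sum.inl + p.2.map Sum.inr
  let z : Multiset (Module.Basis.ofVectorSpaceIndex K nm) × Multiset (Module.Basis.ofVectorSpaceIndex K bp) →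
      UniversalEnvelopingAlgebra K g := fun p => ordProd y p.1 * ordProd β p.2
  have hd_inj : Function.Injective d := by
    rintro ⟨a, c⟩ ⟨a', c'⟩ h
    simp only [d] at h
    ext j
    · have := congrArg (Multiset.count (Sum.inl j)) h
      simpa [Multiset.count_map_eq_count' _ _ Sum.inl_injective] using this
    · have := congrArg (Multiset.count (Sum.inr j)) h
      simpa [Multiset.count_map_eq_count' _ _ Sum.inr_injective] using this
  have hd_surj : Function.Surjective d := by
    intro m
    induction m using Multiset.induction_on with
    | empty => exact ⟨(0, 0), by simp [d]⟩
    | cons j m ih =>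
      obtain ⟨⟨a, c⟩, rfl⟩ := ih
      rcases j with j | j
      · exact ⟨(j ::ₘ a, c), by simp [d]⟩
      · exact ⟨(a, j ::ₘ c), by simp [d]⟩
  have hz : ∀ t, (z t, symMonomial K (d t)) ∈ symRel x (Multiset.card (d t)) := by
    rintro ⟨a, c⟩
    simp only [z, d, Multiset.card_add, symMonomial_add]
    refine symRel_mul x (symRel_ordProd x y Sum.inl (fun t => ?_) a)
      (symRel_ordProd x β Sum.inr (fun t => ?_) c)
    · have := shiftMap_symRel x 0 (Sum.inl t)
      rw [hxl] at this
      simpa [shiftMap] using this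
    · have := shiftMap_symRel x χ (Sum.inr t)
      rwa [hxr] at this
  have hli := linearIndependent_of_symRel x E z d hE hd_inj hz
  have hspan := span_eq_top_of_symRel x z d hd_surj hz
  have hA : ∀ a ∈ Algebra.adjoin K (UniversalEnvelopingAlgebra.ι K '' (nm : Set g)),
      a ∈ Submodule.span K (z '' {p | p.2 = 0}) := by
    intro a ha
    have h1 := wordSpan_le_span_ordProd y hy (adjoin_le_wordSpan y (by
      rintro _ ⟨v, hv, rfl⟩
      exact basis_map_mem_span nm Bm ιLin hv) ha)
    refine Submodule.span_mono ?_ h1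
    rintro _ ⟨m, rfl⟩
    exact ⟨(m, 0), rfl, by simp [z, ordProd_zero]⟩
  have hI : ∀ a ∈ inducedIdeal bp χ, a ∈ Submodule.span K (z '' {p | p.2 ≠ 0}) := by
    have hmul : ∀ u : UniversalEnvelopingAlgebra K g, ∀ b ∈ bp,
        u * shiftMap χ b ∈ Submodule.span K (z '' {p | p.2 ≠ 0}) := by
      intro u b hb
      have hu : u ∈ Submodule.span K (Set.range z) := by rw [hspan]; trivial
      have hb' := basis_map_mem_span bp Bb (shiftMap χ) hb
      have := Submodule.mul_mem_mul hu hb'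
      rw [Submodule.span_mul_span] at this
      refine (Submodule.span_le.2 ?_) this
      rintro _ ⟨_, ⟨⟨a, c⟩, rfl⟩, _, ⟨j, rfl⟩, rfl⟩
      have h1 : ordProd β c * β j = ((c.sort (· ≤ ·) ++ [j]).map β).prod := by
        simp [ordProd]
      have h2 := prod_mem_span_ordProd β hβ (w := c.sort (· ≤ ·) ++ [j]) (by simp)
      rw [← h1] at h2
      simp only [z, mul_assoc]
      change ordProd y a * (ordProd β c * β j) ∈ _
      generalize ordProd β c * β j = r at h2
      induction h2 using Submodule.span_induction with
      | mem r h =>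
        obtain ⟨m, hm, _, rfl⟩ := h
        exact Submodule.subset_span ⟨(a, m), hm, rfl⟩
      | zero => simp
      | add a b _ _ ha hb => rw [mul_add]; exact add_mem ha hb
      | smul c a _ ha => rw [mul_smul_comm]; exact Submodule.smul_mem _ c ha
    intro a ha
    refine Submodule.span_induction (p := fun a _ =>
      ∀ u : UniversalEnvelopingAlgebra K g, u * a ∈ Submodule.span K (z '' {p | p.2 ≠ 0}))
      ?_ ?_ ?_ ?_ ha 1 |> fun h => by rwa [one_mul] at h
    · rintro _ ⟨b, hb, rfl⟩ u
      exact hmul u b hb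
    · intro u; rw [mul_zero]; exact zero_mem _
    · intro a b _ _ ha hb u; rw [mul_add]; exact add_mem (ha u) (hb u)
    · intro v a _ ha u; rw [smul_eq_mul, ← mul_assoc]; exact ha _
  refine ⟨fun a ha haI => ?_, fun u => ?_⟩
  · have hdis := hli.disjoint_span_image (s := {p | p.2 = 0}) (t := {p | p.2 ≠ 0})
      (Set.disjoint_left.2 fun p h1 h2 => h2 h1)
    exact Submodule.disjoint_def.1 hdis a (hA a ha) (hI a haI)
  · have hu : u ∈ Submodule.span K (Set.range z) := by rw [hspan]; trivial
    induction hu using Submodule.span_induction with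
    | mem r h =>
      obtain ⟨⟨a, c⟩, rfl⟩ := h
      have hya : ordProd y a ∈ Algebra.adjoin K (UniversalEnvelopingAlgebra.ι K '' (nm : Set g)) := by
        refine list_prod_mem fun r hr => ?_
        obtain ⟨j, _, rfl⟩ := List.mem_map.1 hr
        exact Algebra.subset_adjoin ⟨_, (Bm j).2, rfl⟩
      rcases eq_or_ne c 0 with rfl | hc
      · exact ⟨ordProd y a, hya, by simp [z, ordProd_zero]⟩
      · refine ⟨0, zero_mem _, ?_⟩
        have hl : c.sort (· ≤ ·) ≠ [] := by
          intro h
          apply hc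
          rw [← Multiset.sort_eq c (· ≤ ·), h]; rfl
        obtain ⟨l, j, hlj⟩ := (List.eq_nil_or_concat' (c.sort (· ≤ ·))).resolve_left hl
        have : z (a, c) - 0 = (ordProd y a * (l.map β).prod) • β j := by
          simp only [z, ordProd]
          rw [hlj]
          simp [mul_assoc]
        rw [this]
        exact Submodule.smul_mem _ _ (Submodule.subset_span ⟨_, (Bb j).2, rfl⟩)
    | zero => exact ⟨0, zero_mem _, by simp⟩
    | add a b _ _ ha hb =>
      obtain ⟨a', ha', h1⟩ := ha
      obtain ⟨b', hb', h2⟩ := hb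
      exact ⟨a' + b', add_mem ha' hb', by rw [add_sub_add_comm]; exact add_mem h1 h2⟩
    | smul c a _ ha =>
      obtain ⟨a', ha', h1⟩ := ha
      exact ⟨c • a', Subalgebra.smul_mem _ ha' c, by
        rw [← smul_sub]; exact Submodule.smul_of_tower_mem _ c h1⟩

end TriangularDecomposition

section Ore

variable {K : Type} [Field K] {R T : Type} [Ring R] [Algebra K R]

/-- The span of words of length at most `n`. -/
def wordSpanLE (K : Type) [Field K] {R T : Type} [Ring R] [Algebra K R] (y : T → R) (n : ℕ) :
    Submodule K R :=
  Submodule.span K {r | ∃ w : List T, w.length ≤ n ∧ r = (w.map y).prod}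

lemma wordSpanLE_mul (y : T → R) {m n : ℕ} {a b : R} (ha : a ∈ wordSpanLE K y m)
    (hb : b ∈ wordSpanLE K y n) : a * b ∈ wordSpanLE K y (m + n) := by
  have : wordSpanLE K y m * wordSpanLE K y n ≤ wordSpanLE K y (m + n) := by
    rw [wordSpanLE, wordSpanLE, Submodule.span_mul_span, Submodule.span_le]
    rintro _ ⟨_, ⟨v, hv, rfl⟩, _, ⟨w, hw, rfl⟩, rfl⟩
    exact Submodule.subset_span ⟨v ++ w, by simp; omega, by simp⟩
  exact this (Submodule.mul_mem_mul ha hb)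

lemma wordSpanLE_mono (y : T → R) {m n : ℕ} (h : m ≤ n) : wordSpanLE K y m ≤ wordSpanLE K y n :=
  Submodule.span_mono fun _ ⟨w, hw, e⟩ => ⟨w, hw.trans h, e⟩

lemma wordSpanLE_le (y : T → R) (n : ℕ) : wordSpanLE K y n ≤ wordSpan K y :=
  Submodule.span_mono fun _ ⟨w, _, e⟩ => ⟨w, e⟩

lemma exists_mem_wordSpanLE (y : T → R) {a : R} (ha : a ∈ wordSpan K y) :
    ∃ n, a ∈ wordSpanLE K y n := by
  induction ha using Submodule.span_induction with
  | mem r h => obtain ⟨w, rfl⟩ := h; exact ⟨w.length, Submodule.subset_span ⟨w, le_rfl, rfl⟩⟩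
  | zero => exact ⟨0, zero_mem _⟩
  | add a b _ _ ha hb =>
    obtain ⟨m, ha⟩ := ha
    obtain ⟨n, hb⟩ := hb
    exact ⟨max m n, add_mem (wordSpanLE_mono y (le_max_left _ _) ha)
      (wordSpanLE_mono y (le_max_right _ _) hb)⟩
  | smul c a _ ha => obtain ⟨n, ha⟩ := ha; exact ⟨n, Submodule.smul_mem _ c ha⟩

lemma wordSpanLE_le_span [LinearOrder T] [Fintype T] (y : T → R)
    (hy : ∀ i j, y i * y j - y j * y i ∈ Submodule.span K (Set.range y)) (n : ℕ) :
    wordSpanLE K y n ≤ Submodule.span K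
      (Set.range fun c : T → Fin (n + 1) => ordProd y (∑ t, (c t : ℕ) • {t})) := by
  refine Submodule.span_le.2 ?_
  rintro _ ⟨w, hw, rfl⟩
  have key : ∀ m : Multiset T, Multiset.card m ≤ n →
      ordProd y m ∈ Set.range fun c : T → Fin (n + 1) => ordProd y (∑ t, (c t : ℕ) • {t}) := by
    intro m hm
    refine ⟨fun t => ⟨m.count t, Nat.lt_succ_of_le ((Multiset.count_le_card t m).trans hm)⟩, ?_⟩
    refine congrArg (ordProd y) (Multiset.ext.2 fun t => ?_)
    rw [Multiset.count_sum']
    simp [Multiset.count_singleton]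
  rcases eq_or_ne w [] with rfl | hne
  · exact Submodule.subset_span (by simpa [ordProd_zero] using key 0 (by simp))
  · refine Submodule.span_mono ?_ (prod_mem_span_ordProd y hy hne)
    rintro _ ⟨m, _, hm, rfl⟩
    exact key m (hm.trans hw)

lemma exists_pow_lt_two_pow (r d : ℕ) : ∃ j : ℕ, (j * r + 1) ^ d < 2 ^ j := by
  have h := tendsto_pow_const_div_const_pow_of_one_lt d (r := (2 : ℝ)) (by norm_num)
  have h2 := h.eventually (gt_mem_nhds (show (0 : ℝ) < 1 / (r + 1) ^ d by positivity))
  obtain ⟨j, hj, hj1⟩ := (h2.and (Filter.eventually_ge_atTop 1)).exists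
  refine ⟨j, ?_⟩
  rw [div_lt_div_iff₀ (by positivity) (by positivity), one_mul, ← mul_pow] at hj
  have h3 : ((j * r + 1 : ℕ) : ℝ) ^ d < 2 ^ j := by
    refine lt_of_le_of_lt ?_ hj
    gcongr
    have : (1 : ℝ) ≤ j := by exact_mod_cast hj1
    push_cast
    linarith
  exact_mod_cast h3

lemma exists_common_multiple [Finite T] (hR : ∀ a b : R, a * b = 0 → a = 0 ∨ b = 0) (y : T → R)
    (hy : ∀ i j, y i * y j - y j * y i ∈ Submodule.span K (Set.range y))
    {u v : R} (hu : u ∈ wordSpan K y) (hv : v ∈ wordSpan K y) (hu0 : u ≠ 0) (hv0 : v ≠ 0) :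
    ∃ a ∈ wordSpan K y, ∃ b ∈ wordSpan K y, a * u = b * v ∧ a * u ≠ 0 := by
  classical
  let _ : LinearOrder T := linearOrderOfSTO (WellOrderingRel (α := T))
  let _ := Fintype.ofFinite T
  by_contra! hcon
  have hfd : ∀ n, FiniteDimensional K (wordSpanLE K y n) := fun n => by
    have := FiniteDimensional.span_of_finite K (Set.finite_range
      fun c : T → Fin (n + 1) => ordProd y (∑ t, (c t : ℕ) • {t}))
    exact Submodule.finiteDimensional_of_le (wordSpanLE_le_span y hy n)
  have hbound : ∀ n, Module.finrank K (wordSpanLE K y n) ≤ (n + 1) ^ Fintype.card T := by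
    intro n
    have := FiniteDimensional.span_of_finite K (Set.finite_range
      fun c : T → Fin (n + 1) => ordProd y (∑ t, (c t : ℕ) • {t}))
    refine (Submodule.finrank_mono (wordSpanLE_le_span y hy n)).trans ?_
    refine (finrank_range_le_card _).trans ?_
    simp
  obtain ⟨r1, hr1⟩ := exists_mem_wordSpanLE y hu
  obtain ⟨r2, hr2⟩ := exists_mem_wordSpanLE y hv
  set r := max r1 r2
  have hur := wordSpanLE_mono y (le_max_left r1 r2) hr1
  have hvr := wordSpanLE_mono y (le_max_right r1 r2) hr2
  have hstep : ∀ n, 2 * Module.finrank K (wordSpanLE K y n) ≤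
      Module.finrank K (wordSpanLE K y (n + r)) := by
    intro n
    let φ : (wordSpanLE K y n × wordSpanLE K y n) →ₗ[K] wordSpanLE K y (n + r) :=
      LinearMap.codRestrict _
        (LinearMap.coprod ((LinearMap.mulRight K u) ∘ₗ Submodule.subtype _)
          ((LinearMap.mulRight K v) ∘ₗ Submodule.subtype _)) (fun p => by
            simpa using add_mem (wordSpanLE_mul y p.1.2 hur) (wordSpanLE_mul y p.2.2 hvr))
    have hφ : Function.Injective φ := by
      rw [← LinearMap.ker_eq_bot, LinearMap.ker_eq_bot']
      rintro ⟨a, b⟩ hab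
      have h1 : (a : R) * u + b * v = 0 := by simpa [φ] using congrArg Subtype.val hab
      have h2 : (a : R) * u = (-(b : R)) * v := by rw [neg_mul]; exact eq_neg_of_add_eq_zero_left h1
      have h3 := hcon a (wordSpanLE_le y n a.2) _ (neg_mem (wordSpanLE_le y n b.2)) h2
      rw [h3, zero_add] at h1
      have ha := (hR _ _ h3).resolve_right hu0
      have hb := (hR _ _ h1).resolve_right hv0
      ext <;> simp [ha, hb]
    have := LinearMap.finrank_le_finrank_of_injective hφ
    rwa [Module.finrank_prod, ← two_mul] at this
  have h0 : 1 ≤ Module.finrank K (wordSpanLE K y 0) := by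
    rw [Nat.one_le_iff_ne_zero, ← Nat.pos_iff_ne_zero, Module.finrank_pos_iff_exists_ne_zero]
    refine ⟨⟨1, Submodule.subset_span ⟨[], by simp, by simp⟩⟩, fun h => hu0 ?_⟩
    have : (1 : R) = 0 := congrArg Subtype.val h
    rw [← one_mul u, this, zero_mul]
  have hgrow : ∀ j, 2 ^ j ≤ Module.finrank K (wordSpanLE K y (j * r)) := by
    intro j
    induction j with
    | zero => simpa using h0
    | succ j ih =>
      rw [pow_succ, mul_comm, add_mul, one_mul]
      exact (Nat.mul_le_mul_left 2 ih).trans (hstep _)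
  obtain ⟨j, hj⟩ := exists_pow_lt_two_pow r (Fintype.card T)
  exact absurd ((hgrow j).trans (hbound _)) (not_le.2 hj)

end Ore

section AbelianIdealsCentral

variable {K : Type} [Field K] [IsAlgClosed K] [CharZero K]
variable {L : Type} [LieRing L] [LieAlgebra K L] [FiniteDimensional K L]

open LieAlgebra LieModule

lemma mem_center_iff {x : L} : x ∈ center K L ↔ ∀ y : L, ⁅x, y⁆ = 0 := by
  rw [center, LieModule.mem_maxTrivSubmodule]
  refine forall_congr' fun y => ?_
  rw [← lie_skew, neg_eq_zero]

/-- The theorem of Lie, relative to an ideal and modulo the center. -/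
lemma exists_weight_ideal (B Y : LieIdeal K L) [IsSolvable B] (hY : ¬ Y ≤ center K L) :
    ∃ (χ : B → K) (W : LieIdeal K L), W ≤ Y ∧ ¬ W ≤ center K L ∧
      ∀ b : B, ∀ w ∈ W, ⁅(b : L), w⁆ - χ b • w ∈ center K L := by
  let V : LieSubmodule K L (L ⧸ center K L) := LieSubmodule.map (LieSubmodule.Quotient.mk' (center K L)) Y
  have hV : Nontrivial V := by
    rw [LieSubmodule.nontrivial_iff_ne_bot]
    intro h
    refine hY fun y hy => ?_
    have : (LieSubmodule.Quotient.mk' (center K L)) y ∈ V := LieSubmodule.mem_map_of_mem hy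
    rw [h, LieSubmodule.mem_bot] at this
    exact (LieSubmodule.Quotient.mk_eq_zero _).1 this
  obtain ⟨χ, hχ⟩ := exists_nontrivial_weightSpace_of_isSolvable K B V
  let V' : LieSubmodule K L V := weightSpaceOfIsLieTower K V χ
  refine ⟨χ, Y ⊓ (V'.map V.incl).comap (LieSubmodule.Quotient.mk' (center K L)),
    inf_le_left, fun h => ?_, ?_⟩
  · obtain ⟨⟨⟨v, hv⟩, hvV⟩, hne⟩ := exists_ne (0 : weightSpace V χ)
    obtain ⟨y, hy, rfl⟩ := (LieSubmodule.mem_map _).1 hv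
    have hmem : y ∈ Y ⊓ (V'.map V.incl).comap (LieSubmodule.Quotient.mk' (center K L)) :=
      ⟨hy, (LieSubmodule.mem_map _).2 ⟨_, hvV, rfl⟩⟩
    exact hne (Subtype.ext (Subtype.ext ((LieSubmodule.Quotient.mk_eq_zero _).2 (h hmem))))
  · rintro b w ⟨-, hw⟩
    obtain ⟨v, hv, hvw⟩ := (LieSubmodule.mem_map _).1 (LieSubmodule.mem_comap.1 hw)
    have h1 : ⁅b, v⁆ = χ b • v := (mem_weightSpace _ _).1 hv b
    have h2 := congrArg V.incl h1
    rw [map_smul, hvw] at h2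
    have h3 : V.incl ⁅b, v⁆ = ⁅(b : L), V.incl v⁆ := rfl
    rw [h3, hvw, ← LieModuleHom.map_lie, ← map_smul] at h2
    rw [← sub_eq_zero, ← map_sub] at h2
    exact (LieSubmodule.Quotient.mk_eq_zero _).1 h2

variable (hab : ∀ I : LieIdeal K L, IsLieAbelian I → I ≤ center K L)

include hab

lemma le_center_of_lie_eq_zero (I : LieIdeal K L) (hI : ∀ x ∈ I, ∀ y ∈ I, ⁅x, y⁆ = 0) :
    I ≤ center K L := by
  refine hab I ⟨fun x y => Subtype.ext ?_⟩
  exact hI x x.2 y y.2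

lemma derived_le_center_step (B : LieIdeal K L) [IsSolvable B]
    (hBB : ⁅⁅B, B⁆, ⁅B, B⁆⁆ ≤ center K L) : ⁅B, B⁆ ≤ center K L := by
  set A : LieIdeal K L := ⁅B, B⁆ with hA
  have hAA : ∀ x ∈ A, ∀ y ∈ A, ∀ z : L, ⁅⁅x, y⁆, z⁆ = 0 := fun x hx y hy z =>
    mem_center_iff.1 (hBB (LieSubmodule.lie_mem_lie hx hy)) z
  have hYA : ⁅B, A⁆ ≤ A := LieSubmodule.lie_le_right _ _
  have hY : ⁅B, A⁆ ≤ center K L := by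
    by_contra hcon
    obtain ⟨χ, W, hWY, hWZ, hW⟩ := exists_weight_ideal B ⁅B, A⁆ hcon
    refine hWZ (le_center_of_lie_eq_zero hab W fun x hx y hy => ?_)
    by_cases hχ : χ = 0
    · have : ∀ y ∈ ⁅B, A⁆, ⁅x, y⁆ = 0 := by
        intro y hy
        rw [← LieSubmodule.mem_toSubmodule, LieSubmodule.lieIdeal_oper_eq_linear_span'] at hy
        refine Submodule.span_induction (p := fun y _ => ⁅x, y⁆ = 0) ?_ ?_ ?_ ?_ hy
        · rintro _ ⟨b, hb, a, ha, rfl⟩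
          have h1 : ⁅b, x⁆ ∈ center K L := by simpa [hχ] using hW ⟨b, hb⟩ x hx
          have h2 : ⁅⁅x, a⁆, b⁆ = 0 := hAA x (hYA (hWY hx)) a ha b
          rw [leibniz_lie, ← lie_skew x b, neg_lie, mem_center_iff.1 h1, neg_zero, zero_add,
            ← lie_skew, h2, neg_zero]
        · simp
        · intro a b _ _ ha hb; rw [lie_add, ha, hb, add_zero]
        · intro c a _ ha; rw [lie_smul, ha, smul_zero]
      exact this y (hWY hy)
    · obtain ⟨b, hb⟩ : ∃ b, χ b ≠ 0 := by
        by_contra hh; push Not at hh; exact hχ (funext hh)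
      have h0 : ⁅(b : L), ⁅x, y⁆⁆ = 0 := by
        rw [← lie_skew, hAA x (hYA (hWY hx)) y (hYA (hWY hy)), neg_zero]
      have hx' := mem_center_iff.1 (hW b x hx) y
      have hy' := mem_center_iff.1 (hW b y hy) x
      rw [sub_lie, smul_lie, sub_eq_zero] at hx' hy'
      rw [leibniz_lie, hx', ← lie_skew x ⁅(b : L), y⁆, hy', ← lie_skew x y, smul_neg,
        ← neg_add, neg_eq_zero, ← two_smul K, smul_smul, smul_eq_zero] at h0
      rcases h0 with h0 | h0
      · exact absurd h0 (by simpa using hb)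
      · rw [← lie_skew, h0, neg_zero]
  refine le_center_of_lie_eq_zero hab A fun x hx y hy => ?_
  rw [hA, ← LieSubmodule.mem_toSubmodule, LieSubmodule.lieIdeal_oper_eq_linear_span'] at hx
  refine Submodule.span_induction (p := fun x _ => ⁅x, y⁆ = 0) ?_ ?_ ?_ ?_ hx
  · rintro _ ⟨b, hb, b', hb', rfl⟩
    have h1 := mem_center_iff.1 (hY (LieSubmodule.lie_mem_lie hb' hy)) b
    have h2 := mem_center_iff.1 (hY (LieSubmodule.lie_mem_lie hb hy)) b'
    rw [lie_lie, ← lie_skew, h1, ← lie_skew b', h2]; simp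
  · simp
  · intro a b _ _ ha hb; rw [add_lie, ha, hb, add_zero]
  · intro c a _ ha; rw [smul_lie, ha, smul_zero]

lemma radical_lie_radical_le_center : ⁅radical K L, radical K L⁆ ≤ center K L := by
  set R := radical K L
  have hsolv : ∀ k, IsSolvable (derivedSeriesOfIdeal K L k R) := fun k =>
    (LieIdeal.solvable_iff_le_radical K L _).2
      ((derivedSeriesOfIdeal_le_self R k))
  have hk : ∃ k, derivedSeriesOfIdeal K L (k + 1) R ≤ center K L := by
    obtain ⟨k, hk⟩ := (LieAlgebra.isSolvable_iff K R).1 (radicalIsSolvable K L)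
    refine ⟨k, ?_⟩
    have h0 : derivedSeriesOfIdeal K L k R = ⊥ := by
      rw [LieIdeal.derivedSeries_eq_bot_iff] at hk; exact hk
    rw [derivedSeriesOfIdeal_succ, h0]; simp
  obtain ⟨k, hk⟩ := hk
  induction k with
  | zero => simpa using hk
  | succ k ih =>
    refine ih ?_
    have := hsolv k
    rw [derivedSeriesOfIdeal_succ]
    refine derived_le_center_step hab _ ?_
    simpa [derivedSeriesOfIdeal_succ] using hk

end AbelianIdealsCentral

section PrincipalTriple

open LieAlgebra LieAlgebra.IsKilling LieModule Module

variable {K : Type} [Field K] [CharZero K] [IsAlgClosed K]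
variable {s : Type} [LieRing s] [LieAlgebra K s] [FiniteDimensional K s] [IsKilling K s]
variable (H : LieSubalgebra K s) [H.IsCartanSubalgebra]

/-- The principal `sl₂`-triple: its neutral element has nonzero even integer values on roots. -/
lemma exists_principal_triple :
    ∃ (h : H) (e f : s), ⁅e, f⁆ = (h : s) ∧ ⁅(h : s), e⁆ = (2 : K) • e ∧
      ⁅(h : s), f⁆ = (-2 : K) • f ∧
      ∀ α : Weight K H s, α.IsNonZero → ∃ n : ℤ, n ≠ 0 ∧ α h = 2 * n := by
  classical
  obtain ⟨B⟩ := (rootSystem H).nonempty_base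
  have hsl : ∀ i : H.root, ∃ e ∈ rootSpace H i.1, ∃ f ∈ rootSpace H (-i.1),
      ⁅e, f⁆ = (coroot i.1 : s) := by
    intro i
    have hi := LieSubalgebra.isNonZero_coe_root i
    obtain ⟨h, e, f, ht, he, hf⟩ := exists_isSl2Triple_of_weight_isNonZero hi
    refine ⟨e, he, f, hf, ?_⟩
    rw [ht.lie_e_f, ht.h_eq_coroot hi he hf]
  choose e he f hf hef using hsl
  let φ : Dual K (Dual K H) := B.toWeightBasis.constr K fun _ => (2 : K)
  let h : H := (evalEquiv K H).symm φ
  have hφ : ∀ l : Dual K H, l h = φ l := fun l => by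
    rw [← apply_evalEquiv_symm_apply]
  have hbase : ∀ i ∈ B.support, i.1 h = 2 := by
    intro i hi
    have h1 : B.toWeightBasis ⟨i, hi⟩ = i.1.toLinear := by
      rw [RootPairing.Base.toWeightBasis_apply]; rfl
    have h2 := hφ (B.toWeightBasis ⟨i, hi⟩)
    rw [Basis.constr_basis, h1] at h2
    exact h2
  let c : H.root → K := fun i => if hi : i ∈ B.support then B.toCoweightBasis.repr h ⟨i, hi⟩ else 0
  have hc : (h : s) = ∑ i ∈ B.support, c i • (coroot i.1 : s) := by
    have h1 := B.toCoweightBasis.sum_repr h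
    have h2 := congrArg (fun x : H => (x : s)) h1.symm
    simp only [RootPairing.Base.toCoweightBasis_apply] at h2
    rw [h2, ← Finset.sum_coe_sort B.support, AddSubmonoidClass.coe_finsetSum]
    refine Finset.sum_congr rfl fun i _ => ?_
    simp [c, rootSystem_coroot_apply]
  refine ⟨h, ∑ i ∈ B.support, e i, ∑ i ∈ B.support, c i • f i, ?_, ?_, ?_, ?_⟩
  · rw [hc, sum_lie]
    refine Finset.sum_congr rfl fun i hi => ?_
    rw [lie_sum, Finset.sum_eq_single_of_mem i hi]
    · rw [lie_smul, hef]
    · intro j hj hji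
      rw [lie_smul]
      have hmem : ⁅e i, f j⁆ ∈ rootSpace H ((i.1 : H → K) + (-j.1 : H → K)) :=
        lie_mem_genWeightSpace_of_mem_genWeightSpace (he i) (hf j)
      by_cases hbot : rootSpace H ((i.1 : H → K) + (-j.1 : H → K)) = ⊥
      · rw [hbot, LieSubmodule.mem_bot] at hmem
        rw [hmem, smul_zero]
      · exfalso
        let w : Weight K H s := ⟨_, hbot⟩
        have hw : w.IsNonZero := by
          intro h0
          apply hji
          have h3 : ∀ x, i.1 x - j.1 x = 0 := fun x => by
            have := congrFun h0 x
            simpa [w, sub_eq_add_neg] using this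
          exact (Subtype.ext (Weight.ext fun x => (sub_eq_zero.1 (h3 x)))).symm
        refine B.sub_notMem_range_root hi hj ⟨⟨w, by simpa using hw⟩, ?_⟩
        ext x
        simp [w, sub_eq_add_neg]
  · rw [lie_sum, Finset.smul_sum]
    refine Finset.sum_congr rfl fun i hi => ?_
    rw [← hbase i hi]
    exact lie_eq_smul_of_mem_rootSpace (he i) h
  · rw [lie_sum, Finset.smul_sum]
    refine Finset.sum_congr rfl fun i hi => ?_
    rw [lie_smul, smul_comm]
    congr 1
    have := lie_eq_smul_of_mem_rootSpace (hf i) h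
    rw [show (-i.1 : H → K) h = -2 by simp [hbase i hi]] at this
    exact this
  · intro α hα
    let i : H.root := ⟨α, by simpa using hα⟩
    obtain ⟨q, -, -, hq⟩ := B.exists_root_eq_sum_int i
    refine ⟨B.height i, B.height_ne_zero i, ?_⟩
    rw [RootPairing.Base.height_eq_sum hq]
    have h1 := congrArg (fun l : Dual K H => l h) hq
    simp only [rootSystem_root_apply, LinearMap.sum_apply, LinearMap.smul_apply] at h1
    have h2 : α h = ∑ j ∈ B.support, q j • (2 : K) := by
      refine Eq.trans ?_ (h1.trans (Finset.sum_congr rfl fun j hj => ?_))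
      · rfl
      · rw [← hbase j hj]; rfl
    rw [h2]
    push_cast
    rw [Finset.mul_sum]
    exact Finset.sum_congr rfl fun j _ => by rw [zsmul_eq_mul, mul_comm]

end PrincipalTriple

section SymplecticModule

open LieAlgebra LieAlgebra.IsKilling LieModule Module

variable {K : Type} [Field K] [CharZero K] [IsAlgClosed K]
variable {s : Type} [LieRing s] [LieAlgebra K s]
variable {V : Type} [AddCommGroup V] [Module K V] [LieRingModule s V] [LieModule K s V]
variable [FiniteDimensional K V]
variable {Z : Type} [AddCommGroup Z] [Module K Z] (ω : V →ₗ[K] V →ₗ[K] Z)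

/-- The words in elements of `N` applied to `v`. -/
def moduleWord {N : Set s} (v : V) : List N → V
  | [] => v
  | x :: l => ⁅(x : s), moduleWord v l⁆

/-- If `N` together with the elements preserving the line of `v` spans the Lie algebra,
the words in `N` applied to `v` span a submodule. -/
def wordSubmodule {N : Set s} (v : V)
    (hN : ∀ y : s, y ∈ Submodule.span K (N ∪ {y : s | ⁅y, v⁆ ∈ Submodule.span K {v}})) :
    LieSubmodule K s V where
  toSubmodule := Submodule.span K (Set.range (moduleWord (N := N) v))
  lie_mem := by
    set W := Submodule.span K (Set.range (moduleWord (N := N) v)) with hW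
    have hv : v ∈ W := Submodule.subset_span ⟨[], rfl⟩
    have hNW : ∀ x ∈ N, ∀ w ∈ W, ⁅x, w⁆ ∈ W := by
      intro x hx w hw
      induction hw using Submodule.span_induction with
      | mem w hw =>
        obtain ⟨l, rfl⟩ := hw
        exact Submodule.subset_span ⟨⟨x, hx⟩ :: l, rfl⟩
      | zero => simp
      | add a b _ _ ha hb => rw [lie_add]; exact add_mem ha hb
      | smul c a _ ha => rw [lie_smul]; exact W.smul_mem c ha
    have key : ∀ (l : List N) (y : s), ⁅y, moduleWord v l⁆ ∈ W := by
      intro l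
      induction l with
      | nil =>
        intro y
        refine Submodule.span_induction (p := fun y _ => ⁅y, v⁆ ∈ W) ?_ ?_ ?_ ?_ (hN y)
        · rintro y (hy | hy)
          · exact hNW y hy v hv
          · exact (Submodule.span_le.2 (Set.singleton_subset_iff.2 hv) :
              Submodule.span K {v} ≤ W) hy
        · simp
        · intro a b _ _ ha hb; rw [add_lie]; exact add_mem ha hb
        · intro c a _ ha; rw [smul_lie]; exact W.smul_mem c ha
      | cons x l ih =>
        intro y
        change ⁅y, ⁅(x : s), moduleWord v l⁆⁆ ∈ W
        rw [leibniz_lie]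
        exact add_mem (ih _) (hNW x x.2 _ (ih y))
    intro y w hw
    change ⁅y, w⁆ ∈ W
    replace hw : w ∈ W := hw
    induction hw using Submodule.span_induction with
    | mem w hw => obtain ⟨l, rfl⟩ := hw; exact key l y
    | zero => simp
    | add a b _ _ ha hb => rw [lie_add]; exact add_mem ha hb
    | smul c a _ ha => rw [lie_smul]; exact W.smul_mem c ha

variable (hinv : ∀ (x : s) (v w : V), ω ⁅x, v⁆ w = - ω v ⁅x, w⁆)

/-- The orthogonal of a submodule for an invariant form. -/
def orthSubmodule (ω : V →ₗ[K] V →ₗ[K] Z) (hinv : ∀ (x : s) (v w : V), ω ⁅x, v⁆ w = - ω v ⁅x, w⁆)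
    (W : LieSubmodule K s V) : LieSubmodule K s V where
  carrier := {v | ∀ w ∈ W, ω v w = 0}
  add_mem' := fun ha hb w hw => by rw [map_add, LinearMap.add_apply, ha w hw, hb w hw, add_zero]
  zero_mem' := fun w _ => by simp
  smul_mem' := fun c x hx w hw => by rw [map_smul, LinearMap.smul_apply, hx w hw, smul_zero]
  lie_mem := by
    intro x v hv w hw
    rw [hinv, hv _ (W.lie_mem hw), neg_zero]

variable (halt : ∀ v, ω v v = 0)
variable (hiso : ∀ W : LieSubmodule K s V, (∀ v ∈ W, ∀ w ∈ W, ω v w = 0) → W = ⊥)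

include hinv hiso

lemma eq_zero_of_orthogonal (W : LieSubmodule K s V) {v : V} (hvW : v ∈ W)
    (hv : ∀ w ∈ W, ω v w = 0) : v = 0 := by
  have h := hiso (W ⊓ orthSubmodule ω hinv W) fun a ha b hb => ha.2 b hb.1
  have hmem : v ∈ W ⊓ orthSubmodule ω hinv W := ⟨hvW, hv⟩
  rwa [h, LieSubmodule.mem_bot] at hmem

include halt

lemma form_pow_eq_zero (f : s) (v : V) {m : ℕ} (hm : Even m) :
    ω v ((toEnd K s V f ^ m) v) = 0 := by
  have h1 : ∀ (k : ℕ) (a b : V), ω a ((toEnd K s V f ^ k) b) =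
      (-1 : ℤ) ^ k • ω ((toEnd K s V f ^ k) a) b := by
    intro k
    induction k with
    | zero => simp
    | succ k ih =>
      intro a b
      have h2 : (toEnd K s V f ^ (k + 1)) a = (toEnd K s V f ^ k) ⁅f, a⁆ := by
        rw [pow_succ, Module.End.mul_apply, toEnd_apply_apply]
      rw [h2, pow_succ', Module.End.mul_apply, toEnd_apply_apply,
        ← neg_neg (ω a ⁅f, _⁆), ← hinv f a, ih, pow_succ]
      simp
  have h2 := h1 m v v
  rw [hm.neg_one_pow, one_smul] at h2
  have h3 := halt (v + (toEnd K s V f ^ m) v)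
  simp only [map_add, LinearMap.add_apply, halt, zero_add, add_zero] at h3
  rw [← h2, ← two_smul K, smul_eq_zero] at h3
  exact h3.resolve_left two_ne_zero

end SymplecticModule

section Parity

open LieAlgebra LieModule Module

variable {K : Type} [Field K] [CharZero K] [IsAlgClosed K]
variable {s : Type} [LieRing s] [LieAlgebra K s]
variable {V : Type} [AddCommGroup V] [Module K V] [LieRingModule s V] [LieModule K s V]

lemma lie_lie_of_eigen {h x : s} {v : V} {a b : K} (hx : ⁅h, x⁆ = a • x) (hv : ⁅h, v⁆ = b • v) :
    ⁅h, ⁅x, v⁆⁆ = (a + b) • ⁅x, v⁆ := by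
  rw [leibniz_lie, hx, hv, smul_lie, lie_smul, add_smul]

variable [FiniteDimensional K V]

lemma finite_even_eigenvalues (h : s) :
    {k : ℤ | ∃ v : V, v ≠ 0 ∧ ⁅h, v⁆ = (2 * k : K) • v}.Finite := by
  have h1 : {a : K | (toEnd K s V h).HasEigenvalue a}.Finite :=
    Module.End.finite_hasEigenvalue _
  refine (h1.preimage (f := fun k : ℤ => (2 * k : K)) ?_).subset ?_
  · intro a _ b _ hab
    have : (a : K) = b := mul_left_cancel₀ two_ne_zero hab
    exact_mod_cast this
  · rintro k ⟨v, hv, hk⟩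
    exact Module.End.hasEigenvalue_of_hasEigenvector
      (x := v) (Module.End.hasEigenvector_iff.2 ⟨Module.End.mem_eigenspace_iff.2 hk, hv⟩)

lemma exists_common_eigenvector (H : LieSubalgebra K s) [IsLieAbelian H] {h : s} (hH : h ∈ H)
    {a : K} {u : V} (hu : u ≠ 0) (ha : ⁅h, u⁆ = a • u) :
    ∃ v : V, v ≠ 0 ∧ ⁅h, v⁆ = a • v ∧ ∃ χ : H → K, ∀ x : H, ⁅(x : s), v⁆ = χ x • v := by
  let E : LieSubmodule K H V :=
    { toSubmodule := Module.End.eigenspace (toEnd K s V h) a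
      lie_mem := by
        intro x v hv
        have hv' : ⁅h, v⁆ = a • v := Module.End.mem_eigenspace_iff.1 hv
        refine Module.End.mem_eigenspace_iff.2 ?_
        change ⁅h, ⁅(x : s), v⁆⁆ = a • ⁅(x : s), v⁆
        have h0 : ⁅h, (x : s)⁆ = 0 :=
          congrArg (fun z : H => (z : s)) (trivial_lie_zero H H ⟨h, hH⟩ x)
        rw [leibniz_lie, h0, zero_lie, zero_add, hv', lie_smul] }
  have : Nontrivial E := by
    refine ⟨⟨⟨u, Module.End.mem_eigenspace_iff.2 ha⟩, 0, fun h0 => hu ?_⟩⟩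
    exact congrArg (fun z : E => (z : V)) h0
  obtain ⟨χ, hχ⟩ := exists_nontrivial_weightSpace_of_isSolvable K H E
  obtain ⟨⟨v, hv⟩, hne⟩ := exists_ne (0 : weightSpace E χ)
  refine ⟨v, fun h0 => hne (Subtype.ext (Subtype.ext h0)), Module.End.mem_eigenspace_iff.1 v.2,
    χ, fun x => ?_⟩
  exact congrArg (fun z : E => (z : V)) ((mem_weightSpace _ _).1 hv x)

variable {Z : Type} [AddCommGroup Z] [Module K Z] (ω : V →ₗ[K] V →ₗ[K] Z)
variable (hinv : ∀ (x : s) (v w : V), ω ⁅x, v⁆ w = - ω v ⁅x, w⁆)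
variable (halt : ∀ v, ω v v = 0)
variable (hiso : ∀ W : LieSubmodule K s V, (∀ v ∈ W, ∀ w ∈ W, ω v w = 0) → W = ⊥)

include hinv halt hiso

/-- A neutral element with even eigenvalues on the Lie algebra has no even eigenvalue on an
alternating module without isotropic submodules. -/
lemma no_even_eigenvector (H : LieSubalgebra K s) [IsLieAbelian H] {h e f : s} (hH : h ∈ H)
    (hef : ⁅e, f⁆ = h) (he : ⁅h, e⁆ = (2 : K) • e) (hf : ⁅h, f⁆ = (-2 : K) • f)
    (hspan : ∀ y : s, y ∈ Submodule.span K
      ((H : Set s) ∪ {x | ∃ n : ℤ, n ≠ 0 ∧ ⁅h, x⁆ = (2 * n : K) • x}))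
    {k : ℤ} {u : V} (hu : ⁅h, u⁆ = (2 * k : K) • u) : u = 0 := by
  by_contra hu0
  set S := {k : ℤ | ∃ v : V, v ≠ 0 ∧ ⁅h, v⁆ = (2 * k : K) • v} with hS
  have hSfin : S.Finite := finite_even_eigenvalues h
  have hSne : S.Nonempty := ⟨k, u, hu0, hu⟩
  obtain ⟨m, ⟨u1, hu1, hu1m⟩, hmax⟩ := Set.exists_max_image S id hSfin hSne
  obtain ⟨q, ⟨u2, hu2, hu2m⟩, hmin⟩ := Set.exists_min_image S id hSfin hSne
  simp only [id] at hmax hmin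
  have hgt : ∀ {j : ℤ} {x : V}, m < j → ⁅h, x⁆ = (2 * j : K) • x → x = 0 := by
    intro j x hj hx
    by_contra hx0
    exact absurd (hmax j ⟨x, hx0, hx⟩) (not_le.2 hj)
  have hlt : ∀ {j : ℤ} {x : V}, j < q → ⁅h, x⁆ = (2 * j : K) • x → x = 0 := by
    intro j x hj hx
    by_contra hx0
    exact absurd (hmin j ⟨x, hx0, hx⟩) (not_le.2 hj)
  obtain ⟨v, hv0, hvm, χ, hχ⟩ := exists_common_eigenvector H hH hu1 hu1m
  set N : Set s := {x | ∃ n : ℤ, n < 0 ∧ ⁅h, x⁆ = (2 * n : K) • x} with hN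
  have hNspan : ∀ y : s, y ∈ Submodule.span K (N ∪ {y : s | ⁅y, v⁆ ∈ Submodule.span K {v}}) := by
    intro y
    refine Submodule.span_mono ?_ (hspan y)
    rintro x (hx | ⟨n, hn, hx⟩)
    · refine Or.inr ?_
      change ⁅x, v⁆ ∈ Submodule.span K {v}
      rw [hχ ⟨x, hx⟩]
      exact Submodule.smul_mem _ _ (Submodule.mem_span_singleton_self v)
    · rcases lt_or_gt_of_ne hn with h1 | h1
      · exact Or.inl ⟨n, h1, hx⟩
      · refine Or.inr ?_
        change ⁅x, v⁆ ∈ Submodule.span K {v}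
        have h2 : ⁅x, v⁆ = 0 := by
          refine hgt (j := n + m) (by linarith) ?_
          rw [lie_lie_of_eigen hx hvm]
          push_cast; ring_nf
        rw [h2]; exact zero_mem _
  set W := wordSubmodule v hNspan with hW
  have hvW : v ∈ W := Submodule.subset_span ⟨[], rfl⟩
  have hword : ∀ l : List N, ∃ j : ℤ, (j = m → l = []) ∧ j ≤ m ∧
      ⁅h, moduleWord v l⁆ = (2 * j : K) • moduleWord v l := by
    intro l
    induction l with
    | nil => exact ⟨m, fun _ => rfl, le_rfl, hvm⟩
    | cons x l ih =>
      obtain ⟨j, -, hj, hj2⟩ := ih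
      obtain ⟨n, hn, hx⟩ := x.2
      refine ⟨n + j, fun h1 => by lia, by lia, ?_⟩
      change ⁅h, ⁅(x : s), moduleWord v l⁆⁆ = _ • ⁅(x : s), moduleWord v l⁆
      rw [lie_lie_of_eigen hx hj2]
      push_cast; ring_nf
  have hWm : ∀ w ∈ W, ⁅h, w⁆ = (2 * m : K) • w → ∃ c : K, w = c • v := by
    intro w hw hwm
    have hle : W.toSubmodule ≤ Submodule.span K {v} ⊔
        ⨆ (a : K) (_ : a ≠ 2 * m), Module.End.eigenspace (toEnd K s V h) a := by
      refine Submodule.span_le.2 ?_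
      rintro _ ⟨l, rfl⟩
      obtain ⟨j, hj1, -, hj⟩ := hword l
      by_cases hjm : j = m
      · rw [hj1 hjm]
        exact Submodule.mem_sup_left (Submodule.mem_span_singleton_self v)
      · refine Submodule.mem_sup_right (Submodule.mem_iSup_of_mem (2 * j : K)
          (Submodule.mem_iSup_of_mem ?_ (Module.End.mem_eigenspace_iff.2 hj)))
        intro h1
        exact hjm (by exact_mod_cast mul_left_cancel₀ two_ne_zero h1)
    obtain ⟨y, hy, z, hz, rfl⟩ := Submodule.mem_sup.1 (hle hw)
    obtain ⟨c, rfl⟩ := Submodule.mem_span_singleton.1 hy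
    refine ⟨c, ?_⟩
    have hz2 : z ∈ Module.End.eigenspace (toEnd K s V h) (2 * m : K) := by
      refine Module.End.mem_eigenspace_iff.2 ?_
      change ⁅h, z⁆ = _
      rw [lie_add, lie_smul, hvm, smul_add, smul_comm c] at hwm
      exact add_left_cancel hwm
    have := (Module.End.eigenspaces_iSupIndep (toEnd K s V h) (2 * m : K)).le_bot ⟨hz2, hz⟩
    rw [Submodule.mem_bot] at this
    rw [this, add_zero]
  have horth : ∀ l : List N, ω v (moduleWord v l) = 0 := by
    intro l
    obtain ⟨j, hj1, hjm, hj⟩ := hword l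
    set w := moduleWord v l with hw
    have hwW : w ∈ W := Submodule.subset_span ⟨l, rfl⟩
    have h1 : (2 * m + 2 * j : K) • ω v w = 0 := by
      have := hinv h v w
      rw [hvm, hj, map_smul, map_smul, LinearMap.smul_apply] at this
      rw [add_smul, this, neg_add_cancel]
    rcases smul_eq_zero.1 h1 with h1 | h1
    swap
    · exact h1
    have hjm' : j = -m := by
      have : (2 : K) * ((m + j : ℤ) : K) = 0 := by push_cast; linear_combination h1
      have := (mul_eq_zero.1 this).resolve_left two_ne_zero
      have : m + j = 0 := by exact_mod_cast this
      lia
    by_cases hm0 : m = 0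
    · rw [hw, hj1 (by lia)]; exact halt v
    by_cases hw0 : w = 0
    · rw [hw0, map_zero]
    have hh : h ≠ 0 := by
      rintro rfl
      rw [zero_lie] at hvm
      have := (smul_eq_zero.1 hvm.symm).resolve_right hv0
      have := (mul_eq_zero.1 this).resolve_left two_ne_zero
      exact hm0 (by exact_mod_cast this)
    have t : IsSl2Triple h e f :=
      ⟨hh, hef, by rw [he, two_smul, two_nsmul], by rw [hf, neg_smul, two_smul, two_nsmul]⟩
    have hqm : -m ≤ q := by
      have P : t.symm.HasPrimitiveVectorWith u2 (-(2 * q) : K) :=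
        ⟨hu2, by rw [neg_lie, hu2m, neg_smul], hlt (j := q - 1) (by lia) (by
          rw [lie_lie_of_eigen hf hu2m]; push_cast; ring_nf)⟩
      obtain ⟨a, ha⟩ := P.exists_nat
      have h3 := P.pow_toEnd_f_ne_zero_of_eq_nat ha le_rfl
      have h4 := P.lie_h_pow_toEnd_f a
      have h5 : -q ∈ S := by
        refine ⟨_, h3, ?_⟩
        rw [neg_lie, neg_eq_iff_eq_neg, ← neg_smul] at h4
        rw [h4]; congr 1; push_cast; linear_combination (-2) * ha
      have := hmax _ h5
      lia
    have hPv : t.HasPrimitiveVectorWith v (2 * m : K) :=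
      ⟨hv0, hvm, hgt (j := m + 1) (by lia) (by
        rw [lie_lie_of_eigen he hvm]; push_cast; ring_nf)⟩
    obtain ⟨n, hn⟩ := hPv.exists_nat
    have hlow : ∀ x : V, ⁅h, x⁆ = (-(2 * m) : K) • x → x ≠ 0 →
        (toEnd K s V e ^ n) x ≠ 0 ∧
        ⁅h, (toEnd K s V e ^ n) x⁆ = (2 * m : K) • (toEnd K s V e ^ n) x := by
      intro x hx hx0
      have P : t.symm.HasPrimitiveVectorWith x (2 * m : K) :=
        ⟨hx0, by rw [neg_lie, hx, neg_smul, neg_neg], hlt (j := -m - 1) (by lia) (by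
          rw [lie_lie_of_eigen hf hx]; push_cast; ring_nf)⟩
      refine ⟨P.pow_toEnd_f_ne_zero_of_eq_nat hn le_rfl, ?_⟩
      have h4 := P.lie_h_pow_toEnd_f n
      rw [neg_lie, neg_eq_iff_eq_neg, ← neg_smul] at h4
      rw [h4]; congr 1; linear_combination (-2) * hn
    have hpowW : ∀ (a : s) (i : ℕ) (x : V), x ∈ W → (toEnd K s V a ^ i) x ∈ W := by
      intro a i x hx
      induction i with
      | zero => simpa using hx
      | succ i ih =>
        rw [pow_succ', Module.End.mul_apply, toEnd_apply_apply]
        exact W.lie_mem ih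
    have hu0m := hPv.lie_h_pow_toEnd_f n
    rw [show (2 * m - 2 * n : K) = -(2 * m) by linear_combination 2 * hn] at hu0m
    have hu0ne := hPv.pow_toEnd_f_ne_zero_of_eq_nat hn le_rfl
    obtain ⟨a1, a2⟩ := hlow _ hu0m hu0ne
    have hjK : (2 * j : K) = -(2 * m) := by rw [hjm']; push_cast; ring
    rw [hjK] at hj
    obtain ⟨b1, b2⟩ := hlow _ hj hw0
    obtain ⟨c0, hc0⟩ := hWm _ (hpowW e n _ (hpowW f n v hvW)) a2
    obtain ⟨c, hc⟩ := hWm _ (hpowW e n _ hwW) b2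
    have hd : c0 • w - c • (toEnd K s V f ^ n) v = 0 := by
      by_contra hd
      refine (hlow _ ?_ hd).1 ?_
      · rw [lie_sub, lie_smul, lie_smul, hj, hu0m, smul_sub, smul_comm c0, smul_comm c]
      · rw [map_sub, map_smul, map_smul, hc, hc0, smul_comm, sub_self]
    have hc0ne : c0 ≠ 0 := by
      rintro rfl
      exact a1 (by rw [hc0, zero_smul])
    have hneven : Even n := by
      have : (2 * m : ℤ) = n := by exact_mod_cast hn
      exact ⟨m.toNat, by lia⟩
    have h6 : c0 • ω v w = 0 := by
      rw [← map_smul, sub_eq_zero.1 hd, map_smul,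
        form_pow_eq_zero ω hinv halt hiso f v hneven, smul_zero]
    exact (smul_eq_zero.1 h6).resolve_left hc0ne
  refine hv0 (eq_zero_of_orthogonal ω hinv hiso W hvW fun w hw => ?_)
  replace hw : w ∈ Submodule.span K (Set.range (moduleWord (N := N) v)) := hw
  induction hw using Submodule.span_induction with
  | mem w hw => obtain ⟨l, rfl⟩ := hw; exact horth l
  | zero => simp
  | add a b _ _ ha hb => rw [map_add, ha, hb, add_zero]
  | smul c a _ ha => rw [map_smul, ha, smul_zero]

end Parity

section SemisimpleAction

open LieAlgebra LieModule Module

variable {K : Type} [Field K] [CharZero K] [IsAlgClosed K]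
variable {s : Type} [LieRing s] [LieAlgebra K s]
variable {V : Type} [AddCommGroup V] [Module K V] [LieRingModule s V] [LieModule K s V]

/-- The sum of the eigenspaces of an element acting diagonalizably on the Lie algebra. -/
def eigenSum (V : Type) [AddCommGroup V] [Module K V] [LieRingModule s V] [LieModule K s V]
    (x : s) (hx : ⨆ a, Module.End.eigenspace (toEnd K s s x) a = ⊤) :
    LieSubmodule K s V where
  toSubmodule := ⨆ a, Module.End.eigenspace (toEnd K s V x) a
  lie_mem := by
    set D := ⨆ a, Module.End.eigenspace (toEnd K s V x) a with hD
    intro y v hv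
    replace hv : v ∈ D := hv
    change ⁅y, v⁆ ∈ D
    have hy : y ∈ ⨆ a, Module.End.eigenspace (toEnd K s s x) a := hx ▸ Submodule.mem_top
    induction hv using Submodule.iSup_induction' with
    | mem a v hv =>
      induction hy using Submodule.iSup_induction' with
      | mem b y hy =>
        refine Submodule.mem_iSup_of_mem (b + a) (Module.End.mem_eigenspace_iff.2 ?_)
        exact lie_lie_of_eigen (Module.End.mem_eigenspace_iff.1 hy)
          (Module.End.mem_eigenspace_iff.1 hv)
      | zero => rw [zero_lie]; exact zero_mem _
      | add y z _ _ hy hz => rw [add_lie]; exact add_mem hy hz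
    | zero => rw [lie_zero]; exact zero_mem _
    | add v w _ _ hv hw => rw [lie_add]; exact add_mem hv hw

variable {Z : Type} [AddCommGroup Z] [Module K Z] (ω : V →ₗ[K] V →ₗ[K] Z)
variable (hinv : ∀ (x : s) (v w : V), ω ⁅x, v⁆ w = - ω v ⁅x, w⁆)
variable (hiso : ∀ W : LieSubmodule K s V, (∀ v ∈ W, ∀ w ∈ W, ω v w = 0) → W = ⊥)

include hinv hiso

variable [FiniteDimensional K V] in
lemma iSup_eigenspace_toEnd_eq_top {x : s}
    (hx : ⨆ a, Module.End.eigenspace (toEnd K s s x) a = ⊤) :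
    ⨆ a, Module.End.eigenspace (toEnd K s V x) a = ⊤ := by
  suffices h : ∀ (n : ℕ) (U : LieSubmodule K s V), finrank K U = n → U ≤ eigenSum V x hx from
    top_le_iff.1 (show ((⊤ : LieSubmodule K s V) : Submodule K V) ≤ _ from h _ ⊤ rfl)
  intro n
  induction n using Nat.strong_induction_on with
  | _ n ih =>
  intro U hU
  by_cases hU0 : U = ⊥
  · rw [hU0]; exact bot_le
  obtain ⟨W, hWat, hWU⟩ := (eq_bot_or_exists_atom_le U).resolve_left hU0
  have hWD : W ≤ eigenSum V x hx := by
    have hWn : Nontrivial W := (LieSubmodule.nontrivial_iff_ne_bot K s V).2 hWat.1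
    obtain ⟨a, ha⟩ := Module.End.exists_eigenvalue (toEnd K s W x)
    obtain ⟨v, hv, hv0⟩ := ha.exists_hasEigenvector
    have hv1 := Module.End.mem_eigenspace_iff.1 hv
    have h1 : (v : V) ∈ W ⊓ eigenSum V x hx := by
      refine ⟨v.2, Submodule.mem_iSup_of_mem a (Module.End.mem_eigenspace_iff.2 ?_)⟩
      exact congrArg (fun z : W => (z : V)) hv1
    rcases hWat.le_iff.1 (inf_le_left : W ⊓ eigenSum V x hx ≤ W) with h2 | h2
    · rw [h2, LieSubmodule.mem_bot] at h1
      exact absurd (Subtype.ext h1) hv0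
    · exact inf_eq_left.1 h2
  have hex : ∃ v ∈ W, ∃ w ∈ W, ω v w ≠ 0 := by
    by_contra! hcon
    exact hWat.1 (hiso W hcon)
  obtain ⟨v0, hv0, w0, hw0, hvw⟩ := hex
  obtain ⟨ζ, hζ⟩ := Projective.exists_dual_ne_zero K hvw
  let β : V →ₗ[K] V →ₗ[K] K := ω.compr₂ ζ
  have hβ : ∀ (x : s) (v w : V), β ⁅x, v⁆ w = - β v ⁅x, w⁆ := fun x v w => by
    simp only [β, LinearMap.compr₂_apply, hinv x v w, map_neg]
  let O := orthSubmodule β hβ W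
  have hWO : W ⊓ O = ⊥ := by
    refine (hWat.le_iff.1 (inf_le_left : W ⊓ O ≤ W)).resolve_right fun h => ?_
    exact hζ ((inf_eq_left.1 h hv0) w0 hw0)
  let φ : W →ₗ[K] Dual K W := (β.domRestrict W.toSubmodule).compr₂ LinearMap.id |>.flip.domRestrict
    W.toSubmodule |>.flip
  have hφ : ∀ w w' : W, φ w w' = β w w' := fun _ _ => rfl
  have hinj : Function.Injective φ := by
    refine (injective_iff_map_eq_zero φ).2 fun w hw => ?_
    have h1 : (w : V) ∈ W ⊓ O := ⟨w.2, fun w' hw' => by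
      rw [← hφ w ⟨w', hw'⟩, hw, LinearMap.zero_apply]⟩
    rw [hWO, LieSubmodule.mem_bot] at h1
    exact Subtype.ext h1
  have hsurj : Function.Surjective φ :=
    (LinearMap.injective_iff_surjective_of_finrank_eq_finrank Subspace.dual_finrank_eq.symm).1 hinj
  have hlt : finrank K (U ⊓ O : LieSubmodule K s V) < n := by
    rw [← hU]
    refine Submodule.finrank_lt_finrank_of_lt (lt_of_le_of_ne
      (show (U ⊓ O : LieSubmodule K s V).toSubmodule ≤ U.toSubmodule from fun x hx => hx.1) ?_)
    intro h
    have h1 : v0 ∈ (U ⊓ O : LieSubmodule K s V).toSubmodule := h ▸ hWU hv0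
    exact hζ (h1.2 w0 hw0)
  have hUO := ih _ hlt (U ⊓ O) rfl
  intro u hu
  obtain ⟨w, hw⟩ := hsurj ((β u).domRestrict W.toSubmodule)
  have h1 : u - w ∈ U ⊓ O := by
    refine ⟨sub_mem hu (hWU w.2), fun w' hw' => ?_⟩
    have := LinearMap.congr_fun hw ⟨w', hw'⟩
    rw [hφ] at this
    rw [map_sub, LinearMap.sub_apply, this]
    exact sub_self _
  rw [← sub_add_cancel u w]
  exact add_mem (hUO h1) (hWD w.2)

end SemisimpleAction

section Eigen

open LieAlgebra LieModule Module

variable {K : Type} [Field K]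
variable {M M' : Type} [AddCommGroup M] [Module K M] [AddCommGroup M'] [Module K M']

lemma exists_preimage_of_iSupIndep {ι : Type} {A : ι → Submodule K M} {B : ι → Submodule K M'}
    (hA : ⨆ i, A i = ⊤) (hB : iSupIndep B) {φ : M →ₗ[K] M'} (hφ : Function.Surjective φ)
    (hAB : ∀ i, ∀ x ∈ A i, φ x ∈ B i) {i : ι} {x' : M'} (hx' : x' ∈ B i) :
    ∃ x ∈ A i, φ x = x' := by
  obtain ⟨x, rfl⟩ := hφ x'
  have hx : x ∈ A i ⊔ ⨆ (j) (_ : j ≠ i), A j := by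
    rw [← iSup_split_single A i, hA]; exact Submodule.mem_top
  obtain ⟨a, ha, y, hy, rfl⟩ := Submodule.mem_sup.1 hx
  refine ⟨a, ha, ?_⟩
  have h1 : φ y ∈ ⨆ (j) (_ : j ≠ i), B j := by
    have h2 : (⨆ (j) (_ : j ≠ i), A j) ≤ (⨆ (j) (_ : j ≠ i), B j).comap φ :=
      iSup₂_le fun j hj z hz => Submodule.mem_iSup_of_mem j (Submodule.mem_iSup_of_mem hj
        (hAB j z hz))
    exact h2 hy
  have h3 : φ y ∈ B i := by
    rw [show φ y = φ (a + y) - φ a by rw [map_add, add_sub_cancel_left]]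
    exact sub_mem hx' (hAB i a ha)
  have h4 := (hB i).le_bot ⟨h3, h1⟩
  rw [Submodule.mem_bot] at h4
  rw [map_add, h4, add_zero]

lemma maxGenEigenspace_eq_eigenspace {f : End K M} (hf : ⨆ a, End.eigenspace f a = ⊤) (a : K) :
    End.maxGenEigenspace f a = End.eigenspace f a := by
  refine le_antisymm (fun x hx => ?_) (End.genEigenspace f a |>.mono le_top)
  obtain ⟨y, hy, rfl⟩ := exists_preimage_of_iSupIndep (φ := LinearMap.id) hf
    (End.independent_maxGenEigenspace f) Function.surjective_id
    (fun b z hz => (End.genEigenspace f b).mono le_top hz) hx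
  exact hy

lemma apply_eq_zero_of_apply_apply_eq_zero {f : End K M} (hf : ⨆ a, End.eigenspace f a = ⊤)
    {x : M} (hx : f (f x) = 0) : f x = 0 := by
  have h : x ∈ End.maxGenEigenspace f 0 :=
    (End.mem_maxGenEigenspace f 0 x).2 ⟨2, by simpa [pow_two] using hx⟩
  rw [maxGenEigenspace_eq_eigenspace hf, End.mem_eigenspace_iff, zero_smul] at h
  exact h

lemma iSup_eigenspace_of_surjective {f : End K M} {f' : End K M'} {φ : M →ₗ[K] M'}
    (hφ : Function.Surjective φ) (hff : ∀ x, φ (f x) = f' (φ x))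
    (hf : ⨆ a, End.eigenspace f a = ⊤) : ⨆ a, End.eigenspace f' a = ⊤ := by
  rw [eq_top_iff, ← LinearMap.range_eq_top.2 hφ, LinearMap.range_eq_map, ← hf, Submodule.map_iSup]
  refine iSup_mono fun a => ?_
  rintro _ ⟨x, hx, rfl⟩
  rw [End.mem_eigenspace_iff, ← hff, End.mem_eigenspace_iff.1 hx, map_smul]

end Eigen

section CartanContaining

open LieAlgebra LieModule Module

variable {K : Type} [Field K] [Infinite K]
variable {s : Type} [LieRing s] [LieAlgebra K s] [FiniteDimensional K s]

def centralizerSub (t : Set s) : LieSubalgebra K s where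
  carrier := {x | ∀ y ∈ t, ⁅y, x⁆ = 0}
  add_mem' := fun ha hb y hy => by rw [lie_add, ha y hy, hb y hy, add_zero]
  zero_mem' := fun y _ => lie_zero y
  smul_mem' := fun c x hx y hy => by rw [lie_smul, hx y hy, smul_zero]
  lie_mem' := fun {a b} ha hb y hy => by
    rw [leibniz_lie, ha y hy, hb y hy, zero_lie, lie_zero, add_zero]

lemma exists_cartan_of_diagonalizable (t : Set s) (ht : ∀ x ∈ t, ∀ y ∈ t, ⁅x, y⁆ = 0)
    (hd : ∀ x ∈ t, ⨆ a, End.eigenspace (toEnd K s s x) a = ⊤) :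
    ∃ H : LieSubalgebra K s, H.IsCartanSubalgebra ∧ t ⊆ H ∧
      ∀ x ∈ H, ∀ y ∈ t, ⁅y, x⁆ = 0 := by
  let c : LieSubalgebra K s := centralizerSub t
  obtain ⟨x0, hx0⟩ := exists_isCartanSubalgebra_engel K c
  set H' := LieSubalgebra.engel K x0
  have hHc : ∀ x ∈ H'.map c.incl, ∃ h : x ∈ c, (⟨x, h⟩ : c) ∈ H' := by
    rintro _ ⟨y, hy, rfl⟩
    exact ⟨y.2, hy⟩
  have hmem : ∀ x : c, x ∈ H' → (x : s) ∈ H'.map c.incl := fun x hx => ⟨x, hx, rfl⟩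
  have htH : t ⊆ (H'.map c.incl : LieSubalgebra K s) := by
    intro y hy
    have hyc : y ∈ c := fun z hz => ht z hz y hy
    refine hmem ⟨y, hyc⟩ ?_
    rw [← hx0.self_normalizing, LieSubalgebra.mem_normalizer_iff]
    intro z _
    have : ⁅(⟨y, hyc⟩ : c), z⁆ = 0 := Subtype.ext (z.2 y hy)
    rw [this]; exact zero_mem _
  refine ⟨H'.map c.incl, ⟨?_, ?_⟩, htH, fun x hx => (hHc x hx).1⟩
  · have := hx0.nilpotent
    exact (LieEquiv.nilpotent_iff_equiv_nilpotent
      (H'.equivMapOfInjective c.incl Subtype.val_injective)).1 this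
  · refine le_antisymm (fun x hx => ?_) (LieSubalgebra.le_normalizer _)
    rw [LieSubalgebra.mem_normalizer_iff] at hx
    have hxc : x ∈ c := by
      intro y hy
      refine apply_eq_zero_of_apply_apply_eq_zero (f := toEnd K s s y) (hd y hy) ?_
      rw [toEnd_apply_apply, toEnd_apply_apply, ← lie_skew y x, lie_neg,
        (hHc _ (hx y (htH hy))).1 y hy, neg_zero]
    refine hmem ⟨x, hxc⟩ ?_
    rw [← hx0.self_normalizing, LieSubalgebra.mem_normalizer_iff]
    intro z hz
    obtain ⟨h1, h2⟩ := hHc _ (hx z (hmem z hz))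
    exact h2

end CartanContaining

section KillingFacts

open LieAlgebra LieAlgebra.IsKilling LieModule Module

variable {K : Type} [Field K] [CharZero K] [IsAlgClosed K]
variable {s : Type} [LieRing s] [LieAlgebra K s] [FiniteDimensional K s] [IsKilling K s]
variable (H : LieSubalgebra K s) [H.IsCartanSubalgebra]

/-- The coroots span a splitting Cartan subalgebra. -/
lemma mem_span_lie_of_mem_cartan {x : s} (hx : x ∈ H) :
    x ∈ Submodule.span K {z : s | ∃ (α : Weight K H s), α.IsNonZero ∧ ∃ e ∈ rootSpace H α,
      ∃ f ∈ rootSpace H (-α), z = ⁅e, f⁆} := by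
  obtain ⟨B⟩ := (rootSystem H).nonempty_base
  have h1 := B.toCoweightBasis.sum_repr ⟨x, hx⟩
  have h2 := congrArg (fun x : H => (x : s)) h1.symm
  simp only [AddSubmonoidClass.coe_finsetSum] at h2
  rw [h2]
  refine Submodule.sum_mem _ fun i _ => Submodule.smul_mem _ _ (Submodule.subset_span ?_)
  have hi := LieSubalgebra.isNonZero_coe_root i.1
  obtain ⟨h, e, f, ht, he, hf⟩ := exists_isSl2Triple_of_weight_isNonZero hi
  refine ⟨_, hi, e, he, f, hf, ?_⟩
  rw [ht.lie_e_f, ht.h_eq_coroot hi he hf, RootPairing.Base.toCoweightBasis_apply,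
    rootSystem_coroot_apply]

lemma iSup_eigenspace_of_mem_cartan {x : s} (hx : x ∈ H) :
    ⨆ a, End.eigenspace (toEnd K s s x) a = ⊤ :=
  (isSemisimple_ad_of_mem_isCartanSubalgebra hx).iSup_eigenspace_eq_top

lemma mem_span_of_principal {h : H}
    (hh : ∀ α : Weight K H s, α.IsNonZero → ∃ n : ℤ, n ≠ 0 ∧ α h = 2 * n) (y : s) :
    y ∈ Submodule.span K ((H : Set s) ∪ {x | ∃ n : ℤ, n ≠ 0 ∧ ⁅(h : s), x⁆ = (2 * n : K) • x}) := by
  have hy : y ∈ (⨆ χ : Weight K H s, genWeightSpace s χ).toSubmodule := by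
    rw [iSup_genWeightSpace_eq_top']; trivial
  rw [LieSubmodule.iSup_toSubmodule] at hy
  refine (iSup_le fun χ z hz => ?_ : ((⨆ χ : Weight K H s, (genWeightSpace s χ).toSubmodule) ≤ _)) hy
  by_cases hχ : χ.IsZero
  · refine Submodule.subset_span (Or.inl ?_)
    rw [show (χ : H → K) = 0 from hχ] at hz
    have : z ∈ rootSpace H (0 : H → K) := hz
    rw [rootSpace_zero_eq] at this
    exact this
  · obtain ⟨n, hn, hn2⟩ := hh χ hχ
    refine Submodule.subset_span (Or.inr ⟨n, hn, ?_⟩)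
    rw [← hn2]
    exact lie_eq_smul_of_mem_rootSpace hz h

variable {H} {h : H}
    (hh : ∀ α : Weight K H s, α.IsNonZero → ∃ n : ℤ, n ≠ 0 ∧ α h = 2 * n)
include hh

lemma cartan_le_eigenspace_zero : H.toSubmodule ≤ End.eigenspace (toEnd K s s (h : s)) 0 := by
  intro x hx
  rw [End.mem_eigenspace_iff, zero_smul]
  exact congrArg (fun z : H => (z : s)) (trivial_lie_zero H H h ⟨x, hx⟩)

lemma eq_even_of_eigen {a : K} {x : s} (hx0 : x ≠ 0) (hx : ⁅(h : s), x⁆ = a • x) :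
    ∃ n : ℤ, a = 2 * n := by
  by_contra! hcon
  refine hx0 ?_
  have h1 := End.eigenspaces_iSupIndep (toEnd K s s (h : s)) a
  refine (Submodule.mem_bot K).1 (h1.le_bot ⟨End.mem_eigenspace_iff.2 hx, ?_⟩)
  refine Submodule.span_le.2 ?_ (mem_span_of_principal H hh x)
  rintro y (hy | ⟨n, -, hy⟩)
  · refine Submodule.mem_iSup_of_mem 0 (Submodule.mem_iSup_of_mem ?_
      (cartan_le_eigenspace_zero hh hy))
    intro h0
    exact hcon 0 (by rw [← h0]; simp)
  · exact Submodule.mem_iSup_of_mem (2 * n : K) (Submodule.mem_iSup_of_mem (hcon n).symm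
      (End.mem_eigenspace_iff.2 hy))

lemma mem_cartan_of_lie_eq_zero {x : s} (hx : ⁅(h : s), x⁆ = 0) : x ∈ H := by
  have h1 := End.eigenspaces_iSupIndep (toEnd K s s (h : s)) 0
  have h2 : x ∈ H.toSubmodule ⊔ ⨆ (a : K) (_ : a ≠ 0), End.eigenspace (toEnd K s s (h : s)) a := by
    refine Submodule.span_le.2 ?_ (mem_span_of_principal H hh x)
    rintro y (hy | ⟨n, hn, hy⟩)
    · exact Submodule.mem_sup_left hy
    · refine Submodule.mem_sup_right (Submodule.mem_iSup_of_mem (2 * n : K)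
        (Submodule.mem_iSup_of_mem ?_ (End.mem_eigenspace_iff.2 hy)))
      exact mul_ne_zero two_ne_zero (by exact_mod_cast hn)
  obtain ⟨y, hy, z, hz, rfl⟩ := Submodule.mem_sup.1 h2
  have h3 : z ∈ End.eigenspace (toEnd K s s (h : s)) 0 := by
    rw [← add_sub_cancel_left y z]
    refine sub_mem (End.mem_eigenspace_iff.2 ?_) (cartan_le_eigenspace_zero hh hy)
    rw [toEnd_apply_apply, hx, zero_smul]
  have h4 := h1.le_bot ⟨h3, hz⟩
  rw [Submodule.mem_bot] at h4
  rw [h4, add_zero]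
  exact hy

end KillingFacts

section RadicalForm

open LieAlgebra LieModule Module

variable {K : Type} [Field K] [CharZero K] [IsAlgClosed K]
variable {L : Type} [LieRing L] [LieAlgebra K L] [FiniteDimensional K L]
variable (hab : ∀ I : LieIdeal K L, IsLieAbelian I → I ≤ center K L)
variable {s : Type} [LieRing s] [LieAlgebra K s]
variable {V : Type} [AddCommGroup V] [Module K V] [LieRingModule s V] [LieModule K s V]
variable {π : L →ₗ⁅K⁆ s} (hπs : Function.Surjective π)
variable {q : radical K L →ₗ[K] V} (hqs : Function.Surjective q)
    (hq0 : ∀ y : radical K L, q y = 0 ↔ (y : L) ∈ center K L)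
    (hq : ∀ (x : L) (y : radical K L), q ⁅x, y⁆ = ⁅π x, q y⁆)

include hab hπs hqs hq0 hq in
/-- The bracket of the radical induces an invariant alternating form without isotropic submodules
on the quotient of the radical by the center. -/
lemma exists_radical_form : ∃ ω : V →ₗ[K] V →ₗ[K] L,
    (∀ (x : s) (v w : V), ω ⁅x, v⁆ w = - ω v ⁅x, w⁆) ∧ (∀ v, ω v v = 0) ∧
    ∀ W : LieSubmodule K s V, (∀ v ∈ W, ∀ w ∈ W, ω v w = 0) → W = ⊥ := by
  obtain ⟨σ, hσ⟩ := q.exists_rightInverse_of_surjective (LinearMap.range_eq_top.2 hqs)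
  let ω : V →ₗ[K] V →ₗ[K] L := LinearMap.mk₂ K (fun v w => ⁅(σ v : L), (σ w : L)⁆)
    (fun a b c => by simp) (fun a b c => by simp) (fun a b c => by simp) (fun a b c => by simp)
  have hσq : ∀ y : radical K L, ((σ (q y) : radical K L) : L) - y ∈ center K L := by
    intro y
    rw [← LieSubmodule.coe_sub, ← hq0, map_sub]
    rw [show q (σ (q y)) = q y from LinearMap.congr_fun hσ (q y), sub_self]
  have hω : ∀ y z : radical K L, ω (q y) (q z) = ⁅(y : L), (z : L)⁆ := by
    intro y z
    have h1 := mem_center_iff.1 (hσq y) (σ (q z) : L)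
    have h2 := mem_center_iff.1 (hσq z) (y : L)
    rw [sub_lie, sub_eq_zero] at h1 h2
    rw [LinearMap.mk₂_apply, h1, ← lie_skew, h2, lie_skew]
  refine ⟨ω, ?_, fun v => lie_self _, ?_⟩
  · intro x v w
    obtain ⟨x, rfl⟩ := hπs x
    obtain ⟨y, rfl⟩ := hqs v
    obtain ⟨z, rfl⟩ := hqs w
    rw [← hq, ← hq, hω, hω, LieSubmodule.coe_bracket, LieSubmodule.coe_bracket]
    have h := mem_center_iff.1 (radical_lie_radical_le_center hab
      (LieSubmodule.lie_mem_lie y.2 z.2)) x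
    rw [← lie_skew, neg_eq_zero, leibniz_lie] at h
    exact eq_neg_of_add_eq_zero_left h
  · intro W hW
    let I : LieIdeal K L :=
      { carrier := {x | ∃ h : x ∈ radical K L, q ⟨x, h⟩ ∈ W}
        add_mem' := by
          rintro a b ⟨ha, ha'⟩ ⟨hb, hb'⟩
          exact ⟨add_mem ha hb, by
            have := add_mem ha' hb'
            rwa [← map_add] at this⟩
        zero_mem' := ⟨zero_mem _, by
          have : q 0 ∈ W := by rw [map_zero]; exact zero_mem _
          exact this⟩
        smul_mem' := by
          rintro c a ⟨ha, ha'⟩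
          exact ⟨Submodule.smul_mem (radical K L).toSubmodule c ha, by
            have := W.smul_mem c ha'
            rwa [← map_smul] at this⟩
        lie_mem := by
          rintro x a ⟨ha, ha'⟩
          exact ⟨LieSubmodule.lie_mem _ ha, by
            have := W.lie_mem (x := π x) ha'
            rwa [← hq] at this⟩ }
    have hI : I ≤ center K L := by
      refine le_center_of_lie_eq_zero hab I ?_
      rintro x ⟨hx, hx'⟩ y ⟨hy, hy'⟩
      rw [← hω ⟨x, hx⟩ ⟨y, hy⟩]
      exact hW _ hx' _ hy'
    refine (LieSubmodule.eq_bot_iff _).2 fun v hv => ?_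
    obtain ⟨⟨y, hy⟩, rfl⟩ := hqs v
    exact (hq0 _).2 (hI ⟨hy, hv⟩)

end RadicalForm

section GenEigen

open LieAlgebra LieModule Module

variable {K : Type} [Field K]
variable {M M' : Type} [AddCommGroup M] [Module K M] [AddCommGroup M'] [Module K M']

lemma map_pow_sub_smul {f : End K M} {f' : End K M'} {φ : M →ₗ[K] M'}
    (hff : ∀ x, φ (f x) = f' (φ x)) (a : K) (n : ℕ) (x : M) :
    φ (((f - a • (1 : End K M)) ^ n) x) = ((f' - a • (1 : End K M')) ^ n) (φ x) := by
  induction n with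
  | zero => rfl
  | succ n ih =>
    rw [pow_succ', pow_succ', End.mul_apply, End.mul_apply, ← ih]
    simp [hff]

lemma map_mem_maxGenEigenspace {f : End K M} {f' : End K M'} {φ : M →ₗ[K] M'}
    (hff : ∀ x, φ (f x) = f' (φ x)) {a : K} {x : M} (hx : x ∈ End.maxGenEigenspace f a) :
    φ x ∈ End.maxGenEigenspace f' a := by
  rw [End.mem_maxGenEigenspace] at hx ⊢
  obtain ⟨n, hn⟩ := hx
  exact ⟨n, by rw [← map_pow_sub_smul hff, hn, map_zero]⟩

lemma mem_maxGenEigenspace_of_map {f : End K M} {f' : End K M'} {φ : M →ₗ[K] M'}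
    (hφ : Function.Injective φ)
    (hff : ∀ x, φ (f x) = f' (φ x)) {a : K} {x : M} (hx : φ x ∈ End.maxGenEigenspace f' a) :
    x ∈ End.maxGenEigenspace f a := by
  rw [End.mem_maxGenEigenspace] at hx ⊢
  obtain ⟨n, hn⟩ := hx
  exact ⟨n, hφ (by rw [map_pow_sub_smul hff, hn, map_zero])⟩

lemma iSup_iInf_eigenspace_eq_top [FiniteDimensional K M] {ι : Type} (f : ι → End K M)
    (hc : ∀ i j, Commute (f i) (f j)) (hf : ∀ i, ⨆ a, End.eigenspace (f i) a = ⊤) :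
    ⨆ χ : ι → K, ⨅ i, End.eigenspace (f i) (χ i) = ⊤ := by
  have h := End.iSup_iInf_maxGenEigenspace_eq_top_of_iSup_maxGenEigenspace_eq_top_of_commute f
    (fun i j _ => hc i j) fun i => by
      simp_rw [maxGenEigenspace_eq_eigenspace (hf i)]; exact hf i
  simp_rw [fun i a => maxGenEigenspace_eq_eigenspace (hf i) a] at h
  exact h

lemma iSupIndep_iInf_eigenspace {ι : Type} (f : ι → End K M)
    (hc : ∀ i j, Commute (f i) (f j)) :
    iSupIndep fun χ : ι → K => ⨅ i, End.eigenspace (f i) (χ i) :=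
  (End.independent_iInf_maxGenEigenspace_of_forall_mapsTo f fun i j φ =>
    End.mapsTo_maxGenEigenspace_of_comm (hc j i) φ).mono fun χ =>
      iInf_mono fun i => (End.genEigenspace (f i) (χ i)).mono le_top

end GenEigen

section MaxToral

open LieAlgebra LieAlgebra.IsKilling LieModule Module

variable {K : Type} [Field K] [CharZero K] [IsAlgClosed K]
variable {L : Type} [LieRing L] [LieAlgebra K L] [FiniteDimensional K L]
variable (hab : ∀ I : LieIdeal K L, IsLieAbelian I → I ≤ center K L)
variable {s : Type} [LieRing s] [LieAlgebra K s] [FiniteDimensional K s] [IsKilling K s]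
variable {V : Type} [AddCommGroup V] [Module K V] [LieRingModule s V] [LieModule K s V]
variable [FiniteDimensional K V]
variable {π : L →ₗ⁅K⁆ s} (hπs : Function.Surjective π)
    (hπ0 : ∀ x, π x = 0 ↔ x ∈ radical K L)
variable {q : radical K L →ₗ[K] V} (hqs : Function.Surjective q)
    (hq0 : ∀ y : radical K L, q y = 0 ↔ (y : L) ∈ center K L)
    (hq : ∀ (x : L) (y : radical K L), q ⁅x, y⁆ = ⁅π x, q y⁆)

lemma commute_toEnd {x y : L} {M : Type} [AddCommGroup M] [Module K M] [LieRingModule L M]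
    [LieModule K L M] (h : ⁅x, y⁆ = 0) : Commute (toEnd K L M x) (toEnd K L M y) := by
  refine LinearMap.ext fun z => ?_
  rw [End.mul_apply, End.mul_apply, toEnd_apply_apply, toEnd_apply_apply, toEnd_apply_apply,
    toEnd_apply_apply, leibniz_lie x y z, h, zero_lie, zero_add]

include hπs in
lemma exists_lift_commuting {t : Set L} (ht : ∀ x ∈ t, ∀ y ∈ t, ⁅x, y⁆ = 0)
    (hd : ∀ x ∈ t, ⨆ a, End.eigenspace (toEnd K L L x) a = ⊤) {h : s}
    (hh : ∀ y ∈ t, ⁅π y, h⁆ = 0) : ∃ h0 : L, π h0 = h ∧ ∀ y ∈ t, ⁅y, h0⁆ = 0 := by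
  obtain ⟨x, hx, hxh⟩ := exists_preimage_of_iSupIndep (φ := (π : L →ₗ[K] s))
    (iSup_iInf_eigenspace_eq_top (fun y : t => toEnd K L L (y : L))
      (fun i j => commute_toEnd (ht _ i.2 _ j.2)) fun i => hd _ i.2)
    (iSupIndep_iInf_eigenspace (fun y : t => toEnd K s s (π y))
      (fun i j => commute_toEnd (by rw [← LieHom.map_lie, ht _ i.2 _ j.2, map_zero]))) hπs
    (i := 0) (x' := h) (fun χ x hx => by
      rw [Submodule.mem_iInf] at hx ⊢
      intro i
      have h1 := End.mem_eigenspace_iff.1 (hx i)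
      rw [toEnd_apply_apply] at h1
      rw [End.mem_eigenspace_iff, toEnd_apply_apply]
      change ⁅π i, π x⁆ = χ i • π x
      rw [← LieHom.map_lie, h1, map_smul]) (by
      rw [Submodule.mem_iInf]
      intro i
      rw [End.mem_eigenspace_iff, toEnd_apply_apply, hh _ i.2]
      simp)
  refine ⟨x, hxh, fun y hy => ?_⟩
  rw [Submodule.mem_iInf] at hx
  simpa using hx ⟨y, hy⟩

include hab hπs hπ0 hqs hq0 hq in
/-- A maximal toral subalgebra is self-centralizing, relative to auxiliary quotients. -/
lemma mem_of_centralizes_aux {t : LieSubalgebra K L}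
    (ht : ∀ x ∈ t, ∀ y ∈ t, ⁅x, y⁆ = 0)
    (hd : ∀ x ∈ t, ⨆ a, End.eigenspace (toEnd K L L x) a = ⊤)
    (hmax : ∀ T : LieSubalgebra K L, (∀ x ∈ T, ∀ y ∈ T, ⁅x, y⁆ = 0) →
      (∀ x ∈ T, ⨆ a, End.eigenspace (toEnd K L L x) a = ⊤) → t ≤ T → T ≤ t)
    {x : L} (hx : ∀ y ∈ t, ⁅y, x⁆ = 0) : x ∈ t := by
  obtain ⟨ω, hinv, halt, hiso⟩ := exists_radical_form hab hπs hqs hq0 hq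
  have hπd : ∀ y : L, ∀ z, π (toEnd K L L y z) = toEnd K s s (π y) (π z) := fun y z =>
    LieHom.map_lie π y z
  obtain ⟨H, hHc, htH, hHt⟩ := exists_cartan_of_diagonalizable (π '' (t : Set L))
    (by
      rintro _ ⟨a, ha, rfl⟩ _ ⟨b, hb, rfl⟩
      rw [← LieHom.map_lie, ht a ha b hb, map_zero])
    (by
      rintro _ ⟨a, ha, rfl⟩
      exact iSup_eigenspace_of_surjective (φ := (π : L →ₗ[K] s)) hπs (hπd a) (hd a ha))
  obtain ⟨h, e, f, hef, he, hf, hh⟩ := exists_principal_triple H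
  obtain ⟨h0, hh0, hh0t⟩ := exists_lift_commuting hπs (t := (t : Set L)) ht hd (h := (h : s))
    (fun y hy => hHt _ h.2 _ ⟨y, hy, rfl⟩)
  set F : K → Submodule K L := fun a => End.maxGenEigenspace (toEnd K L L h0) a with hF
  have hHd : ∀ z ∈ H, ⨆ a, End.eigenspace (toEnd K s s z) a = ⊤ := fun z hz =>
    iSup_eigenspace_of_mem_cartan H hz
  have hVd : ∀ z ∈ H, ⨆ a, End.eigenspace (toEnd K s V z) a = ⊤ := fun z hz =>
    iSup_eigenspace_toEnd_eq_top ω hinv hiso (hHd z hz)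
  have hVeven : ∀ {k : ℤ} {v : V}, ⁅(h : s), v⁆ = (2 * k : K) • v → v = 0 := fun hv =>
    no_even_eigenvector ω hinv halt hiso H h.2 hef he hf (mem_span_of_principal H hh) hv
  have hπF : ∀ {y z : L} {a : K}, π y ∈ H → z ∈ End.maxGenEigenspace (toEnd K L L y) a →
      ⁅π y, π z⁆ = a • π z := by
    intro y z a hy hz
    have h1 := map_mem_maxGenEigenspace (φ := (π : L →ₗ[K] s)) (hπd y) hz
    rw [maxGenEigenspace_eq_eigenspace (hHd _ hy)] at h1
    exact End.mem_eigenspace_iff.1 h1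
  have hqF : ∀ {y z : L} {a : K} (hzr : z ∈ radical K L), π y ∈ H →
      z ∈ End.maxGenEigenspace (toEnd K L L y) a → ⁅π y, q ⟨z, hzr⟩⁆ = a • q ⟨z, hzr⟩ := by
    intro y z a hzr hy hz
    have h1 := mem_maxGenEigenspace_of_map (f := toEnd K L (radical K L) y)
      (φ := (radical K L).toSubmodule.subtype) Subtype.val_injective (fun _ => rfl)
      (x := ⟨z, hzr⟩) hz
    have h2 := map_mem_maxGenEigenspace (φ := q) (f' := toEnd K s V (π y)) (hq y) h1
    rw [maxGenEigenspace_eq_eigenspace (hVd _ hy)] at h2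
    exact End.mem_eigenspace_iff.1 h2
  have hπh : π h0 ∈ H := hh0 ▸ h.2
  have hcenter : ∀ {k : ℤ} {z : L}, z ∈ F (2 * k) → π z = 0 → z ∈ center K L := by
    intro k z hz hz0
    have h1 := hqF ((hπ0 z).1 hz0) hπh hz
    rw [hh0] at h1
    exact (hq0 _).1 (hVeven h1)
  have hcF : ∀ {a : K} {z : L}, a ≠ 0 → z ∈ F a → z ∈ center K L → z = 0 := by
    intro a z ha hz hzc
    have h1 : z ∈ End.maxGenEigenspace (toEnd K L L h0) 0 := by
      refine (End.mem_maxGenEigenspace _ _ _).2 ⟨1, ?_⟩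
      rw [pow_one, zero_smul, sub_zero, toEnd_apply_apply, ← lie_skew,
        mem_center_iff.1 hzc, neg_zero]
    exact Submodule.disjoint_def.1 ((End.independent_maxGenEigenspace (toEnd K L L h0)).pairwiseDisjoint
      ha) z hz h1
  have hlieF : ∀ {a b : K} {y z : L}, y ∈ F a → z ∈ F b → ⁅y, z⁆ ∈ F (a + b) := fun hy hz =>
    lie_mem_maxGenEigenspace_toEnd hy hz
  have hevenzero : ∀ {k : ℤ} {z : L}, k ≠ 0 → z ∈ F (2 * k) → π z = 0 → z = 0 := by
    intro k z hk hz hz0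
    exact hcF (mul_ne_zero two_ne_zero (by exact_mod_cast hk)) hz (hcenter hz hz0)
  set T : LieSubalgebra K L := LieSubalgebra.engel K h0 with hT
  have hTF : ∀ {z : L}, z ∈ T ↔ z ∈ F 0 := Iff.rfl
  have hTH : ∀ {z : L}, z ∈ T → π z ∈ H := by
    intro z hz
    refine mem_cartan_of_lie_eq_zero hh ?_
    have := hπF hπh hz
    rwa [hh0, zero_smul] at this
  have hTc : ∀ {z : L}, z ∈ T → π z = 0 → z ∈ center K L := by
    intro z hz hz0
    refine hcenter (k := 0) ?_ hz0
    rw [Int.cast_zero, mul_zero]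
    exact hz
  have hlift : ∀ {a : K} {z : s}, ⁅(h : s), z⁆ = a • z → ∃ z' ∈ F a, π z' = z := by
    intro a z hz
    refine exists_preimage_of_iSupIndep (φ := (π : L →ₗ[K] s))
      (End.iSup_maxGenEigenspace_eq_top (toEnd K L L h0))
      (End.independent_maxGenEigenspace (toEnd K s s (h : s))) hπs ?_ ?_
    · intro b x hx
      refine map_mem_maxGenEigenspace (φ := (π : L →ₗ[K] s)) ?_ hx
      intro y
      rw [← hh0]
      exact hπd h0 y
    · exact (End.genEigenspace _ a).mono le_top (End.mem_eigenspace_iff.2 hz)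
  have hTab : ∀ y ∈ T, ∀ z ∈ T, ⁅y, z⁆ = 0 := by
    intro y hy z hz
    have hz1 : ∃ z' ∈ T, π z' = π z ∧ ⁅y, z'⁆ = 0 := by
      have h1 := mem_span_lie_of_mem_cartan H (hTH hz)
      generalize π z = w at h1
      induction h1 using Submodule.span_induction with
      | mem w hw =>
        obtain ⟨α, hα, e, he, f, hf, rfl⟩ := hw
        obtain ⟨n, hn, hαn⟩ := hh α hα
        have he1 := fun x => lie_eq_smul_of_mem_rootSpace he x
        have hf1 := fun x => lie_eq_smul_of_mem_rootSpace hf x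
        simp only [Pi.neg_apply] at hf1
        obtain ⟨e', he', rfl⟩ := hlift (he1 h)
        obtain ⟨f', hf', rfl⟩ := hlift (hf1 h)
        have hyH := hTH hy
        have hye : ⁅y, e'⁆ = α ⟨π y, hyH⟩ • e' := by
          rw [← sub_eq_zero]
          refine hevenzero hn (?_ : _ ∈ F (2 * n)) ?_
          · rw [← hαn]
            refine sub_mem ?_ (Submodule.smul_mem _ _ he')
            have := hlieF hy he'
            rwa [zero_add] at this
          · rw [map_sub, LieHom.map_lie, map_smul, sub_eq_zero]
            exact he1 ⟨π y, hyH⟩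
        have hyf : ⁅y, f'⁆ = (-α ⟨π y, hyH⟩) • f' := by
          rw [← sub_eq_zero]
          refine hevenzero (neg_ne_zero.2 hn) (?_ : _ ∈ F (2 * (-n : ℤ))) ?_
          · rw [Int.cast_neg, mul_neg, ← hαn]
            refine sub_mem ?_ (Submodule.smul_mem _ _ hf')
            have := hlieF hy hf'
            rwa [zero_add] at this
          · rw [map_sub, LieHom.map_lie, map_smul, sub_eq_zero]
            exact hf1 ⟨π y, hyH⟩
        refine ⟨⁅e', f'⁆, ?_, LieHom.map_lie _ _ _, ?_⟩
        · have := hlieF he' hf'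
          rw [add_neg_cancel] at this
          exact this
        · rw [leibniz_lie, hye, hyf, smul_lie, lie_smul, neg_smul, add_neg_cancel]
      | zero => exact ⟨0, zero_mem _, map_zero _, lie_zero _⟩
      | add a b _ _ ha hb =>
        obtain ⟨a', h1, h2, h3⟩ := ha
        obtain ⟨b', h4, h5, h6⟩ := hb
        exact ⟨a' + b', add_mem h1 h4, by rw [map_add, h2, h5], by rw [lie_add, h3, h6, add_zero]⟩
      | smul c a _ ha =>
        obtain ⟨a', h1, h2, h3⟩ := ha
        exact ⟨c • a', T.smul_mem c h1, by rw [map_smul, h2], by rw [lie_smul, h3, smul_zero]⟩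
    obtain ⟨z', hz', hπz, hyz⟩ := hz1
    have h1 := mem_center_iff.1 (hTc (sub_mem hz hz') (by rw [map_sub, hπz, sub_self])) y
    rw [← lie_skew, neg_eq_zero, lie_sub, hyz, sub_zero] at h1
    exact h1
  have hTd : ∀ y ∈ T, ⨆ a, End.eigenspace (toEnd K L L y) a = ⊤ := by
    intro y hy
    rw [eq_top_iff, ← End.iSup_maxGenEigenspace_eq_top (toEnd K L L h0)]
    refine iSup_le fun a => ?_
    have hstab : ∀ z ∈ F a, toEnd K L L y z ∈ F a := fun z hz => by
      have := hlieF hy hz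
      rwa [zero_add] at this
    have h1 := Submodule.inf_iSup_genEigenspace (f := toEnd K L L y) hstab ⊤
    have h2 : ⨆ b, (toEnd K L L y).genEigenspace b ⊤ = ⊤ :=
      End.iSup_maxGenEigenspace_eq_top (toEnd K L L y)
    rw [h2, inf_top_eq] at h1
    change F a ≤ _
    rw [h1]
    refine iSup_mono fun b => ?_
    rintro z ⟨hz, hzb⟩
    rw [End.mem_eigenspace_iff, toEnd_apply_apply, ← sub_eq_zero]
    have hu : ⁅y, z⁆ - b • z ∈ F a := sub_mem (hstab z hz) (Submodule.smul_mem _ _ hz)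
    have hπu : π (⁅y, z⁆ - b • z) = 0 := by
      rw [map_sub, LieHom.map_lie, map_smul, sub_eq_zero]
      exact hπF (hTH hy) hzb
    by_cases ha0 : a = 0
    · subst ha0
      by_cases hb0 : b = 0
      · rw [hTab y hy z hz, hb0, zero_smul, sub_zero]
      · have : z = 0 := by
          have h3 : z ∈ End.maxGenEigenspace (toEnd K L L y) 0 :=
            (End.mem_maxGenEigenspace _ _ _).2 ⟨1, by
              rw [pow_one, zero_smul, sub_zero, toEnd_apply_apply, hTab y hy z hz]⟩
          exact Submodule.disjoint_def.1
            ((End.independent_maxGenEigenspace (toEnd K L L y)).pairwiseDisjoint hb0) z hzb h3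
        rw [this, lie_zero, smul_zero, sub_zero]
    by_cases hk : ∃ k : ℤ, a = 2 * k
    · obtain ⟨k, rfl⟩ := hk
      refine hevenzero ?_ hu hπu
      rintro rfl
      simp at ha0
    · have hz0 : π z = 0 := by
        by_contra hne
        have h3 := hπF hπh hz
        rw [hh0] at h3
        exact hk (eq_even_of_eigen hh hne h3)
      refine hcF ha0 hu ?_
      have hzr := (hπ0 z).1 hz0
      have h4 := hqF hzr (hTH hy) hzb
      rw [← hq, ← map_smul, ← sub_eq_zero, ← map_sub, hq0] at h4
      exact h4
  have hle : T ≤ t := hmax T hTab hTd fun y hy => by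
    refine hTF.2 ((End.mem_maxGenEigenspace _ _ _).2 ⟨1, ?_⟩)
    rw [pow_one, zero_smul, sub_zero, toEnd_apply_apply, ← lie_skew, hh0t y hy, neg_zero]
  have hmemT : ∀ {y : L}, ⁅h0, y⁆ = 0 → y ∈ T := fun {y} hy =>
    hTF.2 ((End.mem_maxGenEigenspace _ _ _).2 ⟨1, by
      rw [pow_one, zero_smul, sub_zero, toEnd_apply_apply, hy]⟩)
  exact hle (hmemT (hx h0 (hle (hmemT (lie_self h0)))))

end MaxToral

section MaxToralConcrete

open LieAlgebra LieAlgebra.IsKilling LieModule Module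

variable {K : Type} [Field K] [CharZero K] [IsAlgClosed K]
variable {L : Type} [LieRing L] [LieAlgebra K L] [FiniteDimensional K L]

/-- The projection of a Lie algebra to a quotient, as a morphism of Lie algebras. -/
def quotientLieHom (I : LieIdeal K L) : L →ₗ⁅K⁆ L ⧸ I where
  toLinearMap := (LieSubmodule.Quotient.mk' I : L →ₗ[K] L ⧸ I)
  map_lie' := by
    intro x y
    exact LieSubmodule.Quotient.mk_bracket (I := I) x y

lemma quotientLieHom_surjective (I : LieIdeal K L) : Function.Surjective (quotientLieHom I) :=
  LieSubmodule.Quotient.surjective_mk' I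

lemma quotientLieHom_eq_zero {I : LieIdeal K L} {x : L} : quotientLieHom I x = 0 ↔ x ∈ I :=
  LieSubmodule.Quotient.mk_eq_zero I

lemma derivedSeriesOfIdeal_comap_le {L' : Type} [LieRing L'] [LieAlgebra K L'] (f : L →ₗ⁅K⁆ L')
    (J : LieIdeal K L') (k : ℕ) :
    derivedSeriesOfIdeal K L k (J.comap f) ≤ (derivedSeriesOfIdeal K L' k J).comap f := by
  induction k with
  | zero => simp
  | succ k ih =>
    rw [derivedSeriesOfIdeal_succ, derivedSeriesOfIdeal_succ]
    exact (LieSubmodule.mono_lie ih ih).trans (LieIdeal.comap_bracket_le f)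

lemma hasTrivialRadical_quotient_radical : HasTrivialRadical K (L ⧸ radical K L) := by
  rw [hasTrivialRadical_iff, eq_bot_iff]
  set J := radical K (L ⧸ radical K L) with hJ
  obtain ⟨k, hk⟩ := (isSolvable_iff K J).1 (radicalIsSolvable K _)
  obtain ⟨l, hl⟩ := (isSolvable_iff K (radical K L)).1 (radicalIsSolvable K _)
  rw [LieIdeal.derivedSeries_eq_bot_iff] at hk hl
  have h1 := derivedSeriesOfIdeal_comap_le (quotientLieHom (radical K L)) J k
  rw [hk] at h1
  have h2 : derivedSeriesOfIdeal K L k (J.comap (quotientLieHom (radical K L))) ≤ radical K L := by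
    refine h1.trans fun x hx => ?_
    rw [LieIdeal.mem_comap, LieSubmodule.mem_bot, quotientLieHom_eq_zero] at hx
    exact hx
  have h3 : derivedSeriesOfIdeal K L (l + k) (J.comap (quotientLieHom (radical K L))) = ⊥ := by
    rw [derivedSeriesOfIdeal_add, eq_bot_iff, ← hl]
    exact derivedSeriesOfIdeal_mono h2 l
  have h4 : IsSolvable (J.comap (quotientLieHom (radical K L))) :=
    (isSolvable_iff K _).2 ⟨l + k, (LieIdeal.derivedSeries_eq_bot_iff _ _).2 h3⟩
  rw [LieIdeal.solvable_iff_le_radical] at h4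
  intro x hx
  obtain ⟨x, rfl⟩ := quotientLieHom_surjective _ x
  rw [LieSubmodule.mem_bot, quotientLieHom_eq_zero]
  exact h4 ((LieIdeal.mem_comap).2 hx)

lemma mem_of_centralizes (hab : ∀ I : LieIdeal K L, IsLieAbelian I → I ≤ center K L)
    {t : LieSubalgebra K L}
    (ht : ∀ x ∈ t, ∀ y ∈ t, ⁅x, y⁆ = 0)
    (hd : ∀ x ∈ t, ⨆ a, End.eigenspace (toEnd K L L x) a = ⊤)
    (hmax : ∀ T : LieSubalgebra K L, (∀ x ∈ T, ∀ y ∈ T, ⁅x, y⁆ = 0) →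
      (∀ x ∈ T, ⨆ a, End.eigenspace (toEnd K L L x) a = ⊤) → t ≤ T → T ≤ t)
    {x : L} (hx : ∀ y ∈ t, ⁅y, x⁆ = 0) : x ∈ t := by
  have := hasTrivialRadical_quotient_radical (K := K) (L := L)
  let R := radical K L
  let Z : Submodule K R := (center K L).toSubmodule.comap R.toSubmodule.subtype
  let V := R ⧸ Z
  have hZ : ∀ (a : L) (r : R), r ∈ Z → ⁅a, r⁆ ∈ Z := fun a r hr => by
    have : (r : L) ∈ center K L := hr
    exact LieSubmodule.lie_mem _ this
  let act : L →ₗ[K] Module.End K V :=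
    { toFun := fun a => Z.mapQ Z (toEnd K L R a) (fun r hr => hZ a r hr)
      map_add' := by
        intro a b
        refine LinearMap.ext fun v => ?_
        obtain ⟨r, rfl⟩ := Z.mkQ_surjective v
        change Z.mkQ ⁅a + b, r⁆ = Z.mkQ ⁅a, r⁆ + Z.mkQ ⁅b, r⁆
        rw [add_lie, map_add]
      map_smul' := by
        intro c a
        refine LinearMap.ext fun v => ?_
        obtain ⟨r, rfl⟩ := Z.mkQ_surjective v
        change Z.mkQ ⁅c • a, r⁆ = c • Z.mkQ ⁅a, r⁆
        rw [smul_lie, map_smul] }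
  have hact : ∀ (a : L) (r : R), act a (Z.mkQ r) = Z.mkQ ⁅a, r⁆ := fun a r => rfl
  let act' : L ⧸ R →ₗ[K] Module.End K V := Submodule.liftQ R.toSubmodule act (by
    intro a ha
    rw [LinearMap.mem_ker]
    ext r
    change Z.mkQ ⁅a, r⁆ = 0
    rw [Submodule.mkQ_apply, Submodule.Quotient.mk_eq_zero]
    exact radical_lie_radical_le_center hab (LieSubmodule.lie_mem_lie ha r.2))
  have hact' : ∀ (a : L) (r : R), act' (quotientLieHom R a) (Z.mkQ r) = Z.mkQ ⁅a, r⁆ :=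
    fun a r => rfl
  let _ : LieRingModule (L ⧸ R) V :=
    { bracket := fun a v => act' a v
      add_lie := fun a b v => by
        change act' (a + b) v = act' a v + act' b v
        rw [map_add, LinearMap.add_apply]
      lie_add := fun a v w => map_add (act' a) v w
      leibniz_lie := fun a b v => by
        obtain ⟨a, rfl⟩ := quotientLieHom_surjective _ a
        obtain ⟨b, rfl⟩ := quotientLieHom_surjective _ b
        obtain ⟨r, rfl⟩ := Z.mkQ_surjective v
        change act' _ (act' _ _) = act' ⁅_, _⁆ _ + act' _ (act' _ _)
        rw [← LieHom.map_lie, hact', hact', hact', hact', hact', ← map_add, leibniz_lie] }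
  have : LieModule K (L ⧸ R) V :=
    { smul_lie := fun c a v => by
        change act' (c • a) v = c • act' a v
        rw [map_smul, LinearMap.smul_apply]
      lie_smul := fun c a v => map_smul (act' a) c v }
  refine mem_of_centralizes_aux hab (π := quotientLieHom R) (quotientLieHom_surjective _)
    (fun x => quotientLieHom_eq_zero) (q := Z.mkQ) Z.mkQ_surjective (fun y => ?_) (fun a r => ?_)
    ht hd hmax hx
  · rw [Submodule.mkQ_apply, Submodule.Quotient.mk_eq_zero]
    rfl
  · exact (hact' a r).symm

end MaxToralConcrete

section SetupCentralizer

open LieAlgebra LieModule Module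

variable {K : Type} [Field K] [IsAlgClosed K] [CharZero K]
variable {g : Type} [LieRing g] [LieAlgebra K g]

lemma exists_dual_of_eigenvector {t : LieSubalgebra K g} {v : g} (hv : v ≠ 0) {c : t → K}
    (hc : ∀ y : t, ⁅(y : g), v⁆ = c y • v) : ∃ α : Dual K t, ∀ y, α y = c y := by
  have hinj := smul_left_injective K hv
  refine ⟨{ toFun := c, map_add' := fun y z => hinj ?_, map_smul' := fun a y => hinj ?_ },
    fun y => rfl⟩
  · change c (y + z) • v = (c y + c z) • v
    rw [← hc, add_smul, ← hc, ← hc, ← add_lie]; rfl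
  · change c (a • y) • v = (a • c y) • v
    rw [← hc, smul_assoc, ← hc, ← smul_lie]; rfl

lemma isToralIn_map {s : LieSubalgebra K g} [FiniteDimensional K s] {T : LieSubalgebra K s}
    (hT : ∀ x ∈ T, ∀ y ∈ T, ⁅x, y⁆ = 0)
    (hd : ∀ x ∈ T, ⨆ a, End.eigenspace (toEnd K s s x) a = ⊤) :
    IsToralIn K g s (T.map s.incl) := by
  refine ⟨?_, ?_, ?_⟩
  · rintro _ ⟨x, -, rfl⟩
    exact x.2
  · refine ⟨?_⟩
    rintro ⟨_, x, hx, rfl⟩ ⟨_, y, hy, rfl⟩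
    refine Subtype.ext ?_
    exact congrArg (s.incl) (hT x hx y hy)
  · have htop := iSup_iInf_eigenspace_eq_top (fun y : T => toEnd K s s (y : s))
      (fun x y => commute_toEnd (hT x x.2 y y.2)) (fun x => hd x x.2)
    intro z hz
    have hz' : (⟨z, hz⟩ : s) ∈ (⊤ : Submodule K s) := trivial
    rw [← htop] at hz'
    have hz2 := Submodule.mem_map_of_mem (f := s.toSubmodule.subtype) hz'
    rw [Submodule.map_iSup] at hz2
    refine (iSup_le (α := Submodule K g) fun χ => ?_) hz2
    rintro _ ⟨v, hv, rfl⟩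
    by_cases hv0 : v = 0
    · rw [hv0, map_zero]; exact Submodule.zero_mem _
    have hev : ∀ y : T, ⁅(y : s), v⁆ = χ y • v := fun y =>
      End.mem_eigenspace_iff.1 ((Submodule.mem_iInf _).1 hv y)
    have key : ∀ y : (T.map s.incl), ∃ c : K, ⁅(y : g), (v : g)⁆ = c • (v : g) := by
      rintro ⟨_, y, hy, rfl⟩
      exact ⟨χ ⟨y, hy⟩, congrArg (s.incl) (hev ⟨y, hy⟩)⟩
    choose c hc using key
    obtain ⟨α, hα⟩ := exists_dual_of_eigenvector (v := (v : g)) (by simpa using hv0) hc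
    refine Submodule.mem_iSup_of_mem α ⟨v.2, fun y => ?_⟩
    rw [hα]; exact hc y

namespace Setup

variable (S : Setup K g)

lemma lie_h_h {x y : g} (hx : x ∈ S.h) (hy : y ∈ S.h) : ⁅x, y⁆ = 0 := by
  obtain ⟨n, hn⟩ := S.F_exhaust x
  obtain ⟨m, hm⟩ := S.F_exhaust y
  have := (S.h_maxToral (max n m)).1.2.1
  have := this.trivial ⟨x, hx, S.F_mono (le_max_left n m) hn⟩ ⟨y, hy, S.F_mono (le_max_right n m) hm⟩
  exact congrArg Subtype.val this

lemma mem_h_of_centralizes {n : ℕ} {x : g} (hxn : x ∈ S.F n)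
    (hx : ∀ y ∈ S.h, y ∈ S.F n → ⁅y, x⁆ = 0) : x ∈ S.h := by
  have := S.F_findim n
  obtain ⟨⟨h1, h2, h3⟩, hmax⟩ := S.h_maxToral n
  suffices H : (⟨x, hxn⟩ : S.F n) ∈ S.h.comap (S.F n).incl from H
  refine mem_of_centralizes (S.F_reductive n) ?_ ?_ ?_ ?_
  · intro y hy z hz
    exact Subtype.ext (S.lie_h_h hy hz)
  · intro y hy
    rw [eq_top_iff]
    rintro z -
    have hz := h3 z.2
    have : (⨆ α : Dual K ↥(S.h ⊓ S.F n), (S.F n).toSubmodule ⊓ adWeightSpace K g (S.h ⊓ S.F n) α) ≤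
        (⨆ a, End.eigenspace (toEnd K (S.F n) (S.F n) y) a).map (S.F n).toSubmodule.subtype := by
      refine iSup_le fun α => ?_
      rintro v ⟨hv1, hv2⟩
      refine ⟨⟨v, hv1⟩, Submodule.mem_iSup_of_mem (α ⟨y, hy, y.2⟩) ?_, rfl⟩
      rw [End.mem_eigenspace_iff]
      exact Subtype.ext (hv2 ⟨y, hy, y.2⟩)
    obtain ⟨w, hw, hwz⟩ := this hz
    rwa [← Subtype.ext hwz]
  · intro T hT hd hle
    have := hmax _ (isToralIn_map hT hd) (by
      rintro y ⟨hy, hyn⟩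
      exact ⟨⟨y, hyn⟩, hle hy, rfl⟩)
    intro y hy
    have hy' : (y : g) ∈ T.map (S.F n).incl := ⟨y, hy, rfl⟩
    rw [this] at hy'
    exact hy'.1
  · intro y hy
    exact Subtype.ext (hx y hy y.2)

lemma adWeightSpace_zero : adWeightSpace K g S.h 0 = S.h.toSubmodule := by
  ext x
  constructor
  · intro hx
    obtain ⟨n, hn⟩ := S.F_exhaust x
    refine S.mem_h_of_centralizes hn fun y hy _ => ?_
    rw [hx ⟨y, hy⟩, LinearMap.zero_apply, zero_smul]
  · intro hx H
    rw [S.lie_h_h H.2 hx, LinearMap.zero_apply, zero_smul]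

end Setup

end SetupCentralizer

section RootVectors

open LieAlgebra LieModule Module

variable {K : Type} [Field K] [IsAlgClosed K] [CharZero K]
variable {g : Type} [LieRing g] [LieAlgebra K g]

lemma lie_mem_adWeightSpace {h : LieSubalgebra K g} {α β : Dual K h} {x y : g}
    (hx : x ∈ adWeightSpace K g h α) (hy : y ∈ adWeightSpace K g h β) :
    ⁅x, y⁆ ∈ adWeightSpace K g h (α + β) := by
  intro H
  rw [leibniz_lie, hx H, hy H, smul_lie, lie_smul, LinearMap.add_apply, add_smul]

lemma ad_pow_mem_adWeightSpace {h : LieSubalgebra K g} {α β : Dual K h} {x y : g}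
    (hx : x ∈ adWeightSpace K g h α) (hy : y ∈ adWeightSpace K g h β) (k : ℕ) :
    ((ad K g x) ^ k) y ∈ adWeightSpace K g h (β + k • α) := by
  induction k with
  | zero => simpa using hy
  | succ k ih =>
    rw [pow_succ', Module.End.mul_apply, ad_apply]
    have := lie_mem_adWeightSpace hx ih
    rwa [add_comm, add_assoc, ← succ_nsmul] at this

/-- The basic commutation formula in `sl₂`-modules. -/
lemma lie_ad_pow_succ {e f h x : g} {c : K} (hef : ⁅e, f⁆ = h) (he : ⁅h, e⁆ = (2 : K) • e)
    (hx : ⁅h, x⁆ = c • x) (h0 : ⁅e, ⁅f, x⁆⁆ = 0) (j : ℕ) :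
    ⁅f, ((ad K g e) ^ (j + 1)) x⁆ = (-((j + 1) * (c + j)) : K) • ((ad K g e) ^ j) x := by
  have hw : ∀ j : ℕ, ⁅h, ((ad K g e) ^ j) x⁆ = (c + 2 * j) • ((ad K g e) ^ j) x := by
    intro j
    induction j with
    | zero => simpa using hx
    | succ j ih =>
      rw [pow_succ', Module.End.mul_apply, ad_apply, leibniz_lie, he, ih, smul_lie, lie_smul,
        ← add_smul]
      push_cast
      ring_nf
  have hstep : ∀ y : g, ⁅f, ⁅e, y⁆⁆ = ⁅e, ⁅f, y⁆⁆ - ⁅h, y⁆ := by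
    intro y
    rw [← hef, lie_lie]; abel
  induction j with
  | zero =>
    rw [zero_add, pow_one, pow_zero, ad_apply, hstep, h0, hx]
    simp
  | succ j ih =>
    rw [pow_succ', Module.End.mul_apply, ad_apply, hstep, ih, hw, lie_smul, ← ad_apply K g e,
      ← Module.End.mul_apply, ← pow_succ', ← sub_smul]
    push_cast
    ring_nf

namespace Setup

variable (S : Setup K g)

lemma isCompl_weight (α : Dual K S.h) : IsCompl (adWeightSpace K g S.h α)
    (⨆ β, ⨆ _ : β ≠ α, adWeightSpace K g S.h β) := by
  refine IsCompl.of_le (S.h_indep α).le_bot ?_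
  rw [← S.h_span]
  refine iSup_le fun β => ?_
  by_cases hβ : β = α
  · rw [hβ]; exact le_sup_left
  · exact le_sup_of_le_right (le_iSup₂_of_le β hβ le_rfl)

/-- The projection to a weight space. -/
def proj (α : Dual K S.h) : g →ₗ[K] g :=
  Submodule.projection _ _ (S.isCompl_weight α)

lemma proj_mem (α : Dual K S.h) (x : g) : S.proj α x ∈ adWeightSpace K g S.h α :=
  Submodule.projection_apply_mem _ _

lemma proj_of_mem {α : Dual K S.h} {x : g} (hx : x ∈ adWeightSpace K g S.h α) :
    S.proj α x = x :=
  Submodule.projection_apply_left (S.isCompl_weight α) ⟨x, hx⟩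

lemma proj_of_mem_ne {α β : Dual K S.h} {x : g} (hx : x ∈ adWeightSpace K g S.h β)
    (hβ : β ≠ α) : S.proj α x = 0 := by
  rw [proj, Submodule.projection_apply_eq_zero_iff]
  exact Submodule.mem_iSup_of_mem β (Submodule.mem_iSup_of_mem hβ hx)

lemma weight_induction {p : g → Prop} (h0 : p 0) (hadd : ∀ x y, p x → p y → p (x + y))
    (hw : ∀ α x, x ∈ adWeightSpace K g S.h α → p x) (x : g) : p x := by
  have hx : x ∈ ⨆ α, adWeightSpace K g S.h α := by rw [S.h_span]; trivial
  exact Submodule.iSup_induction _ (motive := p) hx hw h0 hadd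

lemma lie_proj {α : Dual K S.h} {x : g} (hx : x ∈ adWeightSpace K g S.h α) (β : Dual K S.h)
    (y : g) : ⁅x, S.proj β y⁆ = S.proj (α + β) ⁅x, y⁆ := by
  refine S.weight_induction (p := fun y => ⁅x, S.proj β y⁆ = S.proj (α + β) ⁅x, y⁆)
    (by simp) ?_ ?_ y
  · intro a b ha hb
    rw [map_add, lie_add, lie_add, map_add, ha, hb]
  · intro γ z hz
    by_cases hγ : γ = β
    · subst hγ
      rw [S.proj_of_mem hz, S.proj_of_mem (lie_mem_adWeightSpace hx hz)]
    · rw [S.proj_of_mem_ne hz hγ, lie_zero,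
        S.proj_of_mem_ne (lie_mem_adWeightSpace hx hz) (by simpa using hγ)]

/-- The bracket of opposite root vectors lies in `h`. -/
lemma lie_mem_h {α β : Dual K S.h} {x y : g} (hx : x ∈ adWeightSpace K g S.h α)
    (hy : y ∈ adWeightSpace K g S.h β) (h : α + β = 0) : ⁅x, y⁆ ∈ S.h := by
  have := lie_mem_adWeightSpace hx hy
  rw [h, S.adWeightSpace_zero] at this
  exact this

lemma exists_F_pair (x y : g) : ∃ n, x ∈ S.F n ∧ y ∈ S.F n := by
  obtain ⟨n, hn⟩ := S.F_exhaust x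
  obtain ⟨m, hm⟩ := S.F_exhaust y
  exact ⟨max n m, S.F_mono (le_max_left n m) hn, S.F_mono (le_max_right n m) hm⟩

lemma exists_ad_pow_eq_zero {α β : Dual K S.h} (hα : α ≠ 0) {x y : g}
    (hx : x ∈ adWeightSpace K g S.h α) (hy : y ∈ adWeightSpace K g S.h β) :
    ∃ k, ((ad K g x) ^ k) y = 0 := by
  by_contra! hne
  obtain ⟨n, hxn, hyn⟩ := S.exists_F_pair x y
  have := S.F_findim n
  have hmem : ∀ k, ((ad K g x) ^ k) y ∈ S.F n := by
    intro k
    induction k with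
    | zero => simpa using hyn
    | succ k ih =>
      rw [pow_succ', Module.End.mul_apply, ad_apply]
      exact (S.F n).lie_mem hxn ih
  have hli : LinearIndependent K fun k : ℕ => ((ad K g x) ^ k) y := by
    have hinj : Function.Injective fun k : ℕ => β + k • α := by
      intro a b hab
      have : (a : K) • α = (b : K) • α := by simpa [← Nat.cast_smul_eq_nsmul K] using hab
      exact_mod_cast smul_left_injective K hα this
    exact (S.h_indep.comp hinj).linearIndependent _
      (fun k => ad_pow_mem_adWeightSpace hx hy k) hne
  have hli' : LinearIndependent K fun k : ℕ => (⟨((ad K g x) ^ k) y, hmem k⟩ : S.F n) :=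
    LinearIndependent.of_comp (S.F n).toSubmodule.subtype hli
  exact Module.Finite.not_linearIndependent_of_infinite _ hli'

/-- An `sl₂`-triple consisting of root vectors. -/
structure IsTriple (α : Dual K S.h) (H : S.h) (e f : g) : Prop where
  e_mem : e ∈ adWeightSpace K g S.h α
  f_mem : f ∈ adWeightSpace K g S.h (-α)
  lie_e_f : ⁅e, f⁆ = H
  apply_two : α H = 2

variable {S}

namespace IsTriple

variable {α β : Dual K S.h} {H : S.h} {e f x : g}

lemma ne_zero (T : S.IsTriple α H e f) : α ≠ 0 := by
  rintro rfl
  simpa using T.apply_two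

lemma e_ne_zero (T : S.IsTriple α H e f) : e ≠ 0 := by
  rintro rfl
  have h := T.lie_e_f
  rw [zero_lie] at h
  have h' : H = 0 := Subtype.ext h.symm
  simpa [h'] using T.apply_two

lemma symm (T : S.IsTriple α H e f) : S.IsTriple (-α) (-H) f e where
  e_mem := T.f_mem
  f_mem := by rw [neg_neg]; exact T.e_mem
  lie_e_f := by rw [← lie_skew, T.lie_e_f]; rfl
  apply_two := by rw [LinearMap.neg_apply, map_neg, neg_neg, T.apply_two]

lemma eq_zero_or_weight (T : S.IsTriple α H e f) (hx : x ∈ adWeightSpace K g S.h β)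
    (h0 : ⁅e, ⁅f, x⁆⁆ = 0) : x = 0 ∨ ∃ n : ℕ, β H = -n := by
  obtain ⟨k, hk⟩ := S.exists_ad_pow_eq_zero T.ne_zero T.e_mem hx
  by_contra! hcon
  obtain ⟨hx0, hcon⟩ := hcon
  induction k with
  | zero => exact hx0 (by simpa using hk)
  | succ j ih =>
    have key := lie_ad_pow_succ T.lie_e_f (by rw [T.e_mem H, T.apply_two]) (hx H) h0 j
    rw [hk, lie_zero] at key
    rcases smul_eq_zero.1 key.symm with h | h
    · rw [neg_eq_zero, mul_eq_zero] at h
      rcases h with h | h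
      · exact absurd h (by exact_mod_cast Nat.succ_ne_zero j)
      · exact hcon j (by linear_combination h)
    · exact ih h

/-- The root spaces occurring in triples are one-dimensional. -/
lemma exists_smul (T : S.IsTriple α H e f) (hx : x ∈ adWeightSpace K g S.h α) :
    ∃ c : K, x = c • e := by
  have hm : ⁅x, f⁆ ∈ S.h := S.lie_mem_h hx T.f_mem (add_neg_cancel α)
  set H' : S.h := ⟨⁅x, f⁆, hm⟩ with hH'
  refine ⟨α H' / 2, ?_⟩
  rw [← sub_eq_zero]
  have h1 : ⁅e, ⁅f, x - (α H' / 2) • e⁆⁆ = 0 := by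
    have h2 : ⁅f, x - (α H' / 2) • e⁆ = -((H' - (α H' / 2) • H : S.h) : g) := by
      rw [lie_sub, lie_smul, ← lie_skew, ← lie_skew f e, T.lie_e_f, smul_neg, sub_neg_eq_add]
      change _ = -(⁅x, f⁆ - (α H' / 2) • (H : g))
      abel
    rw [h2, lie_neg, ← lie_skew, neg_neg, T.e_mem]
    simp [T.apply_two]
  rcases T.eq_zero_or_weight (Submodule.sub_mem _ hx (Submodule.smul_mem _ _ T.e_mem)) h1 with h | h
  · exact h
  · obtain ⟨n, hn⟩ := h
    rw [T.apply_two] at hn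
    have : ((n + 2 : ℕ) : K) = 0 := by push_cast; linear_combination hn
    exact absurd this (Nat.cast_ne_zero.2 (by omega))

end IsTriple

end Setup

end RootVectors

section NilIdeal

open LieAlgebra LieModule Module

variable {K : Type} [Field K] [IsAlgClosed K] [CharZero K]
variable {g : Type} [LieRing g] [LieAlgebra K g]

/-- A diagonalizable commutator that commutes with its entries vanishes. -/
lemma eq_zero_of_commutator {V : Type} [AddCommGroup V] [Module K V] [FiniteDimensional K V]
    {A X Y : End K V} (hA : A = X * Y - Y * X) (hX : Commute A X) (hY : Commute A Y)
    (hd : ⨆ a, End.eigenspace A a = ⊤) : A = 0 := by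
  have hev : ∀ a : K, a ≠ 0 → End.eigenspace A a = ⊥ := by
    intro a ha
    set E := End.eigenspace A a with hE
    have hXE : ∀ v ∈ E, X v ∈ E := fun v hv => by
      rw [hE, End.mem_eigenspace_iff] at hv ⊢
      rw [← Module.End.mul_apply, hX.eq, Module.End.mul_apply, hv, map_smul]
    have hYE : ∀ v ∈ E, Y v ∈ E := fun v hv => by
      rw [hE, End.mem_eigenspace_iff] at hv ⊢
      rw [← Module.End.mul_apply, hY.eq, Module.End.mul_apply, hv, map_smul]
    have h1 : X.restrict hXE * Y.restrict hYE - Y.restrict hYE * X.restrict hXE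
        = a • (1 : End K E) := by
      ext v
      have := End.mem_eigenspace_iff.1 v.2
      rw [hA] at this
      exact this
    have h2 := congrArg (LinearMap.trace K E) h1
    rw [map_sub, LinearMap.trace_mul_comm, sub_self, map_smul, LinearMap.trace_one, smul_eq_mul,
      eq_comm, mul_eq_zero] at h2
    rcases h2 with h2 | h2
    · exact absurd h2 ha
    · exact Submodule.finrank_eq_zero.1 (by exact_mod_cast h2)
  have htop : End.eigenspace A 0 = ⊤ := by
    rw [eq_top_iff, ← hd]
    refine iSup_le fun a => ?_
    by_cases ha : a = 0
    · rw [ha]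
    · rw [hev a ha]; exact bot_le
  ext v
  have hv : v ∈ End.eigenspace A 0 := by rw [htop]; trivial
  simpa using End.mem_eigenspace_iff.1 hv

namespace Setup

variable (S : Setup K g)

/-- The union of the radicals of the finite-dimensional pieces. -/
def nilIdeal : LieIdeal K g where
  carrier := {x | ∃ m, ∀ n, m ≤ n → ∃ hx : x ∈ S.F n, (⟨x, hx⟩ : S.F n) ∈ radical K (S.F n)}
  zero_mem' := ⟨0, fun n _ => ⟨(S.F n).zero_mem, (radical K (S.F n)).zero_mem⟩⟩
  add_mem' := by
    rintro x y ⟨m, hm⟩ ⟨m', hm'⟩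
    refine ⟨max m m', fun n hn => ?_⟩
    obtain ⟨hx, hx'⟩ := hm n (le_trans (le_max_left _ _) hn)
    obtain ⟨hy, hy'⟩ := hm' n (le_trans (le_max_right _ _) hn)
    exact ⟨(S.F n).add_mem hx hy, (radical K (S.F n)).add_mem hx' hy'⟩
  smul_mem' := by
    rintro c x ⟨m, hm⟩
    refine ⟨m, fun n hn => ?_⟩
    obtain ⟨hx, hx'⟩ := hm n hn
    exact ⟨(S.F n).smul_mem c hx, (radical K (S.F n)).smul_mem c hx'⟩
  lie_mem := by
    rintro y x ⟨m, hm⟩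
    obtain ⟨k, hk⟩ := S.F_exhaust y
    refine ⟨max m k, fun n hn => ?_⟩
    obtain ⟨hx, hx'⟩ := hm n (le_trans (le_max_left _ _) hn)
    have hy := S.F_mono (le_trans (le_max_right _ _) hn) hk
    exact ⟨(S.F n).lie_mem hy hx, LieSubmodule.lie_mem (x := (⟨y, hy⟩ : S.F n)) _ hx'⟩

lemma lie_lie_nilIdeal {x y : g} (hx : x ∈ S.nilIdeal) (hy : y ∈ S.nilIdeal) (z : g) :
    ⁅⁅x, y⁆, z⁆ = 0 := by
  obtain ⟨m, hm⟩ := hx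
  obtain ⟨m', hm'⟩ := hy
  obtain ⟨k, hk⟩ := S.F_exhaust z
  set n := max (max m m') k with hn
  obtain ⟨hx, hx'⟩ := hm n ((le_max_left _ _).trans (le_max_left _ _))
  obtain ⟨hy, hy'⟩ := hm' n ((le_max_right _ _).trans (le_max_left _ _))
  have hz := S.F_mono (le_max_right _ _ : k ≤ n) hk
  have := S.F_findim n
  have h1 := radical_lie_radical_le_center (S.F_reductive n) (LieSubmodule.lie_mem_lie hx' hy')
  exact congrArg Subtype.val (mem_center_iff.1 h1 ⟨z, hz⟩)

include S in
/-- Abelian ideals are central. -/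
lemma lie_eq_zero_of_abelian {I : LieIdeal K g} (hI : ∀ x ∈ I, ∀ y ∈ I, ⁅x, y⁆ = 0) {x : g}
    (hx : x ∈ I) (z : g) : ⁅x, z⁆ = 0 := by
  obtain ⟨n, hxn, hzn⟩ := S.exists_F_pair x z
  have := S.F_findim n
  have h1 : (⟨x, hxn⟩ : S.F n) ∈ center K (S.F n) := by
    refine le_center_of_lie_eq_zero (S.F_reductive n) (I.comap (S.F n).incl) ?_ ?_
    · intro a ha b hb
      exact Subtype.ext (hI _ ha _ hb)
    · exact hx
  exact congrArg Subtype.val (mem_center_iff.1 h1 ⟨z, hzn⟩)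

lemma eq_zero_of_central {α : Dual K S.h} (hα : α ≠ 0) {x : g}
    (hx : x ∈ adWeightSpace K g S.h α) (h : ∀ z : g, ⁅x, z⁆ = 0) : x = 0 := by
  obtain ⟨H, hH⟩ : ∃ H, α H ≠ 0 := by
    by_contra! h0
    exact hα (LinearMap.ext h0)
  have := hx H
  rw [← lie_skew, h, neg_zero] at this
  exact (smul_eq_zero.1 this.symm).resolve_left hH

lemma exists_killing_ne_zero {x : g} (hx : x ∉ S.nilIdeal) (m : ℕ) :
    ∃ n, m ≤ n ∧ ∃ hxn : x ∈ S.F n, ∃ z : S.F n, killingForm K (S.F n) ⟨x, hxn⟩ z ≠ 0 := by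
  obtain ⟨k, hk⟩ := S.F_exhaust x
  have : ∃ n, max m k ≤ n ∧ ∀ hxn : x ∈ S.F n, (⟨x, hxn⟩ : S.F n) ∉ radical K (S.F n) := by
    by_contra! hcon
    exact hx ⟨max m k, hcon⟩
  obtain ⟨n, hn, hx'⟩ := this
  have hxn := S.F_mono ((le_max_right _ _).trans hn) hk
  have := S.F_findim n
  refine ⟨n, (le_max_left _ _).trans hn, hxn, ?_⟩
  by_contra! hcon
  refine hx' hxn (killingCompl_top_le_radical K (S.F n) ?_)
  rw [LieIdeal.mem_killingCompl]
  intro y _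
  rw [LieModule.traceForm_comm]
  exact hcon y

lemma exists_triple_of_notMem {α : Dual K S.h} (hα : α ≠ 0) {x : g}
    (hx : x ∈ adWeightSpace K g S.h α) (hxN : x ∉ S.nilIdeal) : ∃ H f, S.IsTriple α H x f := by
  obtain ⟨H0, hH0⟩ : ∃ H, α H ≠ 0 := by
    by_contra! h0
    exact hα (LinearMap.ext h0)
  obtain ⟨m, hm⟩ := S.F_exhaust H0
  obtain ⟨n, hmn, hxn, z, hz⟩ := S.exists_killing_ne_zero hxN m
  have := S.F_findim n
  have hH0n := S.F_mono hmn hm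
  set τ := killingForm K (S.F n) with hτ
  obtain ⟨⟨-, -, hspan⟩, -⟩ := S.h_maxToral n
  have hinv : ∀ a b c : S.F n, τ ⁅a, b⁆ c = -τ b ⁅a, c⁆ := fun a b c => by
    rw [hτ, ← lie_skew, map_neg, LinearMap.neg_apply, LieModule.traceForm_apply_lie_apply]
  obtain ⟨χ, y, hy, hyτ⟩ : ∃ χ : Dual K ↥(S.h ⊓ S.F n), ∃ y : S.F n,
      (y : g) ∈ adWeightSpace K g (S.h ⊓ S.F n) χ ∧ τ ⟨x, hxn⟩ y ≠ 0 := by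
    by_contra! hcon
    have : ∀ v ∈ ⨆ χ : Dual K ↥(S.h ⊓ S.F n),
        (S.F n).toSubmodule ⊓ adWeightSpace K g (S.h ⊓ S.F n) χ,
        ∀ hv : v ∈ S.F n, τ ⟨x, hxn⟩ ⟨v, hv⟩ = 0 := by
      have hle : (⨆ χ : Dual K ↥(S.h ⊓ S.F n),
          (S.F n).toSubmodule ⊓ adWeightSpace K g (S.h ⊓ S.F n) χ) ≤
          (LinearMap.ker (τ ⟨x, hxn⟩)).map (S.F n).toSubmodule.subtype := by
        refine iSup_le fun χ => ?_
        rintro v ⟨hv, hv'⟩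
        exact ⟨⟨v, hv⟩, hcon χ ⟨v, hv⟩ hv', rfl⟩
      intro v hv hvn
      obtain ⟨w, hw, rfl⟩ := hle hv
      exact hw
    exact hz (this z (hspan z.2) z.2)
  have hwt : ∀ t : g, ∀ ht : t ∈ S.h, ∀ htn : t ∈ S.F n, α ⟨t, ht⟩ + χ ⟨t, ht, htn⟩ = 0 := by
    intro t ht htn
    have h1 := hinv ⟨t, htn⟩ ⟨x, hxn⟩ y
    have h2 : ⁅(⟨t, htn⟩ : S.F n), (⟨x, hxn⟩ : S.F n)⁆ = α ⟨t, ht⟩ • ⟨x, hxn⟩ :=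
      Subtype.ext (hx ⟨t, ht⟩)
    have h3 : ⁅(⟨t, htn⟩ : S.F n), y⁆ = χ ⟨t, ht, htn⟩ • y :=
      Subtype.ext (hy ⟨t, ht, htn⟩)
    rw [h2, h3, map_smul, map_smul, LinearMap.smul_apply, smul_eq_mul, smul_eq_mul] at h1
    refine (mul_eq_zero.1 (?_ : _ * τ ⟨x, hxn⟩ y = 0)).resolve_right hyτ
    linear_combination h1
  have hcomm : ∀ t : g, t ∈ S.h → t ∈ S.F n → ⁅t, ⁅x, (y : g)⁆⁆ = 0 := by
    intro t ht htn
    rw [leibniz_lie, hx ⟨t, ht⟩, hy ⟨t, ht, htn⟩, smul_lie, lie_smul, ← add_smul, hwt t ht htn,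
      zero_smul]
  have hxy : ⁅x, (y : g)⁆ ∈ S.h :=
    S.mem_h_of_centralizes ((S.F n).lie_mem hxn y.2) hcomm
  have hne : α ⟨⁅x, (y : g)⁆, hxy⟩ ≠ 0 := by
    intro h0
    set h' : S.F n := ⁅(⟨x, hxn⟩ : S.F n), y⁆ with hh'
    have hx0 : ⁅h', (⟨x, hxn⟩ : S.F n)⁆ = 0 := Subtype.ext (by
      have := hx ⟨⁅x, (y : g)⁆, hxy⟩
      rw [h0, zero_smul] at this
      exact this)
    have hy0 : ⁅h', y⁆ = 0 := Subtype.ext (by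
      have := hy ⟨⁅x, (y : g)⁆, hxy, h'.2⟩
      have h1 := hwt _ hxy h'.2
      rw [h0, zero_add] at h1
      rw [h1, zero_smul] at this
      exact this)
    have hA : toEnd K (S.F n) (S.F n) h' = 0 := by
      refine eq_zero_of_commutator (X := toEnd K _ _ (⟨x, hxn⟩ : S.F n)) (Y := toEnd K _ _ y)
        ?_ (commute_toEnd hx0) (commute_toEnd hy0) ?_
      · exact LinearMap.ext fun v => lie_lie (⟨x, hxn⟩ : S.F n) y v
      · rw [eq_top_iff]
        rintro v -
        have hv := hspan v.2
        have : (⨆ χ : Dual K ↥(S.h ⊓ S.F n),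
            (S.F n).toSubmodule ⊓ adWeightSpace K g (S.h ⊓ S.F n) χ) ≤
            (⨆ a, End.eigenspace (toEnd K (S.F n) (S.F n) h') a).map
              (S.F n).toSubmodule.subtype := by
          refine iSup_le fun χ => ?_
          rintro v ⟨hv1, hv2⟩
          refine ⟨⟨v, hv1⟩, Submodule.mem_iSup_of_mem (χ ⟨h', hxy, h'.2⟩) ?_, rfl⟩
          rw [End.mem_eigenspace_iff]
          exact Subtype.ext (hv2 ⟨h', hxy, h'.2⟩)
        obtain ⟨w, hw, hwz⟩ := this hv
        rwa [← Subtype.ext hwz]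
    have h1 : τ (⟨H0, hH0n⟩ : S.F n) h' = α H0 * τ ⟨x, hxn⟩ y := by
      rw [hh', hτ, ← LieModule.traceForm_apply_lie_apply]
      have h2 : ⁅(⟨(H0 : g), hH0n⟩ : S.F n), (⟨x, hxn⟩ : S.F n)⁆ = α H0 • ⟨x, hxn⟩ :=
        Subtype.ext (hx H0)
      rw [h2, map_smul, LinearMap.smul_apply, smul_eq_mul]
    have h2 : τ (⟨H0, hH0n⟩ : S.F n) h' = 0 := by
      rw [hτ, LieModule.traceForm_apply_apply, hA, LinearMap.comp_zero, map_zero]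
    rw [h2] at h1
    rcases mul_eq_zero.1 h1.symm with h | h
    · exact hH0 h
    · exact hyτ h
  have hproj : ⁅x, S.proj (-α) y⁆ = ⁅x, (y : g)⁆ := by
    rw [S.lie_proj hx, add_neg_cancel, S.proj_of_mem]
    rw [S.adWeightSpace_zero]; exact hxy
  refine ⟨(2 / α ⟨⁅x, (y : g)⁆, hxy⟩) • ⟨⁅x, (y : g)⁆, hxy⟩,
    (2 / α ⟨⁅x, (y : g)⁆, hxy⟩) • S.proj (-α) y, hx, Submodule.smul_mem _ _ (S.proj_mem _ _),
    ?_, ?_⟩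
  · rw [lie_smul, hproj]; rfl
  · rw [map_smul, smul_eq_mul, div_mul_cancel₀ _ hne]

lemma IsTriple.notMem_nilIdeal {S : Setup K g} {α : Dual K S.h} {H : S.h} {e f : g}
    (T : S.IsTriple α H e f) : e ∉ S.nilIdeal := by
  intro he
  have h1 : ⁅e, f⁆ ∈ S.nilIdeal := lie_mem_left K g _ _ _ he
  have h2 := fun z => S.lie_lie_nilIdeal h1 he z
  rw [T.lie_e_f, T.e_mem, T.apply_two] at h2
  refine T.e_ne_zero (S.eq_zero_of_central T.ne_zero T.e_mem fun z => ?_)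
  have := h2 z
  rw [smul_lie] at this
  exact (smul_eq_zero.1 this).resolve_left two_ne_zero

lemma lie_eq_zero_of_mem_nilIdeal_h {x : g} (hx : x ∈ S.nilIdeal) (hxh : x ∈ S.h) (z : g) :
    ⁅x, z⁆ = 0 := by
  refine S.weight_induction (p := fun z => ⁅x, z⁆ = 0) (lie_zero _) ?_ ?_ z
  · intro a b ha hb
    rw [lie_add, ha, hb, add_zero]
  · intro β z hz
    have h1 := hz ⟨x, hxh⟩
    change ⁅x, z⁆ = _ at h1
    rw [h1]
    by_cases hc : β ⟨x, hxh⟩ = 0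
    · rw [hc, zero_smul]
    have hz' : z ∈ S.nilIdeal := by
      have : ⁅x, z⁆ ∈ S.nilIdeal := lie_mem_left K g _ _ _ hx
      rw [h1] at this
      have := S.nilIdeal.smul_mem (β ⟨x, hxh⟩)⁻¹ this
      rwa [smul_smul, inv_mul_cancel₀ hc, one_smul] at this
    have h2 := fun w => S.lie_lie_nilIdeal hx hz' w
    rw [h1] at h2
    rw [S.eq_zero_of_central (α := β) (fun h => hc (by rw [h]; rfl)) (Submodule.smul_mem _ _ hz) h2]

end Setup

end NilIdeal

section DynkinTriples

open LieAlgebra LieModule Module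

variable {K : Type} [Field K] [IsAlgClosed K] [CharZero K]
variable {g : Type} [LieRing g] [LieAlgebra K g]

namespace Setup

variable (S : Setup K g)

lemma isRootOf_of_mem {α : Dual K S.h} (hα : α ≠ 0) {x : g} (hx : x ∈ adWeightSpace K g S.h α)
    (hx0 : x ≠ 0) : IsRootOf K g S.h α :=
  ⟨hα, fun h => hx0 (by rw [h] at hx; exact hx)⟩

lemma pos_ne_zero {α : Dual K S.h} (hα : α ∈ S.pos) : α ≠ 0 := (S.pos_root α hα).1

lemma pos_add_ne_zero {α β : Dual K S.h} (hα : α ∈ S.pos) (hβ : β ∈ S.pos) : α + β ≠ 0 := by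
  intro h
  rw [eq_neg_of_add_eq_zero_right h] at hβ
  exact (S.pos_polar α (S.pos_root α hα)).1 hα hβ

lemma neg_mem_pos {α : Dual K S.h} (hα : IsRootOf K g S.h α) (h : α ∉ S.pos) : -α ∈ S.pos := by
  by_contra h'
  exact h ((S.pos_polar α hα).2 h')

/-- The part of the nil ideal with weights in a given set. -/
def nilPart (P : Set (Dual K S.h)) : Submodule K g :=
  ⨆ α : P, adWeightSpace K g S.h (α : Dual K S.h) ⊓ S.nilIdeal.toSubmodule

variable {S}

lemma mem_nilPart {P : Set (Dual K S.h)} {α : Dual K S.h} (hα : α ∈ P) {x : g}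
    (hx : x ∈ adWeightSpace K g S.h α) (hxN : x ∈ S.nilIdeal) : x ∈ S.nilPart P :=
  Submodule.mem_iSup_of_mem (⟨α, hα⟩ : P) ⟨hx, hxN⟩

lemma lie_mem_nilPart {P : Set (Dual K S.h)} {J : Submodule K g} {y : g}
    (hy : ∀ α ∈ P, ∀ x ∈ adWeightSpace K g S.h α, x ∈ S.nilIdeal → ⁅y, x⁆ ∈ J)
    {x : g} (hx : x ∈ S.nilPart P) : ⁅y, x⁆ ∈ J := by
  refine Submodule.iSup_induction _ (motive := fun x => ⁅y, x⁆ ∈ J) hx ?_ ?_ ?_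
  · rintro ⟨α, hα⟩ x ⟨hx, hxN⟩
    exact hy α hα x hx hxN
  · rw [lie_zero]; exact J.zero_mem
  · intro a b ha hb
    rw [lie_add]; exact J.add_mem ha hb

lemma eq_zero_of_nilPart {P : Set (Dual K S.h)}
    (hcl : ∀ β, ∀ y ∈ adWeightSpace K g S.h β, ∀ α ∈ P, ∀ x ∈ adWeightSpace K g S.h α,
      x ∈ S.nilIdeal → ⁅y, x⁆ ∈ S.nilPart P)
    (hab : ∀ α ∈ P, ∀ β ∈ P, ∀ x ∈ adWeightSpace K g S.h α, ∀ y ∈ adWeightSpace K g S.h β,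
      x ∈ S.nilIdeal → y ∈ S.nilIdeal → ⁅x, y⁆ = 0)
    {α : Dual K S.h} (hα : α ∈ P) (hα0 : α ≠ 0) {x : g} (hx : x ∈ adWeightSpace K g S.h α)
    (hxN : x ∈ S.nilIdeal) : x = 0 := by
  let I : LieIdeal K g :=
    { S.nilPart P with
      lie_mem := by
        intro y x hx
        refine S.weight_induction (p := fun y => ⁅y, x⁆ ∈ S.nilPart P) ?_ ?_ ?_ y
        · rw [zero_lie]; exact Submodule.zero_mem _
        · intro a b ha hb
          rw [add_lie]; exact Submodule.add_mem _ ha hb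
        · intro β y hy
          exact lie_mem_nilPart (hcl β y hy) hx }
  refine S.eq_zero_of_central hα0 hx fun z => S.lie_eq_zero_of_abelian (I := I) ?_
    (mem_nilPart hα hx hxN) z
  intro a ha b hb
  refine (Submodule.mem_bot K).1 (lie_mem_nilPart (P := P) ?_ hb)
  intro β hβ y hy hyN
  rw [Submodule.mem_bot, ← lie_skew, neg_eq_zero]
  refine (Submodule.mem_bot K).1 (lie_mem_nilPart (P := P) ?_ ha)
  intro γ hγ z hz hzN
  exact hab β hβ γ hγ y hy z hz hyN hzN

lemma lie_nil_nil {α β : Dual K S.h} {x y : g} (hx : x ∈ adWeightSpace K g S.h α)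
    (hy : y ∈ adWeightSpace K g S.h β) (hxN : x ∈ S.nilIdeal) (hyN : y ∈ S.nilIdeal)
    (h : α + β ≠ 0) : ⁅x, y⁆ = 0 :=
  S.eq_zero_of_central h (lie_mem_adWeightSpace hx hy) fun z => S.lie_lie_nilIdeal hxN hyN z

lemma lie_nil_zero {y x : g} (hx : x ∈ adWeightSpace K g S.h 0) (hxN : x ∈ S.nilIdeal) :
    ⁅y, x⁆ = 0 := by
  rw [S.adWeightSpace_zero] at hx
  rw [← lie_skew, S.lie_eq_zero_of_mem_nilIdeal_h hxN hx, neg_zero]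

lemma IsTriple.exists_eq_smul_lie {α γ : Dual K S.h} {H H' : S.h} {e f e' f' : g}
    (T : S.IsTriple α H e f) (T' : S.IsTriple γ H' e' f') (hne : ⁅e, f'⁆ ≠ 0) :
    ∃ c : K, f' = c • ⁅f, ⁅e, f'⁆⁆ := by
  have hv := lie_mem_adWeightSpace T.e_mem T'.f_mem
  have hfv := lie_mem_adWeightSpace T.f_mem hv
  rw [neg_add_cancel_left] at hfv
  by_cases h0 : ⁅f, ⁅e, f'⁆⁆ = 0
  · exfalso
    obtain ⟨n, hn⟩ := (T.symm.eq_zero_or_weight T'.f_mem h0).resolve_left T'.symm.e_ne_zero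
    obtain ⟨m, hm⟩ := (T.eq_zero_or_weight hv (by rw [h0, lie_zero])).resolve_left hne
    rw [LinearMap.add_apply, T.apply_two] at hm
    rw [map_neg] at hn
    have : ((n + m + 2 : ℕ) : K) = 0 := by push_cast; linear_combination hn + hm
    exact absurd this (Nat.cast_ne_zero.2 (by omega))
  · obtain ⟨c, hc⟩ := T'.symm.exists_smul hfv
    refine ⟨c⁻¹, ?_⟩
    have hc0 : c ≠ 0 := by rintro rfl; rw [zero_smul] at hc; exact h0 hc
    rw [hc, smul_smul, inv_mul_cancel₀ hc0, one_smul]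

variable (S) in
/-- A positive root whose opposite root space preserves the nonnegative part of the nil ideal. -/
def Good (α : Dual K S.h) : Prop :=
  α ∈ S.pos ∧ (∃ H e f, S.IsTriple α H e f) ∧
    ∀ y ∈ adWeightSpace K g S.h (-α), ∀ x ∈ S.nilPart (insert 0 S.pos),
      ⁅y, x⁆ ∈ S.nilPart (insert 0 S.pos)

lemma good_of_isSimpleRoot {α : Dual K S.h} (hα : S.IsSimpleRoot α)
    (hT : ∃ H e f, S.IsTriple α H e f) : S.Good α := by
  refine ⟨hα.1, hT, fun y hy x hx => lie_mem_nilPart ?_ hx⟩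
  intro β hβ x hx hxN
  have hN : ⁅y, x⁆ ∈ S.nilIdeal := S.nilIdeal.lie_mem hxN
  have hw := lie_mem_adWeightSpace hy hx
  rcases Set.mem_insert_iff.1 hβ with rfl | hβ
  · rw [lie_nil_zero hx hxN]; exact Submodule.zero_mem _
  by_cases h0 : ⁅y, x⁆ = 0
  · rw [h0]; exact Submodule.zero_mem _
  by_cases hαβ : -α + β = 0
  · rw [hαβ] at hw
    exact mem_nilPart (Set.mem_insert _ _) hw hN
  have hr := S.isRootOf_of_mem hαβ hw h0
  by_cases hp : -α + β ∈ S.pos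
  · exact mem_nilPart (Set.mem_insert_of_mem _ hp) hw hN
  · refine absurd ⟨{β, -(-α + β)}, by simp, ?_, by simp⟩ hα.2
    intro γ hγ
    simp only [Multiset.insert_eq_cons, Multiset.mem_cons, Multiset.mem_singleton] at hγ
    rcases hγ with rfl | rfl
    · exact hβ
    · exact S.neg_mem_pos hr hp

lemma good_add {α δ : Dual K S.h} (hα : S.Good α) (hδ : S.Good δ) {x y : g}
    (hx : x ∈ adWeightSpace K g S.h α) (hy : y ∈ adWeightSpace K g S.h δ)
    (hN : ⁅x, y⁆ ∉ S.nilIdeal) : S.Good (α + δ) := by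
  have hw := lie_mem_adWeightSpace hx hy
  have hne : ⁅x, y⁆ ≠ 0 := fun h => hN (by rw [h]; exact S.nilIdeal.zero_mem)
  have h0 := S.pos_add_ne_zero hα.1 hδ.1
  have hr := S.isRootOf_of_mem h0 hw hne
  obtain ⟨H, f, T⟩ := S.exists_triple_of_notMem h0 hw hN
  obtain ⟨hαp, ⟨Hα, eα, fα, Tα⟩, hαJ⟩ := hα
  obtain ⟨hδp, ⟨Hδ, eδ, fδ, Tδ⟩, hδJ⟩ := hδ
  refine ⟨S.pos_add α hαp δ hδp hr, ⟨H, _, f, T⟩, ?_⟩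
  have hf : ∀ u v : g, (∀ x ∈ S.nilPart (insert 0 S.pos), ⁅u, x⁆ ∈ S.nilPart (insert 0 S.pos)) →
      (∀ x ∈ S.nilPart (insert 0 S.pos), ⁅v, x⁆ ∈ S.nilPart (insert 0 S.pos)) →
      ∀ c : K, ∀ x ∈ S.nilPart (insert 0 S.pos), ⁅c • ⁅u, v⁆, x⁆ ∈ S.nilPart (insert 0 S.pos) := by
    intro u v hu hv c x hx
    rw [smul_lie, lie_lie]
    exact Submodule.smul_mem _ _ (Submodule.sub_mem _ (hu _ (hv _ hx)) (hv _ (hu _ hx)))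
  intro y' hy' z hz
  obtain ⟨c, rfl⟩ := T.symm.exists_smul hy'
  rw [smul_lie]
  refine Submodule.smul_mem _ _ ?_
  by_cases h1 : ⁅eδ, f⁆ = 0
  · have h2 : ⁅eα, f⁆ ≠ 0 := by
      intro h2
      obtain ⟨a, rfl⟩ := Tα.exists_smul hx
      obtain ⟨b, rfl⟩ := Tδ.exists_smul hy
      have h3 := T.lie_e_f
      rw [lie_lie, smul_lie b, h1, smul_lie a eα f, h2, smul_zero, smul_zero, lie_zero, lie_zero,
        sub_zero] at h3
      have h4 := T.apply_two
      rw [show H = 0 from Subtype.ext h3.symm, map_zero] at h4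
      exact two_ne_zero h4.symm
    obtain ⟨c, hc⟩ := Tα.exists_eq_smul_lie T h2
    rw [hc]
    refine hf fα _ (hαJ _ Tα.f_mem) (hδJ _ ?_) c z hz
    have := lie_mem_adWeightSpace Tα.e_mem T.f_mem
    rwa [_root_.neg_add, add_neg_cancel_left] at this
  · obtain ⟨c, hc⟩ := Tδ.exists_eq_smul_lie T h1
    rw [hc]
    refine hf fδ _ (hδJ _ Tδ.f_mem) (hαJ _ ?_) c z hz
    have := lie_mem_adWeightSpace Tδ.e_mem T.f_mem
    rwa [neg_add_rev, add_neg_cancel_left] at this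

lemma good_of_notMem (hD : S.IsDynkin) {α : Dual K S.h} (hα : α ∈ S.pos) {x : g}
    (hx : x ∈ adWeightSpace K g S.h α) (hxN : x ∉ S.nilIdeal) : S.Good α := by
  set G : Set g := {x | ∃ β, x ∈ adWeightSpace K g S.h β ∧ (β = 0 ∨ S.Good β ∨ x ∈ S.nilIdeal)}
    with hG
  have hGG : ∀ a ∈ G, ∀ b ∈ G, ⁅a, b⁆ ∈ G := by
    rintro a ⟨β, ha, ha'⟩ b ⟨γ, hb, hb'⟩
    refine ⟨β + γ, lie_mem_adWeightSpace ha hb, ?_⟩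
    by_cases hN : ⁅a, b⁆ ∈ S.nilIdeal
    · exact Or.inr (Or.inr hN)
    rcases ha' with rfl | ha' | ha'
    · rw [zero_add]
      rcases hb' with hb' | hb' | hb'
      · exact Or.inl hb'
      · exact Or.inr (Or.inl hb')
      · exact absurd (S.nilIdeal.lie_mem hb') hN
    · rcases hb' with rfl | hb' | hb'
      · rw [add_zero]; exact Or.inr (Or.inl ha')
      · exact Or.inr (Or.inl (good_add ha' hb' ha hb hN))
      · exact absurd (S.nilIdeal.lie_mem hb') hN
    · exact absurd (lie_mem_left K g _ _ _ ha') hN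
  let B : LieSubalgebra K g :=
    { Submodule.span K G with
      lie_mem' := by
        intro a b ha hb
        refine Submodule.span_induction (p := fun a _ => ⁅a, b⁆ ∈ Submodule.span K G)
          ?_ ?_ ?_ ?_ ha
        · intro a ha
          refine Submodule.span_induction (p := fun b _ => ⁅a, b⁆ ∈ Submodule.span K G)
            ?_ ?_ ?_ ?_ hb
          · exact fun b hb => Submodule.subset_span (hGG a ha b hb)
          · rw [lie_zero]; exact Submodule.zero_mem _
          · intro u v _ _ hu hv
            rw [lie_add]; exact Submodule.add_mem _ hu hv
          · intro c u _ hu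
            rw [lie_smul]; exact Submodule.smul_mem _ _ hu
        · rw [zero_lie]; exact Submodule.zero_mem _
        · intro u v _ _ hu hv
          rw [add_lie]; exact Submodule.add_mem _ hu hv
        · intro c u _ hu
          rw [smul_lie]; exact Submodule.smul_mem _ _ hu }
  have hbB : S.b ≤ B := by
    rw [hD, LieSubalgebra.lieSpan_le]
    rintro z (hz | hz)
    · exact Submodule.subset_span ⟨0, by rw [S.adWeightSpace_zero]; exact hz, Or.inl rfl⟩
    · obtain ⟨β, hβ, hz⟩ := Set.mem_iUnion₂.1 hz
      refine Submodule.subset_span ⟨β, hz, ?_⟩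
      by_cases hzN : z ∈ S.nilIdeal
      · exact Or.inr (Or.inr hzN)
      · obtain ⟨H, f, T⟩ := S.exists_triple_of_notMem (S.pos_ne_zero hβ.1) hz hzN
        exact Or.inr (Or.inl (good_of_isSimpleRoot hβ ⟨H, z, f, T⟩))
  have hxb : x ∈ S.b.toSubmodule := by
    rw [S.b_eq]
    exact Submodule.mem_sup_right (Submodule.mem_iSup_of_mem α (Submodule.mem_iSup_of_mem hα hx))
  by_contra hgood
  refine hxN ?_
  rw [← S.proj_of_mem hx]
  have hxB : x ∈ Submodule.span K G := hbB hxb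
  refine Submodule.span_induction (p := fun z _ => S.proj α z ∈ S.nilIdeal) ?_ ?_ ?_ ?_ hxB
  · rintro z ⟨β, hz, hz'⟩
    by_cases hβ : β = α
    · subst hβ
      rw [S.proj_of_mem hz]
      rcases hz' with h | h | h
      · exact absurd h (S.pos_ne_zero hα)
      · exact absurd h hgood
      · exact h
    · rw [S.proj_of_mem_ne hz hβ]; exact S.nilIdeal.zero_mem
  · rw [map_zero]; exact S.nilIdeal.zero_mem
  · intro u v _ _ hu hv
    rw [map_add]; exact S.nilIdeal.add_mem hu hv
  · intro c u _ hu
    rw [map_smul]; exact S.nilIdeal.smul_mem c hu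

lemma eq_zero_of_mem_nilIdeal_pos (hD : S.IsDynkin) {α : Dual K S.h} (hα : α ∈ S.pos) {x : g}
    (hx : x ∈ adWeightSpace K g S.h α) (hxN : x ∈ S.nilIdeal) : x = 0 := by
  refine eq_zero_of_nilPart (P := insert 0 S.pos) ?_ ?_ (Set.mem_insert_of_mem _ hα)
    (S.pos_ne_zero hα) hx hxN
  · intro β y hy α hα x hx hxN
    have hN : ⁅y, x⁆ ∈ S.nilIdeal := S.nilIdeal.lie_mem hxN
    have hw := lie_mem_adWeightSpace hy hx
    rcases Set.mem_insert_iff.1 hα with rfl | hα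
    · rw [lie_nil_zero hx hxN]; exact Submodule.zero_mem _
    by_cases h0 : ⁅y, x⁆ = 0
    · rw [h0]; exact Submodule.zero_mem _
    by_cases hβα : β + α = 0
    · rw [hβα] at hw
      exact mem_nilPart (Set.mem_insert _ _) hw hN
    have hy0 : y ≠ 0 := by rintro rfl; exact h0 (zero_lie _)
    by_cases hβ0 : β = 0
    · rw [hβ0, zero_add] at hw
      exact mem_nilPart (Set.mem_insert_of_mem _ hα) hw hN
    have hβr := S.isRootOf_of_mem hβ0 hy hy0
    by_cases hβ : β ∈ S.pos
    · exact mem_nilPart (Set.mem_insert_of_mem _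
        (S.pos_add β hβ α hα (S.isRootOf_of_mem hβα hw h0))) hw hN
    by_cases hyN : y ∈ S.nilIdeal
    · exact absurd (lie_nil_nil hy hx hyN hxN hβα) h0
    obtain ⟨H, f, T⟩ := S.exists_triple_of_notMem hβ0 hy hyN
    have hgood := good_of_notMem hD (S.neg_mem_pos hβr hβ) T.f_mem T.symm.notMem_nilIdeal
    exact hgood.2.2 y (by rwa [neg_neg]) x (mem_nilPart (Set.mem_insert_of_mem _ hα) hx hxN)
  · intro α hα β hβ x hx y hy hxN hyN
    rcases Set.mem_insert_iff.1 hβ with rfl | hβ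
    · exact lie_nil_zero hy hyN
    rcases Set.mem_insert_iff.1 hα with rfl | hα
    · rw [← lie_skew, lie_nil_zero hx hxN, neg_zero]
    exact lie_nil_nil hx hy hxN hyN (S.pos_add_ne_zero hα hβ)

lemma eq_zero_of_mem_nilIdeal (hD : S.IsDynkin) {α : Dual K S.h} (hα : α ≠ 0) {x : g}
    (hx : x ∈ adWeightSpace K g S.h α) (hxN : x ∈ S.nilIdeal) : x = 0 := by
  refine eq_zero_of_nilPart (P := Set.univ) ?_ ?_ (Set.mem_univ α) hα hx hxN
  · intro β y hy α _ x hx hxN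
    exact mem_nilPart (Set.mem_univ _) (lie_mem_adWeightSpace hy hx) (S.nilIdeal.lie_mem hxN)
  · intro α _ β _ x hx y hy hxN hyN
    by_cases hαβ : α + β = 0
    · by_cases hα : α = 0
      · subst hα
        rw [← lie_skew, lie_nil_zero hx hxN, neg_zero]
      by_cases hx0 : x = 0
      · rw [hx0, zero_lie]
      have hr := S.isRootOf_of_mem hα hx hx0
      by_cases hp : α ∈ S.pos
      · exact absurd (eq_zero_of_mem_nilIdeal_pos hD hp hx hxN) hx0
      · have := S.neg_mem_pos hr hp
        rw [← eq_neg_of_add_eq_zero_right hαβ] at this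
        rw [eq_zero_of_mem_nilIdeal_pos hD this hy hyN, lie_zero]
    · exact lie_nil_nil hx hy hxN hyN hαβ

lemma exists_triple (hD : S.IsDynkin) {α : Dual K S.h} (hα : α ≠ 0) {x : g}
    (hx : x ∈ adWeightSpace K g S.h α) (hx0 : x ≠ 0) : ∃ H f, S.IsTriple α H x f :=
  S.exists_triple_of_notMem hα hx fun h => hx0 (eq_zero_of_mem_nilIdeal hD hα hx h)

end Setup

end DynkinTriples

section RootStrings

open LieAlgebra LieModule Module

variable {K : Type} [Field K] [IsAlgClosed K] [CharZero K]
variable {g : Type} [LieRing g] [LieAlgebra K g]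

namespace Setup

variable {S : Setup K g}

namespace IsTriple

variable {α β : Dual K S.h} {H : S.h} {e f x : g}

lemma exists_int (T : S.IsTriple α H e f) (hx : x ∈ adWeightSpace K g S.h β) (hx0 : x ≠ 0) :
    ∃ m : ℤ, β H = m := by
  obtain ⟨k, hk⟩ := S.exists_ad_pow_eq_zero (neg_ne_zero.2 T.ne_zero) T.f_mem hx
  induction k with
  | zero => exact absurd (by simpa using hk) hx0
  | succ k ih =>
    by_cases h0 : ((ad K g f) ^ k) x = 0
    · exact ih h0
    rw [pow_succ', Module.End.mul_apply, ad_apply] at hk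
    obtain ⟨n, hn⟩ := (T.eq_zero_or_weight (ad_pow_mem_adWeightSpace T.f_mem hx k)
      (by rw [hk, lie_zero])).resolve_left h0
    refine ⟨2 * k - n, ?_⟩
    have : β H - k * 2 = -n := by
      simpa [← Nat.cast_smul_eq_nsmul K, T.apply_two, sub_eq_add_neg] using hn
    push_cast
    linear_combination this

lemma lie_ne_zero_of_neg (T : S.IsTriple α H e f) (hx : x ∈ adWeightSpace K g S.h β)
    (hx0 : x ≠ 0) {m : ℤ} (hm : β H = m) (hm0 : m < 0) : ⁅e, x⁆ ≠ 0 := by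
  intro h
  obtain ⟨n, hn⟩ := (T.symm.eq_zero_or_weight hx (by rw [h, lie_zero])).resolve_left hx0
  rw [map_neg, hm] at hn
  have : m = n := by exact_mod_cast neg_injective hn
  omega

lemma lie_ne_zero_of_add (T : S.IsTriple α H e f) (hx : x ∈ adWeightSpace K g S.h β)
    (hx1 : ∀ z ∈ adWeightSpace K g S.h β, ∃ c : K, z = c • x) (hx0 : x ≠ 0)
    {y : g} (hy : y ∈ adWeightSpace K g S.h (α + β)) (hy0 : y ≠ 0) : ⁅e, x⁆ ≠ 0 := by
  intro h
  have hfy := lie_mem_adWeightSpace T.f_mem hy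
  rw [neg_add_cancel_left] at hfy
  obtain ⟨c, hc⟩ := hx1 _ hfy
  obtain ⟨n, hn⟩ := (T.eq_zero_or_weight hy (by rw [hc, lie_smul, h, smul_zero])).resolve_left hy0
  rw [LinearMap.add_apply, T.apply_two] at hn
  refine T.lie_ne_zero_of_neg hx hx0 (m := -n - 2) ?_ (by omega) h
  push_cast
  linear_combination hn

end IsTriple

/-- Every nonzero root vector is part of a triple. -/
class HasTriples (S : Setup K g) : Prop where
  exists_triple : ∀ {α : Dual K S.h}, α ≠ 0 → ∀ {x : g}, x ∈ adWeightSpace K g S.h α → x ≠ 0 →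
    ∃ H f, S.IsTriple α H x f

lemma IsDynkin.hasTriples (hD : S.IsDynkin) : S.HasTriples :=
  ⟨fun hα _ hx hx0 => Setup.exists_triple hD hα hx hx0⟩

variable [S.HasTriples]

lemma exists_triple_of_isRootOf {α : Dual K S.h} (hα : IsRootOf K g S.h α) :
    ∃ H e f, S.IsTriple α H e f := by
  obtain ⟨x, hx, hx0⟩ := Submodule.exists_mem_ne_zero_of_ne_bot hα.2
  obtain ⟨H, f, T⟩ := HasTriples.exists_triple hα.1 hx hx0
  exact ⟨H, x, f, T⟩

lemma exists_smul_of_mem {α : Dual K S.h} (hα : α ≠ 0) {x y : g}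
    (hx : x ∈ adWeightSpace K g S.h α) (hx0 : x ≠ 0) (hy : y ∈ adWeightSpace K g S.h α) :
    ∃ c : K, y = c • x := by
  obtain ⟨H, f, T⟩ := HasTriples.exists_triple hα hx hx0
  exact T.exists_smul hy

lemma IsTriple.isRootOf {α : Dual K S.h} {H : S.h} {e f : g} (T : S.IsTriple α H e f) :
    IsRootOf K g S.h α := S.isRootOf_of_mem T.ne_zero T.e_mem T.e_ne_zero

lemma isRootOf_neg {α : Dual K S.h} (hα : IsRootOf K g S.h α) : IsRootOf K g S.h (-α) := by
  obtain ⟨H, e, f, T⟩ := exists_triple_of_isRootOf hα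
  exact T.symm.isRootOf

lemma lie_ne_zero {α β : Dual K S.h} {x y : g} (hα : α ≠ 0) (hβ : β ≠ 0)
    (hx : x ∈ adWeightSpace K g S.h α)
    (hx0 : x ≠ 0) (hy : y ∈ adWeightSpace K g S.h β) (hy0 : y ≠ 0)
    (hαβ : IsRootOf K g S.h (α + β)) : ⁅x, y⁆ ≠ 0 := by
  obtain ⟨z, hz, hz0⟩ := Submodule.exists_mem_ne_zero_of_ne_bot hαβ.2
  obtain ⟨H, f, T⟩ := HasTriples.exists_triple hα hx hx0
  exact T.lie_ne_zero_of_add hy (fun z hz => exists_smul_of_mem hβ hy hy0 hz) hy0 hz hz0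

variable (S) in
/-- The roots whose root vectors, together with the opposite ones, lie in `F n`. -/
def rootsIn (n : ℕ) : Set (Dual K S.h) :=
  {γ | IsRootOf K g S.h γ ∧ adWeightSpace K g S.h γ ≤ (S.F n).toSubmodule ∧
    adWeightSpace K g S.h (-γ) ≤ (S.F n).toSubmodule}

omit [S.HasTriples] in
variable (S) in
lemma rootsIn_mono : Monotone S.rootsIn := fun _ _ h _ hγ =>
  ⟨hγ.1, hγ.2.1.trans (S.F_mono h), hγ.2.2.trans (S.F_mono h)⟩

lemma neg_mem_rootsIn {n : ℕ} {γ : Dual K S.h} (hγ : γ ∈ S.rootsIn n) : -γ ∈ S.rootsIn n :=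
  ⟨isRootOf_neg hγ.1, hγ.2.2, by rw [neg_neg]; exact hγ.2.1⟩

lemma adWeightSpace_add_le {n : ℕ} {γ δ : Dual K S.h} (hγ : IsRootOf K g S.h γ)
    (hγn : adWeightSpace K g S.h γ ≤ (S.F n).toSubmodule)
    (hδ : IsRootOf K g S.h δ) (hδn : adWeightSpace K g S.h δ ≤ (S.F n).toSubmodule)
    (h : IsRootOf K g S.h (γ + δ)) :
    adWeightSpace K g S.h (γ + δ) ≤ (S.F n).toSubmodule := by
  obtain ⟨x, hx, hx0⟩ := Submodule.exists_mem_ne_zero_of_ne_bot hγ.2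
  obtain ⟨y, hy, hy0⟩ := Submodule.exists_mem_ne_zero_of_ne_bot hδ.2
  intro z hz
  obtain ⟨c, rfl⟩ := exists_smul_of_mem h.1 (lie_mem_adWeightSpace hx hy)
    (lie_ne_zero hγ.1 hδ.1 hx hx0 hy hy0 h) hz
  exact Submodule.smul_mem _ _ ((S.F n).lie_mem (hγn hx) (hδn hy))

lemma add_mem_rootsIn {n : ℕ} {γ δ : Dual K S.h} (hγ : γ ∈ S.rootsIn n) (hδ : δ ∈ S.rootsIn n)
    (h : IsRootOf K g S.h (γ + δ)) : γ + δ ∈ S.rootsIn n := by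
  refine ⟨h, adWeightSpace_add_le hγ.1 hγ.2.1 hδ.1 hδ.2.1 h, ?_⟩
  have h' := isRootOf_neg h
  rw [_root_.neg_add] at h' ⊢
  exact adWeightSpace_add_le (isRootOf_neg hγ.1) hγ.2.2 (isRootOf_neg hδ.1) hδ.2.2 h'

lemma exists_mem_rootsIn {γ : Dual K S.h} (hγ : IsRootOf K g S.h γ) : ∃ n, γ ∈ S.rootsIn n := by
  obtain ⟨H, e, f, T⟩ := exists_triple_of_isRootOf hγ
  obtain ⟨n, he, hf⟩ := S.exists_F_pair e f
  refine ⟨n, hγ, fun x hx => ?_, fun x hx => ?_⟩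
  · obtain ⟨c, rfl⟩ := T.exists_smul hx
    exact (S.F n).smul_mem c he
  · obtain ⟨c, rfl⟩ := T.symm.exists_smul hx
    exact (S.F n).smul_mem c hf

omit [S.HasTriples] in
variable (S) in
lemma rootsIn_finite (n : ℕ) : (S.rootsIn n).Finite := by
  have := S.F_findim n
  have hex : ∀ γ : S.rootsIn n, ∃ x : g, x ∈ adWeightSpace K g S.h (γ : Dual K S.h) ∧ x ≠ 0 :=
    fun γ => Submodule.exists_mem_ne_zero_of_ne_bot γ.2.1.2
  choose x hx hx0 using hex
  have hli : LinearIndependent K x :=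
    (S.h_indep.comp Subtype.val_injective).linearIndependent _ hx hx0
  have hli' : LinearIndependent K fun γ : S.rootsIn n => (⟨x γ, γ.2.2.1 (hx γ)⟩ : S.F n) :=
    LinearIndependent.of_comp (S.F n).toSubmodule.subtype hli
  have := hli'.finite
  exact Set.toFinite _

end Setup

end RootStrings

section LocalForm

open LieAlgebra LieModule Module

variable {K : Type} [Field K] [IsAlgClosed K] [CharZero K]

lemma iSupIndep_comap {V W : Type*} [AddCommGroup V] [Module K V] [AddCommGroup W] [Module K W]
    {ι : Type*} {N : ι → Submodule K W} (hN : iSupIndep N) {f : V →ₗ[K] W}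
    (hf : Function.Injective f) : iSupIndep fun i => (N i).comap f := by
  intro i
  rw [Submodule.disjoint_def]
  intro x hx hx'
  apply hf
  rw [map_zero]
  refine Submodule.disjoint_def.1 (hN i) _ hx ?_
  have hle : (⨆ j, ⨆ (_ : j ≠ i), (N j).comap f) ≤ (⨆ j, ⨆ (_ : j ≠ i), N j).comap f :=
    iSup₂_le fun j hj => Submodule.comap_mono (le_iSup₂_of_le j hj le_rfl)
  exact hle hx'

lemma trace_eq_sum_smul {V : Type*} [AddCommGroup V] [Module K V] [FiniteDimensional K V]
    {ι : Type*} [Fintype ι] [DecidableEq ι] {N : ι → Submodule K V} (hN : DirectSum.IsInternal N)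
    {f : V →ₗ[K] V} {c : ι → K} (hf : ∀ i, ∀ x ∈ N i, f x = c i • x) :
    LinearMap.trace K V f = ∑ i, c i * finrank K (N i) := by
  have hm : ∀ i, Set.MapsTo f (N i) (N i) := fun i x hx => by
    rw [hf i x hx]
    exact (N i).smul_mem _ hx
  rw [LinearMap.trace_eq_sum_trace_restrict hN hm]
  refine Finset.sum_congr rfl fun i _ => ?_
  have : f.restrict (hm i) = c i • LinearMap.id := by
    ext x
    exact hf i x x.2
  rw [this, map_smul, LinearMap.trace_id, smul_eq_mul]

variable {g : Type} [LieRing g] [LieAlgebra K g]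

namespace Setup

variable (S : Setup K g)

/-- The finite-dimensional subspace spanned by the root spaces for `rootsIn n` and `h ∩ F n`. -/
def core (n : ℕ) : Submodule K g :=
  (⨆ γ ∈ S.rootsIn n, adWeightSpace K g S.h γ) ⊔ (S.h.toSubmodule ⊓ (S.F n).toSubmodule)

/-- The normalizer of `core n`. -/
def levi (n : ℕ) : LieSubalgebra K g where
  carrier := {x | ∀ w ∈ S.core n, ⁅x, w⁆ ∈ S.core n}
  add_mem' := fun ha hb w hw => by rw [add_lie]; exact add_mem (ha w hw) (hb w hw)
  zero_mem' := fun w _ => by rw [zero_lie]; exact zero_mem _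
  smul_mem' := fun c x hx w hw => by rw [smul_lie]; exact Submodule.smul_mem _ _ (hx w hw)
  lie_mem' := fun {x y} hx hy w hw => by
    rw [lie_lie]
    exact sub_mem (hx _ (hy w hw)) (hy _ (hx w hw))

variable {S}

lemma adWeightSpace_le_core {n : ℕ} {γ : Dual K S.h} (hγ : γ ∈ S.rootsIn n) :
    adWeightSpace K g S.h γ ≤ S.core n :=
  le_sup_of_le_left (le_iSup₂ (f := fun δ (_ : δ ∈ S.rootsIn n) => adWeightSpace K g S.h δ) γ hγ)

lemma core_le (n : ℕ) : S.core n ≤ (S.F n).toSubmodule :=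
  sup_le (iSup₂_le fun _ hγ => hγ.2.1) inf_le_right

instance (n : ℕ) : FiniteDimensional K (S.core n) := by
  have := S.F_findim n
  exact Submodule.finiteDimensional_of_le (core_le (S := S) n)

lemma core_induction {n : ℕ} {p : g → Prop} (h0 : p 0) (hadd : ∀ x y, p x → p y → p (x + y))
    (hr : ∀ γ ∈ S.rootsIn n, ∀ x ∈ adWeightSpace K g S.h γ, p x)
    (hh : ∀ x ∈ S.h, x ∈ S.F n → p x) {x : g} (hx : x ∈ S.core n) : p x := by
  obtain ⟨y, hy, z, hz, rfl⟩ := Submodule.mem_sup.1 hx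
  refine hadd _ _ ?_ (hh z hz.1 hz.2)
  induction hy using Submodule.iSup_induction' with
  | zero => exact h0
  | add a b _ _ ha hb =>
    exact hadd _ _ (ha (Submodule.add_mem_sup ‹_› hz)) (hb (Submodule.add_mem_sup ‹_› hz))
  | mem γ a ha =>
    by_cases hγ : γ ∈ S.rootsIn n
    · rw [iSup_pos hγ] at ha
      exact hr γ hγ a ha
    · rw [iSup_neg hγ, Submodule.mem_bot] at ha
      exact ha ▸ h0

variable [S.HasTriples]

lemma mem_levi_of_mem_h {n : ℕ} {H : g} (hH : H ∈ S.h) : H ∈ S.levi n := by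
  intro w hw
  refine core_induction (p := fun w => ⁅H, w⁆ ∈ S.core n) ?_ ?_ ?_ ?_ hw
  · rw [lie_zero]; exact zero_mem _
  · intro x y hx hy
    rw [lie_add]; exact add_mem hx hy
  · intro γ hγ x hx
    rw [hx ⟨H, hH⟩]
    exact Submodule.smul_mem _ _ (adWeightSpace_le_core hγ hx)
  · intro x hx _
    rw [show ⁅H, x⁆ = 0 from S.lie_h_h hH hx]
    exact zero_mem _

lemma mem_levi_of_mem_adWeightSpace {n : ℕ} {γ : Dual K S.h} (hγ : γ ∈ S.rootsIn n) {x : g}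
    (hx : x ∈ adWeightSpace K g S.h γ) : x ∈ S.levi n := by
  intro w hw
  refine core_induction (p := fun w => ⁅x, w⁆ ∈ S.core n) ?_ ?_ ?_ ?_ hw
  · rw [lie_zero]; exact zero_mem _
  · intro y z hy hz
    rw [lie_add]; exact add_mem hy hz
  · intro δ hδ y hy
    have hxy := lie_mem_adWeightSpace hx hy
    by_cases h0 : γ + δ = 0
    · rw [h0, adWeightSpace_zero] at hxy
      exact Submodule.mem_sup_right ⟨hxy, (S.F n).lie_mem (hγ.2.1 hx) (hδ.2.1 hy)⟩
    by_cases h1 : ⁅x, y⁆ = 0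
    · rw [h1]; exact zero_mem _
    · exact adWeightSpace_le_core (add_mem_rootsIn hγ hδ (S.isRootOf_of_mem h0 hxy h1)) hxy
  · intro H hH _
    rw [← lie_skew, hx ⟨H, hH⟩]
    exact neg_mem (Submodule.smul_mem _ _ (adWeightSpace_le_core hγ hx))

instance (n : ℕ) : LieRingModule (S.levi n) (S.core n) where
  bracket x w := ⟨⁅(x : g), (w : g)⁆, x.2 w w.2⟩
  add_lie x y w := Subtype.ext (add_lie (x : g) (y : g) (w : g))
  lie_add x y w := Subtype.ext (lie_add (x : g) (y : g) (w : g))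
  leibniz_lie x y w := Subtype.ext (leibniz_lie (x : g) (y : g) (w : g))

instance (n : ℕ) : LieModule K (S.levi n) (S.core n) where
  smul_lie t x w := Subtype.ext (smul_lie t (x : g) (w : g))
  lie_smul t x w := Subtype.ext (lie_smul t (x : g) (w : g))

lemma finrank_comap_core {n : ℕ} {γ : Dual K S.h} (hγ : γ ∈ S.rootsIn n) :
    finrank K ((adWeightSpace K g S.h γ).comap (S.core n).subtype) = 1 := by
  obtain ⟨x, hx, hx0⟩ := Submodule.exists_mem_ne_zero_of_ne_bot hγ.1.2
  refine finrank_eq_one ⟨⟨x, adWeightSpace_le_core hγ hx⟩, hx⟩ ?_ ?_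
  · intro h
    exact hx0 (congrArg (fun z => ((z : S.core n) : g)) (congrArg Subtype.val h))
  · intro y
    obtain ⟨c, hc⟩ := exists_smul_of_mem hγ.1.1 hx hx0 y.2
    exact ⟨c, Subtype.ext (Subtype.ext hc.symm)⟩

lemma traceForm_levi_h (n : ℕ) (H H' : S.h) :
    traceForm K (S.levi n) (S.core n) ⟨H, mem_levi_of_mem_h H.2⟩ ⟨H', mem_levi_of_mem_h H'.2⟩ =
      ∑ γ ∈ (S.rootsIn_finite n).toFinset, γ H * γ H' := by
  classical
  have : Fintype (S.rootsIn n) := (S.rootsIn_finite n).fintype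
  let wt : Option (S.rootsIn n) → Dual K S.h := fun i => i.elim 0 Subtype.val
  have hwt : Function.Injective wt := by
    rintro (_ | γ) (_ | δ) h
    · rfl
    · exact absurd h.symm δ.2.1.1
    · exact absurd h γ.2.1.1
    · exact congrArg some (Subtype.ext h)
  let N : Option (S.rootsIn n) → Submodule K (S.core n) :=
    fun i => (adWeightSpace K g S.h (wt i)).comap (S.core n).subtype
  have hN : DirectSum.IsInternal N := by
    refine DirectSum.isInternal_submodule_of_iSupIndep_of_iSup_eq_top
      (iSupIndep_comap (S.h_indep.comp hwt) (S.core n).injective_subtype) ?_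
    refine eq_top_iff.2 fun w _ => ?_
    have key : ∀ x (_ : x ∈ S.core n), x ∈ (⨆ i, N i).map (S.core n).subtype := by
      intro x hx
      refine core_induction (p := fun x => x ∈ (⨆ i, N i).map (S.core n).subtype)
        (zero_mem _) (fun x y => add_mem) ?_ ?_ hx
      · intro γ hγ x hx
        exact ⟨⟨x, adWeightSpace_le_core hγ hx⟩, Submodule.mem_iSup_of_mem (some ⟨γ, hγ⟩) hx, rfl⟩
      · intro x hx hxn
        refine ⟨⟨x, Submodule.mem_sup_right ⟨hx, hxn⟩⟩, Submodule.mem_iSup_of_mem none ?_, rfl⟩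
        change x ∈ adWeightSpace K g S.h 0
        rw [adWeightSpace_zero]
        exact hx
    obtain ⟨w', hw', h⟩ := key w w.2
    rwa [← Subtype.ext h]
  rw [traceForm_apply_apply, trace_eq_sum_smul hN (c := fun i => wt i H * wt i H')]
  · rw [Fintype.sum_option]
    have h0 : ∀ H, wt none H = 0 := fun _ => rfl
    rw [h0, zero_mul, zero_mul, zero_add]
    rw [Finset.sum_subtype _ (fun γ => (S.rootsIn_finite n).mem_toFinset)]
    refine Finset.sum_congr rfl fun γ _ => ?_
    have : finrank K (N (some γ)) = 1 := finrank_comap_core γ.2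
    rw [this, Nat.cast_one, mul_one]
    rfl
  · intro i x hx
    refine Subtype.ext ?_
    change ⁅(H : g), ⁅(H' : g), (x : g)⁆⁆ = (wt i H * wt i H') • (x : g)
    have hx' : ∀ H : S.h, ⁅(H : g), (x : g)⁆ = wt i H • (x : g) := hx
    rw [hx' H', lie_smul, hx' H, smul_smul, mul_comm]

variable (S) in
/-- A symmetric form, invariant on `levi n`, given on `h` by the sum over the roots. -/
theorem exists_form (n : ℕ) : ∃ B : g →ₗ[K] g →ₗ[K] K, (∀ x y, B x y = B y x) ∧
    (∀ x ∈ S.levi n, ∀ y ∈ S.levi n, ∀ z ∈ S.levi n, B ⁅x, y⁆ z = B x ⁅y, z⁆) ∧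
    ∀ H H' : S.h, B H H' = ∑ γ ∈ (S.rootsIn_finite n).toFinset, γ H * γ H' := by
  obtain ⟨T, hT, hTi, hTh⟩ : ∃ T : S.levi n →ₗ[K] S.levi n →ₗ[K] K, (∀ x y, T x y = T y x) ∧
      (∀ x y z, T ⁅x, y⁆ z = T x ⁅y, z⁆) ∧ ∀ H H' : S.h, T ⟨H, mem_levi_of_mem_h H.2⟩
        ⟨H', mem_levi_of_mem_h H'.2⟩ = ∑ γ ∈ (S.rootsIn_finite n).toFinset, γ H * γ H' :=
    ⟨traceForm K (S.levi n) (S.core n), traceForm_comm K _ _,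
      traceForm_apply_lie_apply K _ _, traceForm_levi_h n⟩
  obtain ⟨p, hp⟩ : ∃ p : g →ₗ[K] S.levi n, ∀ x (hx : x ∈ S.levi n), p x = ⟨x, hx⟩ := by
    obtain ⟨p, hp⟩ := (S.levi n).toSubmodule.subtype.exists_leftInverse_of_injective
      (Submodule.ker_subtype _)
    exact ⟨p, fun x hx => LinearMap.congr_fun hp ⟨x, hx⟩⟩
  refine ⟨T.compl₁₂ p p, fun x y => hT _ _, fun x hx y hy z hz => ?_, fun H H' => ?_⟩
  · rw [LinearMap.compl₁₂_apply, LinearMap.compl₁₂_apply, hp _ ((S.levi n).lie_mem hx hy),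
      hp _ ((S.levi n).lie_mem hy hz), hp x hx, hp z hz]
    exact hTi ⟨x, hx⟩ ⟨y, hy⟩ ⟨z, hz⟩
  · rw [LinearMap.compl₁₂_apply, hp _ (mem_levi_of_mem_h H.2), hp _ (mem_levi_of_mem_h H'.2)]
    exact hTh H H'

end Setup

end LocalForm

section RootDuals

open LieAlgebra LieModule Module

variable {K : Type} [Field K] [IsAlgClosed K] [CharZero K]
variable {g : Type} [LieRing g] [LieAlgebra K g]

namespace Setup

variable (S : Setup K g) [S.HasTriples]

/-- The invariant form of `exists_form`. -/
def form (n : ℕ) : g →ₗ[K] g →ₗ[K] K := (S.exists_form n).choose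

/-- `rootsIn n` as a finset. -/
def roots (n : ℕ) : Finset (Dual K S.h) := (S.rootsIn_finite n).toFinset

variable {S}

lemma mem_roots {n : ℕ} {γ : Dual K S.h} : γ ∈ S.roots n ↔ γ ∈ S.rootsIn n :=
  (S.rootsIn_finite n).mem_toFinset

lemma form_comm (n : ℕ) (x y : g) : S.form n x y = S.form n y x :=
  (S.exists_form n).choose_spec.1 x y

lemma form_lie {n : ℕ} {x y z : g} (hx : x ∈ S.levi n) (hy : y ∈ S.levi n) (hz : z ∈ S.levi n) :
    S.form n ⁅x, y⁆ z = S.form n x ⁅y, z⁆ :=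
  (S.exists_form n).choose_spec.2.1 x hx y hy z hz

lemma form_h (n : ℕ) (H H' : S.h) : S.form n H H' = ∑ γ ∈ S.roots n, γ H * γ H' :=
  (S.exists_form n).choose_spec.2.2 H H'

lemma exists_root_dual {n : ℕ} {γ : Dual K S.h} (hγ : γ ∈ S.rootsIn n) :
    ∃ t : S.h, (∀ x ∈ adWeightSpace K g S.h γ, ∀ y ∈ adWeightSpace K g S.h (-γ),
        ⁅x, y⁆ = S.form n x y • (t : g)) ∧
      (∀ H : S.h, S.form n t H = γ H) ∧
      (∃ e ∈ adWeightSpace K g S.h γ, ∃ f ∈ adWeightSpace K g S.h (-γ), S.form n e f = 1) ∧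
      ∃ N : ℕ, 0 < N ∧ ∀ δ, IsRootOf K g S.h δ → ∃ m : ℤ, (N : K) * δ t = m := by
  obtain ⟨H, e, f, T⟩ := exists_triple_of_isRootOf hγ.1
  have he := mem_levi_of_mem_adWeightSpace hγ T.e_mem
  have hf := mem_levi_of_mem_adWeightSpace (neg_mem_rootsIn hγ) T.f_mem
  have hB : ∀ H' : S.h, S.form n H H' = γ H' * S.form n e f := by
    intro H'
    rw [← T.lie_e_f, form_lie he hf (mem_levi_of_mem_h H'.2), ← lie_skew, T.f_mem H']
    simp
  have hcoeff : ∀ δ, IsRootOf K g S.h δ → ∃ m : ℤ, δ H = m := by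
    intro δ hδ
    obtain ⟨x, hx, hx0⟩ := Submodule.exists_mem_ne_zero_of_ne_bot hδ.2
    exact T.exists_int hx hx0
  have hN : ∃ N : ℕ, 0 < N ∧ S.form n H H = N := by
    choose! m hm using hcoeff
    refine ⟨∑ δ ∈ S.roots n, (m δ).natAbs ^ 2, ?_, ?_⟩
    · refine Finset.sum_pos' (fun _ _ => Nat.zero_le _) ⟨γ, mem_roots.2 hγ, ?_⟩
      have h2 : m γ = 2 := by
        have := hm γ hγ.1
        rw [T.apply_two] at this
        exact_mod_cast this.symm
      simp [h2]
    · rw [form_h, Nat.cast_sum]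
      refine Finset.sum_congr rfl fun δ hδ => ?_
      rw [hm δ (mem_roots.1 hδ).1, ← sq]
      have : ((m δ).natAbs : ℤ) ^ 2 = (m δ) ^ 2 := Int.natAbs_sq _
      rw [← Int.cast_pow, ← this, Int.cast_pow, Nat.cast_pow, Int.cast_natCast]
  obtain ⟨N, hN0, hN⟩ := hN
  have h2 : (N : K) = 2 * S.form n e f := by rw [← hN, hB, T.apply_two]
  have hN0' : (N : K) ≠ 0 := Nat.cast_ne_zero.2 hN0.ne'
  have hef : S.form n e f ≠ 0 := fun h => hN0' (by rw [h2, h, mul_zero])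
  have coe_smul' : ∀ c : K, ((c • H : S.h) : g) = c • (H : g) := fun _ => rfl
  refine ⟨(S.form n e f)⁻¹ • H, ?_, ?_, ?_, N, hN0, ?_⟩
  · intro x hx y hy
    obtain ⟨a, rfl⟩ := T.exists_smul hx
    obtain ⟨b, rfl⟩ := T.symm.exists_smul hy
    rw [smul_lie, lie_smul, T.lie_e_f]
    simp only [map_smul, LinearMap.smul_apply, smul_eq_mul, smul_smul, coe_smul']
    rw [mul_assoc, mul_assoc, mul_inv_cancel₀ hef, mul_one, mul_comm]
  · intro H'
    rw [coe_smul', map_smul, LinearMap.smul_apply, hB, smul_eq_mul]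
    field_simp
  · refine ⟨e, T.e_mem, (S.form n e f)⁻¹ • f, Submodule.smul_mem _ _ T.f_mem, ?_⟩
    rw [map_smul, smul_eq_mul, inv_mul_cancel₀ hef]
  · intro δ hδ
    obtain ⟨m, hm⟩ := hcoeff δ hδ
    refine ⟨2 * m, ?_⟩
    rw [map_smul, hm, h2, smul_eq_mul]
    push_cast
    field_simp

variable (S) in
/-- The element of `h` dual to a root with respect to `form n`. -/
def tv (n : ℕ) (γ : Dual K S.h) : S.h :=
  open Classical in if hγ : γ ∈ S.rootsIn n then (exists_root_dual hγ).choose else 0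

section

variable {n : ℕ} {γ δ : Dual K S.h}

lemma tv_spec (hγ : γ ∈ S.rootsIn n) :
    (∀ x ∈ adWeightSpace K g S.h γ, ∀ y ∈ adWeightSpace K g S.h (-γ),
        ⁅x, y⁆ = S.form n x y • (S.tv n γ : g)) ∧
      (∀ H : S.h, S.form n (S.tv n γ) H = γ H) ∧
      (∃ e ∈ adWeightSpace K g S.h γ, ∃ f ∈ adWeightSpace K g S.h (-γ), S.form n e f = 1) ∧
      ∃ N : ℕ, 0 < N ∧ ∀ δ, IsRootOf K g S.h δ → ∃ m : ℤ, (N : K) * δ (S.tv n γ) = m := by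
  rw [tv, dif_pos hγ]
  exact (exists_root_dual hγ).choose_spec

lemma lie_eq_form_smul (hγ : γ ∈ S.rootsIn n) {x y : g} (hx : x ∈ adWeightSpace K g S.h γ)
    (hy : y ∈ adWeightSpace K g S.h (-γ)) : ⁅x, y⁆ = S.form n x y • (S.tv n γ : g) :=
  (tv_spec hγ).1 x hx y hy

lemma form_tv (hγ : γ ∈ S.rootsIn n) (H : S.h) : S.form n (S.tv n γ) H = γ H :=
  (tv_spec hγ).2.1 H

lemma exists_form_eq_one (hγ : γ ∈ S.rootsIn n) :
    ∃ e ∈ adWeightSpace K g S.h γ, ∃ f ∈ adWeightSpace K g S.h (-γ), S.form n e f = 1 :=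
  (tv_spec hγ).2.2.1

lemma exists_form_eq_one_of_ne_zero (hγ : γ ∈ S.rootsIn n) {x : g}
    (hx : x ∈ adWeightSpace K g S.h γ) (hx0 : x ≠ 0) :
    ∃ f ∈ adWeightSpace K g S.h (-γ), S.form n x f = 1 := by
  obtain ⟨e, he, f, hf, h1⟩ := exists_form_eq_one hγ
  obtain ⟨c, rfl⟩ := exists_smul_of_mem hγ.1.1 hx hx0 he
  refine ⟨c • f, Submodule.smul_mem _ _ hf, ?_⟩
  rw [map_smul, LinearMap.smul_apply] at h1
  rw [map_smul, h1]

lemma tv_neg (hγ : γ ∈ S.rootsIn n) : S.tv n (-γ) = -S.tv n γ := by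
  obtain ⟨e, he, f, hf, h1⟩ := exists_form_eq_one hγ
  have hef := lie_eq_form_smul hγ he hf
  have hfe := lie_eq_form_smul (neg_mem_rootsIn hγ) hf (by rwa [neg_neg])
  rw [h1, one_smul] at hef
  rw [form_comm, h1, one_smul] at hfe
  refine Subtype.ext ?_
  rw [← hfe, ← lie_skew, hef]
  rfl

lemma tv_add (hγ : γ ∈ S.rootsIn n) (hδ : δ ∈ S.rootsIn n) (hγδ : γ + δ ∈ S.rootsIn n) :
    S.tv n (γ + δ) = S.tv n γ + S.tv n δ := by
  obtain ⟨e, he, he0⟩ := Submodule.exists_mem_ne_zero_of_ne_bot hγ.1.2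
  obtain ⟨d, hd, hd0⟩ := Submodule.exists_mem_ne_zero_of_ne_bot hδ.1.2
  have hx := lie_mem_adWeightSpace he hd
  obtain ⟨f, hf, h1⟩ := exists_form_eq_one_of_ne_zero hγδ hx
    (lie_ne_zero hγ.1.1 hδ.1.1 he he0 hd hd0 hγδ.1)
  have le := mem_levi_of_mem_adWeightSpace hγ he
  have ld := mem_levi_of_mem_adWeightSpace hδ hd
  have lf := mem_levi_of_mem_adWeightSpace (neg_mem_rootsIn hγδ) hf
  have h := lie_eq_form_smul hγδ hx hf
  have hdf := lie_mem_adWeightSpace hd hf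
  have hef := lie_mem_adWeightSpace he hf
  rw [show δ + -(γ + δ) = -γ by abel] at hdf
  rw [show γ + -(γ + δ) = -δ by abel] at hef
  have h1' : S.form n d ⁅e, f⁆ = -1 := by
    rw [← form_lie ld le lf, ← lie_skew, map_neg, LinearMap.neg_apply, h1]
  have h1'' : S.form n e ⁅d, f⁆ = 1 := by rw [← form_lie le ld lf, h1]
  rw [lie_lie, lie_eq_form_smul hγ he hdf, lie_eq_form_smul hδ hd hef, h1, h1', h1''] at h
  refine Subtype.ext ?_
  simpa using h.symm

end

/-- Two members of a multiset of roots with zero sum can be merged. -/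
lemma exists_merge {n : ℕ} {s : Multiset (Dual K S.h)} (hs : ∀ γ ∈ s, γ ∈ S.rootsIn n)
    (hs0 : s ≠ 0) (hsum : s.sum = 0) :
    ∃ γ δ s', s = γ ::ₘ δ ::ₘ s' ∧ (γ + δ = 0 ∨ γ + δ ∈ S.rootsIn n) := by
  obtain ⟨γ, hγ⟩ := Multiset.exists_mem_of_ne_zero hs0
  obtain ⟨s₁, rfl⟩ := Multiset.exists_cons_of_mem hγ
  obtain ⟨H, e, f, T⟩ := exists_triple_of_isRootOf (hs γ hγ).1
  obtain ⟨δ, hδ, m, hm, hm0⟩ : ∃ δ ∈ s₁, ∃ m : ℤ, δ H = m ∧ m < 0 := by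
    by_contra! hcon
    have key : ∀ s₂ ≤ s₁, ∃ k : ℕ, s₂.sum H = k := by
      intro s₂
      induction s₂ using Multiset.induction with
      | empty => exact fun _ => ⟨0, by simp⟩
      | cons δ s₂ ih =>
        intro hle
        obtain ⟨k, hk⟩ := ih ((Multiset.le_cons_self _ _).trans hle)
        have hδ : δ ∈ s₁ := Multiset.mem_of_le hle (Multiset.mem_cons_self _ _)
        obtain ⟨x, hx, hx0⟩ := Submodule.exists_mem_ne_zero_of_ne_bot
          (hs δ (Multiset.mem_cons_of_mem hδ)).1.2
        obtain ⟨m, hm⟩ := T.exists_int hx hx0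
        obtain ⟨j, rfl⟩ := Int.eq_ofNat_of_zero_le (hcon δ hδ m hm)
        refine ⟨j + k, ?_⟩
        rw [Multiset.sum_cons, LinearMap.add_apply, hm, hk]
        push_cast
        rfl
    obtain ⟨k, hk⟩ := key s₁ le_rfl
    rw [Multiset.sum_cons] at hsum
    have := LinearMap.congr_fun hsum H
    rw [LinearMap.add_apply, T.apply_two, hk, LinearMap.zero_apply] at this
    have h' : ((2 + k : ℕ) : K) = 0 := by push_cast; exact this
    exact absurd h' (Nat.cast_ne_zero.2 (by omega))
  obtain ⟨s₂, rfl⟩ := Multiset.exists_cons_of_mem hδ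
  refine ⟨γ, δ, s₂, rfl, ?_⟩
  have hδ' := hs δ (Multiset.mem_cons_of_mem hδ)
  obtain ⟨x, hx, hx0⟩ := Submodule.exists_mem_ne_zero_of_ne_bot hδ'.1.2
  refine or_iff_not_imp_left.2 fun h0 => add_mem_rootsIn (hs γ hγ) hδ' ?_
  exact S.isRootOf_of_mem h0 (lie_mem_adWeightSpace T.e_mem hx)
    (T.lie_ne_zero_of_neg hx hx0 hm hm0)

lemma sum_tv_eq_zero {n : ℕ} {s : Multiset (Dual K S.h)} (hs : ∀ γ ∈ s, γ ∈ S.rootsIn n)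
    (hsum : s.sum = 0) : (s.map (S.tv n)).sum = 0 := by
  induction hk : Multiset.card s using Nat.strong_induction_on generalizing s with
  | _ k ih =>
    by_cases hs0 : s = 0
    · simp [hs0]
    obtain ⟨γ, δ, s', rfl, h⟩ := exists_merge hs hs0 hsum
    have hγ := hs γ (by simp)
    have hδ := hs δ (by simp)
    have hs' : ∀ ε ∈ s', ε ∈ S.rootsIn n := fun ε hε => hs ε (by simp [hε])
    simp only [Multiset.card_cons] at hk
    simp only [Multiset.sum_cons, ← add_assoc, Multiset.map_cons] at hsum ⊢
    rcases h with h | h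
    · rw [h, zero_add] at hsum
      have := ih _ (by omega) hs' hsum rfl
      rw [this, add_zero, eq_neg_of_add_eq_zero_right h, tv_neg hγ, add_neg_cancel]
    · rw [← tv_add hγ hδ h]
      have := ih (k - 1) (by omega) (s := (γ + δ) ::ₘ s') (fun ε hε => ?_)
        (by rwa [Multiset.sum_cons]) (by rw [Multiset.card_cons]; omega)
      · rwa [Multiset.map_cons, Multiset.sum_cons] at this
      · rcases Multiset.mem_cons.1 hε with rfl | hε
        · exact h
        · exact hs' ε hε

lemma exists_forall_mem_rootsIn (s : Multiset (Dual K S.h)) (hs : ∀ γ ∈ s, IsRootOf K g S.h γ) :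
    ∃ n, ∀ γ ∈ s, γ ∈ S.rootsIn n := by
  induction s using Multiset.induction with
  | empty => exact ⟨0, by simp⟩
  | cons γ s ih =>
    obtain ⟨n, hn⟩ := ih fun δ hδ => hs δ (Multiset.mem_cons_of_mem hδ)
    obtain ⟨m, hm⟩ := exists_mem_rootsIn (hs γ (Multiset.mem_cons_self _ _))
    refine ⟨max m n, fun δ hδ => ?_⟩
    rcases Multiset.mem_cons.1 hδ with rfl | hδ
    · exact S.rootsIn_mono (le_max_left _ _) hm
    · exact S.rootsIn_mono (le_max_right _ _) (hn δ hδ)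

lemma eq_zero_of_sum_pos_eq_zero {s : Multiset (Dual K S.h)} (hs : ∀ γ ∈ s, γ ∈ S.pos)
    (hsum : s.sum = 0) : s = 0 := by
  obtain ⟨n, hn⟩ := exists_forall_mem_rootsIn s fun γ hγ => S.pos_root γ (hs γ hγ)
  induction hk : Multiset.card s using Nat.strong_induction_on generalizing s with
  | _ k ih =>
    by_contra hs0
    obtain ⟨γ, δ, s', rfl, h⟩ := exists_merge hn hs0 hsum
    have hγ := hs γ (by simp)
    have hδ := hs δ (by simp)
    have h := h.resolve_left (S.pos_add_ne_zero hγ hδ)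
    rw [Multiset.card_cons, Multiset.card_cons] at hk
    have := ih (k - 1) (by omega) (s := (γ + δ) ::ₘ s') (fun ε hε => ?_)
      (by rw [Multiset.sum_cons, ← hsum, Multiset.sum_cons, Multiset.sum_cons, add_assoc])
      (fun ε hε => ?_) (by rw [Multiset.card_cons]; omega)
    · exact Multiset.cons_ne_zero this
    · rcases Multiset.mem_cons.1 hε with rfl | hε
      · exact S.pos_add γ hγ δ hδ h.1
      · exact hs ε (by simp [hε])
    · rcases Multiset.mem_cons.1 hε with rfl | hε
      · exact h
      · exact hn ε (by simp [hε])

end Setup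

end RootDuals

section Definiteness

open LieAlgebra LieModule Module

variable {K : Type} [Field K] [IsAlgClosed K] [CharZero K]
variable {g : Type} [LieRing g] [LieAlgebra K g]

namespace Setup

variable {S : Setup K g} [S.HasTriples] {n : ℕ}

lemma form_sum_tv {s : Multiset (Dual K S.h)} (hs : ∀ γ ∈ s, γ ∈ S.rootsIn n) (H : S.h) :
    S.form n (s.map (S.tv n)).sum H = s.sum H := by
  induction s using Multiset.induction with
  | empty => simp
  | cons γ s ih =>
    rw [Multiset.map_cons, Multiset.sum_cons, Multiset.sum_cons, LinearMap.add_apply,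
      ← ih fun δ hδ => hs δ (Multiset.mem_cons_of_mem hδ),
      ← form_tv (hs γ (Multiset.mem_cons_self _ _)) H, ← LinearMap.add_apply, ← map_add]
    rfl

lemma exists_multiset_of_int (m : Dual K S.h → ℤ) {A : Finset (Dual K S.h)}
    (hA : ∀ γ ∈ A, γ ∈ S.rootsIn n) :
    ∃ s : Multiset (Dual K S.h), (∀ γ ∈ s, γ ∈ S.rootsIn n) ∧
      (s.map (S.tv n)).sum = ∑ γ ∈ A, m γ • S.tv n γ := by
  classical
  have hnat : ∀ (k : ℕ) (γ : Dual K S.h), γ ∈ S.rootsIn n →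
      ∃ s : Multiset (Dual K S.h), (∀ δ ∈ s, δ ∈ S.rootsIn n) ∧
        (s.map (S.tv n)).sum = k • S.tv n γ := fun k γ hγ =>
    ⟨Multiset.replicate k γ, fun δ hδ => Multiset.eq_of_mem_replicate hδ ▸ hγ, by simp⟩
  have hmultiple : ∀ (k : ℤ) (γ : Dual K S.h), γ ∈ S.rootsIn n →
      ∃ s : Multiset (Dual K S.h), (∀ δ ∈ s, δ ∈ S.rootsIn n) ∧
        (s.map (S.tv n)).sum = k • S.tv n γ := by
    intro k γ hγ
    obtain ⟨k, rfl | rfl⟩ := k.eq_nat_or_neg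
    · rw [natCast_zsmul]
      exact hnat k γ hγ
    · rw [neg_smul, natCast_zsmul, ← smul_neg, ← tv_neg hγ]
      exact hnat k (-γ) (neg_mem_rootsIn hγ)
  induction A using Finset.induction with
  | empty => exact ⟨0, by simp, by simp⟩
  | insert γ A hγ ih =>
    obtain ⟨s, hs, hsum⟩ := ih fun δ hδ => hA δ (Finset.mem_insert_of_mem hδ)
    obtain ⟨s', hs', hsum'⟩ := hmultiple (m γ) γ (hA γ (Finset.mem_insert_self _ _))
    refine ⟨s' + s, fun δ hδ => ?_, ?_⟩
    · rcases Multiset.mem_add.1 hδ with h | h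
      exacts [hs' δ h, hs δ h]
    · rw [Multiset.map_add, Multiset.sum_add, hsum, hsum', Finset.sum_insert hγ]

lemma int_combination_eq_zero (m : Dual K S.h → ℤ)
    (h : ∀ δ ∈ S.roots n, δ (∑ γ ∈ S.roots n, m γ • S.tv n γ) = 0) :
    ∑ γ ∈ S.roots n, m γ • S.tv n γ = 0 := by
  obtain ⟨s, hs, hsum⟩ := exists_multiset_of_int (n := n) m fun γ hγ => mem_roots.1 hγ
  rw [← hsum] at h ⊢
  refine sum_tv_eq_zero hs (LinearMap.ext fun H => ?_)
  rw [← form_sum_tv hs, form_h]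
  refine Finset.sum_eq_zero fun δ hδ => ?_
  rw [h δ hδ, zero_mul]

lemma rat_combination_eq_zero (c : Dual K S.h → ℚ)
    (h : ∀ δ ∈ S.roots n, δ (∑ γ ∈ S.roots n, (c γ : K) • S.tv n γ) = 0) :
    ∑ γ ∈ S.roots n, (c γ : K) • S.tv n γ = 0 := by
  classical
  set D : ℕ := ∏ γ ∈ S.roots n, (c γ).den with hD
  have hD0 : (D : K) ≠ 0 := Nat.cast_ne_zero.2 (Finset.prod_ne_zero_iff.2 fun γ _ => (c γ).den_nz)
  have hm : ∀ γ ∈ S.roots n, ∃ m : ℤ, (m : ℚ) = D * c γ := by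
    intro γ hγ
    obtain ⟨k, hk⟩ := Finset.dvd_prod_of_mem (fun γ => (c γ).den) hγ
    refine ⟨k * (c γ).num, ?_⟩
    rw [hD, hk]
    push_cast
    rw [mul_comm ((c γ).den : ℚ), mul_assoc, Rat.den_mul_eq_num]
  choose! m hm using hm
  have hv : ∑ γ ∈ S.roots n, m γ • S.tv n γ = (D : K) • ∑ γ ∈ S.roots n, (c γ : K) • S.tv n γ := by
    rw [Finset.smul_sum]
    refine Finset.sum_congr rfl fun γ hγ => ?_
    rw [smul_smul, ← Int.cast_smul_eq_zsmul K]
    congr 1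
    have := congrArg (fun q : ℚ => (q : K)) (hm γ hγ)
    simpa using this
  have h0 := int_combination_eq_zero (n := n) m fun δ hδ => by rw [hv, map_smul, h δ hδ, smul_zero]
  rw [hv] at h0
  exact (smul_eq_zero.1 h0).resolve_left hD0

lemma exists_common_denominator (n : ℕ) : ∃ D : ℕ, 0 < D ∧
    ∀ γ ∈ S.roots n, ∀ δ ∈ S.roots n, ∃ m : ℤ, (D : K) * δ (S.tv n γ) = m := by
  have h : ∀ γ ∈ S.roots n, ∃ N : ℕ, 0 < N ∧
      ∀ δ ∈ S.roots n, ∃ m : ℤ, (N : K) * δ (S.tv n γ) = m := by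
    intro γ hγ
    obtain ⟨N, hN, h⟩ := (tv_spec (mem_roots.1 hγ)).2.2.2
    exact ⟨N, hN, fun δ hδ => h δ (mem_roots.1 hδ).1⟩
  choose! N hN0 hN using h
  refine ⟨∏ γ ∈ S.roots n, N γ, Finset.prod_pos hN0, fun γ hγ δ hδ => ?_⟩
  obtain ⟨k, hk⟩ := Finset.dvd_prod_of_mem N hγ
  obtain ⟨m, hm⟩ := hN γ hγ δ hδ
  refine ⟨k * m, ?_⟩
  rw [hk, Nat.cast_mul, mul_comm (N γ : K), mul_assoc, hm]
  push_cast
  rfl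

lemma exists_rat {γ δ : Dual K S.h} (hγ : γ ∈ S.roots n) (hδ : δ ∈ S.roots n) :
    ∃ q : ℚ, δ (S.tv n γ) = q := by
  obtain ⟨D, hD, h⟩ := S.exists_common_denominator n
  obtain ⟨m, hm⟩ := h γ hγ δ hδ
  have : (D : K) ≠ 0 := Nat.cast_ne_zero.2 hD.ne'
  refine ⟨m / D, ?_⟩
  push_cast
  rw [← hm]
  field_simp

lemma combination_eq_zero (c : Dual K S.h → K)
    (h : ∀ δ ∈ S.roots n, δ (∑ γ ∈ S.roots n, c γ • S.tv n γ) = 0) :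
    ∑ γ ∈ S.roots n, c γ • S.tv n γ = 0 := by
  classical
  let b := Basis.ofVectorSpace ℚ K
  let I : Finset _ := (S.roots n).biUnion fun γ => (b.repr (c γ)).support
  have hc : ∀ γ ∈ S.roots n, c γ = ∑ i ∈ I, ((b.repr (c γ) i : ℚ) : K) * b i := by
    intro γ hγ
    conv_lhs => rw [← b.linearCombination_repr (c γ)]
    rw [Finsupp.linearCombination_apply, Finsupp.sum_of_support_subset _
      (Finset.subset_biUnion_of_mem (fun γ => (b.repr (c γ)).support) hγ) _ (by simp)]
    exact Finset.sum_congr rfl fun i _ => Rat.smul_def _ _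
  have hv : ∑ γ ∈ S.roots n, c γ • S.tv n γ =
      ∑ i ∈ I, b i • ∑ γ ∈ S.roots n, ((b.repr (c γ) i : ℚ) : K) • S.tv n γ := by
    simp only [Finset.smul_sum]
    rw [Finset.sum_comm]
    refine Finset.sum_congr rfl fun γ hγ => ?_
    conv_lhs => rw [hc γ hγ]
    rw [Finset.sum_smul]
    refine Finset.sum_congr rfl fun i _ => ?_
    rw [smul_smul, mul_comm]
  rw [hv]
  refine Finset.sum_eq_zero fun i _ => ?_
  rw [rat_combination_eq_zero (n := n) (fun γ => b.repr (c γ) i), smul_zero]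
  intro δ hδ
  have hq : ∀ γ ∈ S.roots n, ∃ q : ℚ, δ (S.tv n γ) = q := fun γ hγ => exists_rat hγ hδ
  choose! q hq using hq
  have h0 := h δ hδ
  have h1 : ∑ γ ∈ S.roots n, q γ • c γ = 0 := by
    rw [← h0, map_sum]
    refine Finset.sum_congr rfl fun γ hγ => ?_
    rw [map_smul, hq γ hγ, Rat.smul_def, smul_eq_mul, mul_comm]
  have h2 := congrArg (fun z => ((b.repr z i : ℚ) : K)) h1
  simp only [map_sum, map_smul, Finsupp.coe_finsetSum, Finset.sum_apply, map_zero,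
    Finsupp.zero_apply, Rat.cast_zero, Finsupp.smul_apply, smul_eq_mul] at h2
  rw [← h2, map_sum, Rat.cast_sum]
  refine Finset.sum_congr rfl fun γ hγ => ?_
  rw [map_smul, hq γ hγ, smul_eq_mul, Rat.cast_mul, mul_comm]

include S in
/-- The centre of `g` meets the derived algebra trivially. -/
theorem eq_zero_of_central_of_mem_span {z : g} (hz : ∀ y : g, ⁅z, y⁆ = 0)
    (hz' : z ∈ Submodule.span K {w : g | ∃ x y : g, ⁅x, y⁆ = w}) : z = 0 := by
  classical
  let T : ℕ → Submodule K g := fun n => Submodule.span K ((fun γ => (S.tv n γ : g)) '' S.rootsIn n)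
  have hw : ∀ x y : g, ∃ N, ∀ n ≥ N, S.proj 0 ⁅x, y⁆ ∈ T n := by
    intro x y
    have hadd : ∀ u v, (∃ N, ∀ n ≥ N, S.proj 0 u ∈ T n) → (∃ N, ∀ n ≥ N, S.proj 0 v ∈ T n) →
        ∃ N, ∀ n ≥ N, S.proj 0 (u + v) ∈ T n := by
      rintro u v ⟨N, hN⟩ ⟨N', hN'⟩
      refine ⟨max N N', fun n hn => ?_⟩
      rw [map_add]
      exact add_mem (hN n ((le_max_left _ _).trans hn)) (hN' n ((le_max_right _ _).trans hn))
    refine S.weight_induction (p := fun x => ∃ N, ∀ n ≥ N, S.proj 0 ⁅x, y⁆ ∈ T n) ?_ ?_ ?_ x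
    · exact ⟨0, fun n _ => by rw [zero_lie, map_zero]; exact zero_mem _⟩
    · intro u v hu hv
      rw [add_lie]
      exact hadd _ _ hu hv
    · intro α x hx
      refine S.weight_induction (p := fun y => ∃ N, ∀ n ≥ N, S.proj 0 ⁅x, y⁆ ∈ T n) ?_ ?_ ?_ y
      · exact ⟨0, fun n _ => by rw [lie_zero, map_zero]; exact zero_mem _⟩
      · intro u v hu hv
        rw [lie_add]
        exact hadd _ _ hu hv
      · intro β y hy
        have hxy := lie_mem_adWeightSpace hx hy
        by_cases h0 : α + β = 0
        swap
        · exact ⟨0, fun n _ => by rw [S.proj_of_mem_ne hxy h0]; exact zero_mem _⟩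
        by_cases hx0 : x = 0
        · exact ⟨0, fun n _ => by rw [hx0, zero_lie, map_zero]; exact zero_mem _⟩
        by_cases hα : α = 0
        · subst hα
          rw [zero_add] at h0
          subst h0
          rw [adWeightSpace_zero] at hx hy
          exact ⟨0, fun n _ => by rw [S.lie_h_h hx hy, map_zero]; exact zero_mem _⟩
        obtain ⟨N, hN⟩ := exists_mem_rootsIn (S.isRootOf_of_mem hα hx hx0)
        refine ⟨N, fun n hn => ?_⟩
        rw [h0] at hxy
        rw [S.proj_of_mem hxy]
        have hn' := S.rootsIn_mono hn hN
        rw [eq_neg_of_add_eq_zero_right h0] at hy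
        rw [lie_eq_form_smul hn' hx hy]
        exact Submodule.smul_mem _ _ (Submodule.subset_span ⟨α, hn', rfl⟩)
  have key : ∀ z ∈ Submodule.span K {w : g | ∃ x y : g, ⁅x, y⁆ = w},
      ∃ N, ∀ n ≥ N, S.proj 0 z ∈ T n := by
    intro z hz'
    induction hz' using Submodule.span_induction with
    | mem w hw' =>
      obtain ⟨x, y, rfl⟩ := hw'
      exact hw x y
    | zero => exact ⟨0, fun n _ => by rw [map_zero]; exact zero_mem _⟩
    | add u v _ _ hu hv =>
      obtain ⟨N, hN⟩ := hu
      obtain ⟨N', hN'⟩ := hv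
      refine ⟨max N N', fun n hn => ?_⟩
      rw [map_add]
      exact add_mem (hN n ((le_max_left _ _).trans hn)) (hN' n ((le_max_right _ _).trans hn))
    | smul c u _ hu =>
      obtain ⟨N, hN⟩ := hu
      exact ⟨N, fun n hn => by rw [map_smul]; exact Submodule.smul_mem _ _ (hN n hn)⟩
  obtain ⟨n, hN⟩ := key z hz'
  have hzn := hN n le_rfl
  rw [S.proj_of_mem fun H => by
    rw [← lie_skew, hz, LinearMap.zero_apply, zero_smul, neg_zero]] at hzn
  obtain ⟨c, hc⟩ := (Submodule.mem_span_image_finset_iff_exists_fun' K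
    (s := S.roots n) (v := fun γ => (S.tv n γ : g))).1 (by
      rwa [show ((S.roots n : Finset _) : Set (Dual K S.h)) = S.rootsIn n from
        Set.Finite.coe_toFinset _])
  have hv : ((∑ γ ∈ S.roots n, c γ • S.tv n γ : S.h) : g) = z := by
    rw [← hc]
    exact map_sum S.h.toSubmodule.subtype _ _
  rw [← hv, combination_eq_zero c]
  · rfl
  intro δ hδ
  obtain ⟨e, he, he0⟩ := Submodule.exists_mem_ne_zero_of_ne_bot (mem_roots.1 hδ).1.2
  have := he (∑ γ ∈ S.roots n, c γ • S.tv n γ)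
  rw [hv, hz] at this
  exact (smul_eq_zero.1 this.symm).resolve_right he0

lemma exists_bound_of_sum_sq_eq {ι : Type*} [Fintype ι] (m : ι → ℚ) : ∃ R : ℚ, ∀ a : ι → ℚ,
    ∑ i, a i ^ 2 = ∑ i, m i * a i → ∀ i, |a i| ≤ R := by
  refine ⟨∑ i, m i ^ 2 + 1, fun a ha i => ?_⟩
  have h1 : ∑ i, m i * a i ≤ ∑ i, (m i ^ 2 / 2 + a i ^ 2 / 2) :=
    Finset.sum_le_sum fun i _ => by nlinarith [sq_nonneg (m i - a i)]
  rw [Finset.sum_add_distrib, ← Finset.sum_div, ← Finset.sum_div] at h1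
  have h2 : a i ^ 2 ≤ ∑ i, a i ^ 2 :=
    Finset.single_le_sum (f := fun i => a i ^ 2) (fun i _ => sq_nonneg _) (Finset.mem_univ i)
  have h3 : a i ^ 2 ≤ ∑ i, m i ^ 2 := by linarith
  exact abs_le.2 ⟨by nlinarith [sq_nonneg (a i + 1)], by nlinarith [sq_nonneg (a i - 1)]⟩

lemma finite_of_sum_sq {ι : Type*} [Fintype ι] (D : ℕ) (hD : 0 < D) (m : ι → ℚ) :
    {a : ι → ℚ | (∀ i, ∃ k : ℤ, (D : ℚ) * a i = k) ∧
      ∑ i, a i ^ 2 = ∑ i, m i * a i}.Finite := by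
  obtain ⟨R, hR⟩ := exists_bound_of_sum_sq_eq m
  have hD' : (0 : ℚ) < D := Nat.cast_pos.2 hD
  have hfin : {q : ℚ | (∃ k : ℤ, (D : ℚ) * q = k) ∧ |q| ≤ R}.Finite := by
    refine ((Set.finite_Icc (-⌈D * R⌉) ⌈D * R⌉).image fun k : ℤ => (k : ℚ) / D).subset ?_
    rintro q ⟨⟨k, hk⟩, hq⟩
    refine ⟨k, ?_, by simp only; rw [← hk]; field_simp⟩
    have h1 : |(k : ℚ)| ≤ ⌈D * R⌉ := by
      rw [← hk, abs_mul, abs_of_pos hD']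
      exact (mul_le_mul_of_nonneg_left hq hD'.le).trans (Int.le_ceil _)
    have h2 : |k| ≤ ⌈D * R⌉ := by exact_mod_cast h1
    exact abs_le.1 h2
  refine (Set.Finite.pi' fun _ : ι => hfin).subset ?_
  rintro a ⟨h1, h2⟩ i
  exact ⟨h1 i, hR a h2 i⟩

variable (n) in
/-- The sums of roots at which the square length agrees with a given linear function. -/
theorem finite_root_sums (l : S.h →ₗ[K] K) :
    {β : Dual K S.h | ∃ s : Multiset (Dual K S.h), (∀ γ ∈ s, γ ∈ S.rootsIn n) ∧ s.sum = β ∧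
      β (s.map (S.tv n)).sum = l (s.map (S.tv n)).sum}.Finite := by
  classical
  obtain ⟨D, hD, hDm⟩ := S.exists_common_denominator n
  choose! q hq using fun γ (hγ : γ ∈ S.roots n) δ (hδ : δ ∈ S.roots n) => exists_rat hγ hδ
  obtain ⟨π, hπ⟩ : ∃ π : K →ₗ[ℚ] ℚ, ∀ r : ℚ, π (r : K) = r := by
    obtain ⟨π, hπ⟩ := (Algebra.linearMap ℚ K).exists_leftInverse_of_injective
      (LinearMap.ker_eq_bot.2 (algebraMap ℚ K).injective)
    exact ⟨π, fun r => by simpa using LinearMap.congr_fun hπ r⟩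
  let ι := {γ // γ ∈ S.roots n}
  let T : (ι → ℚ) →ₗ[ℚ] (ι → ℚ) :=
    LinearMap.pi fun δ => ∑ γ : ι, q γ δ • LinearMap.proj γ
  let l' : (ι → ℚ) →ₗ[ℚ] ℚ := ∑ γ : ι, π (l (S.tv n γ)) • LinearMap.proj γ
  have hT : ∀ c δ, T c δ = ∑ γ : ι, q γ δ * c γ := fun c δ => by simp [T]
  have hl' : ∀ c, l' c = ∑ γ : ι, π (l (S.tv n γ)) * c γ := fun c => by simp [l']
  have hTv : ∀ (c : ι → ℚ) (δ : ι), (δ : Dual K S.h) (∑ γ : ι, (c γ : K) • S.tv n γ) =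
      (T c δ : ℚ) := by
    intro c δ
    rw [hT, map_sum, Rat.cast_sum]
    refine Finset.sum_congr rfl fun γ _ => ?_
    rw [map_smul, hq γ γ.2 δ δ.2, smul_eq_mul, Rat.cast_mul, mul_comm]
  have hlv : ∀ c : ι → ℚ, π (l (∑ γ : ι, (c γ : K) • S.tv n γ)) = l' c := by
    intro c
    rw [hl', map_sum, map_sum]
    refine Finset.sum_congr rfl fun γ _ => ?_
    rw [map_smul, smul_eq_mul, ← Rat.smul_def, map_smul, smul_eq_mul, mul_comm]
  have hext : ∀ c : ι → ℚ, ∑ γ : ι, (c γ : K) • S.tv n γ =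
      ∑ γ ∈ S.roots n, ((if h : γ ∈ S.roots n then c ⟨γ, h⟩ else 0 : ℚ) : K) • S.tv n γ := by
    intro c
    refine Eq.trans ?_ (Finset.sum_coe_sort (S.roots n) _)
    refine Finset.sum_congr rfl fun γ _ => ?_
    rw [dif_pos γ.2]
  have hker : l' ∈ LinearMap.range T.dualMap := by
    rw [LinearMap.range_dualMap_eq_dualAnnihilator_ker, Submodule.mem_dualAnnihilator]
    intro c hc
    have hv : ∑ γ : ι, (c γ : K) • S.tv n γ = 0 := by
      rw [hext]
      refine rat_combination_eq_zero _ fun δ hδ => ?_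
      rw [← hext, hTv c ⟨δ, hδ⟩, LinearMap.mem_ker.1 hc]
      simp
    rw [← hlv, hv, map_zero, map_zero]
  obtain ⟨m, hm⟩ := hker
  let m' : ι → ℚ := fun δ => m fun j => if δ = j then 1 else 0
  have hm' : ∀ c, l' c = ∑ δ, m' δ * T c δ := by
    intro c
    rw [← hm, LinearMap.dualMap_apply, LinearMap.pi_apply_eq_sum_univ m (T c)]
    refine Finset.sum_congr rfl fun δ _ => ?_
    rw [smul_eq_mul, mul_comm]
  refine ((finite_of_sum_sq D hD m').image fun a : ι → ℚ =>
    ∑ δ : ι, (a δ : K) • (δ : Dual K S.h)).subset ?_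
  rintro _ ⟨s, hs, rfl, hsl⟩
  let c : ι → ℚ := fun γ => s.count γ.1
  have hv : (s.map (S.tv n)).sum = ∑ γ : ι, (c γ : K) • S.tv n γ := by
    rw [Finset.sum_multiset_map_count, Finset.sum_subset (s₂ := S.roots n)
      (fun γ hγ => mem_roots.2 (hs γ (Multiset.mem_toFinset.1 hγ))), ← Finset.sum_coe_sort]
    · refine Finset.sum_congr rfl fun γ _ => ?_
      simp only [c, Rat.cast_natCast, Nat.cast_smul_eq_nsmul]
    · intro γ _ hγ
      rw [Multiset.mem_toFinset] at hγ
      rw [Multiset.count_eq_zero_of_notMem hγ, zero_smul]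
  have hβ : s.sum = ∑ δ : ι, (T c δ : K) • (δ : Dual K S.h) := by
    refine LinearMap.ext fun H => ?_
    rw [← form_sum_tv hs, form_h, ← Finset.sum_coe_sort, LinearMap.sum_apply]
    refine Finset.sum_congr rfl fun δ _ => ?_
    rw [hv, hTv, LinearMap.smul_apply, smul_eq_mul]
  refine ⟨T c, ⟨fun δ => ?_, ?_⟩, hβ.symm⟩
  · have : ∀ γ : ι, ∃ k : ℤ, (D : ℚ) * q γ δ = k := by
      intro γ
      obtain ⟨k, hk⟩ := hDm γ γ.2 δ δ.2
      rw [hq γ γ.2 δ δ.2] at hk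
      exact ⟨k, by exact_mod_cast hk⟩
    choose k hk using this
    refine ⟨∑ γ : ι, k γ * s.count γ.1, ?_⟩
    rw [hT, Finset.mul_sum, Int.cast_sum]
    refine Finset.sum_congr rfl fun γ _ => ?_
    rw [← mul_assoc, hk]
    simp [c]
  · rw [← hm', ← hlv, ← hv, ← hsl, hβ, LinearMap.sum_apply, hv]
    rw [← hπ (∑ δ, T c δ ^ 2), Rat.cast_sum]
    congr 1
    refine Finset.sum_congr rfl fun δ _ => ?_
    rw [LinearMap.smul_apply, hTv, smul_eq_mul, Rat.cast_pow, sq]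

end Setup

end Definiteness

section Faithful

open Module

variable (K : Type) [Field K] (g : Type) [LieRing g] [LieAlgebra K g]

/-- The span of all brackets. -/
def derivedSpan : Submodule K g := Submodule.span K {w : g | ∃ x y : g, ⁅x, y⁆ = w}

/-- The direct sum of the adjoint representation and of a two-step representation
of the abelianisation. -/
def AdjoinAb : Type := g × K × (g ⧸ derivedSpan K g)

instance : AddCommGroup (AdjoinAb K g) := inferInstanceAs (AddCommGroup (g × K × (g ⧸ derivedSpan K g)))

instance : Module K (AdjoinAb K g) := inferInstanceAs (Module K (g × K × (g ⧸ derivedSpan K g)))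

instance : LieRingModule g (AdjoinAb K g) where
  bracket y e := (⁅y, e.1⁆, 0, e.2.1 • (derivedSpan K g).mkQ y)
  add_lie x y e := by
    refine Prod.ext (add_lie x y e.1) (Prod.ext (add_zero (0 : K)).symm ?_)
    change e.2.1 • (derivedSpan K g).mkQ (x + y) =
      e.2.1 • (derivedSpan K g).mkQ x + e.2.1 • (derivedSpan K g).mkQ y
    rw [map_add, smul_add]
  lie_add x e f := by
    refine Prod.ext (lie_add x e.1 f.1) (Prod.ext (add_zero (0 : K)).symm ?_)
    exact add_smul e.2.1 f.2.1 _
  leibniz_lie x y e := by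
    refine Prod.ext (leibniz_lie x y e.1) (Prod.ext (add_zero (0 : K)).symm ?_)
    change (0 : K) • (derivedSpan K g).mkQ x =
      e.2.1 • (derivedSpan K g).mkQ ⁅x, y⁆ + (0 : K) • (derivedSpan K g).mkQ y
    have : (derivedSpan K g).mkQ ⁅x, y⁆ = 0 :=
      (Submodule.Quotient.mk_eq_zero _).2 (Submodule.subset_span ⟨x, y, rfl⟩)
    rw [this, zero_smul, zero_smul, smul_zero, add_zero]

lemma AdjoinAb.lie_def (y : g) (e : AdjoinAb K g) :
    ⁅y, e⁆ = ((⁅y, e.1⁆, 0, e.2.1 • (derivedSpan K g).mkQ y) : g × K × (g ⧸ derivedSpan K g)) := rfl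

instance : LieModule K g (AdjoinAb K g) where
  smul_lie t x e := by
    refine Prod.ext (smul_lie t x e.1) (Prod.ext (smul_zero t).symm ?_)
    change e.2.1 • (derivedSpan K g).mkQ (t • x) = t • e.2.1 • (derivedSpan K g).mkQ x
    rw [map_smul, smul_comm]
  lie_smul t x e := by
    refine Prod.ext (lie_smul t x e.1) (Prod.ext (smul_zero t).symm ?_)
    exact mul_smul t e.2.1 _

end Faithful

section Application

open LieAlgebra LieModule Module

variable {K : Type} [Field K] [IsAlgClosed K] [CharZero K]
variable {g : Type} [LieRing g] [LieAlgebra K g]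

namespace Setup

variable (S : Setup K g)

lemma adjoinAb_faithful [S.HasTriples] (y : g) (hy : ∀ e : AdjoinAb K g, ⁅y, e⁆ = 0) : y = 0 := by
  refine S.eq_zero_of_central_of_mem_span (fun z => ?_) ?_
  · exact congrArg Prod.fst ((AdjoinAb.lie_def K g y _).symm.trans (hy ((z, 0, 0) : g × K × _)))
  · have h := congrArg (fun e : g × K × (g ⧸ derivedSpan K g) => e.2.2)
      ((AdjoinAb.lie_def K g y _).symm.trans (hy ((0, 1, 0) : g × K × _)))
    have h : (1 : K) • (derivedSpan K g).mkQ y = 0 := h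
    rw [one_smul] at h
    exact (Submodule.Quotient.mk_eq_zero _).1 h

include S in
lemma env_mul_eq_zero [S.HasTriples] {u v : Env K g} (h : u * v = 0) : u = 0 ∨ v = 0 :=
  envelope_mul_eq_zero (AdjoinAb K g) S.adjoinAb_faithful h

/-- The sum of the negative root spaces. -/
def nminus : Submodule K g := ⨆ α ∈ S.pos, adWeightSpace K g S.h (-α)

/-- The subalgebra of the enveloping algebra generated by the negative root spaces. -/
def lowerAlg : Subalgebra K (Env K g) :=
  Algebra.adjoin K (UniversalEnvelopingAlgebra.ι K '' (S.nminus : Set g))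

variable {S}

lemma mem_nminus {α : Dual K S.h} (hα : α ∈ S.pos) {x : g} (hx : x ∈ adWeightSpace K g S.h (-α)) :
    x ∈ S.nminus := le_iSup₂ (f := fun α (_ : α ∈ S.pos) => adWeightSpace K g S.h (-α)) α hα hx

lemma mem_nplus {α : Dual K S.h} (hα : α ∈ S.pos) {x : g} (hx : x ∈ adWeightSpace K g S.h α) :
    x ∈ S.nplus := le_iSup₂ (f := fun α (_ : α ∈ S.pos) => adWeightSpace K g S.h α) α hα hx

lemma nminus_induction {p : g → Prop} (h0 : p 0) (hadd : ∀ x y, p x → p y → p (x + y))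
    (hw : ∀ α ∈ S.pos, ∀ x, x ∈ adWeightSpace K g S.h (-α) → p x) {x : g} (hx : x ∈ S.nminus) :
    p x := by
  refine Submodule.iSup_induction _ (motive := p) hx (fun α y hy => ?_) h0 hadd
  by_cases hα : α ∈ S.pos
  · rw [iSup_pos hα] at hy
    exact hw α hα y hy
  · rw [iSup_neg hα] at hy
    rw [(Submodule.mem_bot K).1 hy]
    exact h0

lemma nplus_induction {p : g → Prop} (h0 : p 0) (hadd : ∀ x y, p x → p y → p (x + y))
    (hw : ∀ α ∈ S.pos, ∀ x, x ∈ adWeightSpace K g S.h α → p x) {x : g} (hx : x ∈ S.nplus) :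
    p x := by
  refine Submodule.iSup_induction _ (motive := p) hx (fun α y hy => ?_) h0 hadd
  by_cases hα : α ∈ S.pos
  · rw [iSup_pos hα] at hy
    exact hw α hα y hy
  · rw [iSup_neg hα] at hy
    rw [(Submodule.mem_bot K).1 hy]
    exact h0

lemma nminus_lie [S.HasTriples] {x y : g} (hx : x ∈ S.nminus) (hy : y ∈ S.nminus) :
    ⁅x, y⁆ ∈ S.nminus := by
  refine nminus_induction (p := fun x => ⁅x, y⁆ ∈ S.nminus) (by simp)
    (fun a b ha hb => by rw [add_lie]; exact add_mem ha hb) (fun α hα x hx => ?_) hx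
  refine nminus_induction (p := fun y => ⁅x, y⁆ ∈ S.nminus) (by simp)
    (fun a b ha hb => by rw [lie_add]; exact add_mem ha hb) (fun β hβ y hy => ?_) hy
  by_cases h0 : ⁅x, y⁆ = 0
  · rw [h0]; exact zero_mem _
  have hm := lie_mem_adWeightSpace hx hy
  rw [← _root_.neg_add] at hm
  have hr := isRootOf_neg
    (S.isRootOf_of_mem (neg_ne_zero.2 (S.pos_add_ne_zero hα hβ)) hm h0)
  rw [neg_neg] at hr
  exact mem_nminus (S.pos_add α hα β hβ hr) hm

lemma b_toSubmodule : S.b.toSubmodule = S.h.toSubmodule ⊔ S.nplus := S.b_eq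

lemma isCompl_nminus [S.HasTriples] : IsCompl S.nminus S.b.toSubmodule := by
  have hb : S.b.toSubmodule = ⨆ β ∈ insert 0 S.pos, adWeightSpace K g S.h β := by
    rw [iSup_insert, S.adWeightSpace_zero, b_toSubmodule, nplus]
  have hn : S.nminus = ⨆ β ∈ {β | -β ∈ S.pos}, adWeightSpace K g S.h β := by
    refine le_antisymm (iSup₂_le fun α hα => ?_) (iSup₂_le fun β hβ x hx => ?_)
    · exact le_iSup₂ (f := fun β (_ : β ∈ {β | -β ∈ S.pos}) => adWeightSpace K g S.h β) (-α)
        (by simpa using hα)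
    · exact mem_nminus hβ (by rw [neg_neg]; exact hx)
  refine ⟨?_, codisjoint_iff_le_sup.2 ?_⟩
  · rw [hb, hn]
    refine S.h_indep.disjoint_biSup_biSup (Set.disjoint_left.2 ?_)
    rintro β hβ (rfl | hβ')
    · exact S.pos_ne_zero hβ neg_zero
    · exact S.pos_add_ne_zero hβ hβ' (neg_add_cancel β)
  · rintro x -
    refine S.weight_induction (p := fun x => x ∈ S.nminus ⊔ S.b.toSubmodule) (zero_mem _)
      (fun _ _ => add_mem) (fun β x hx => ?_) x
    by_cases hx0 : x = 0
    · rw [hx0]; exact zero_mem _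
    by_cases hβ0 : β = 0
    · subst hβ0
      rw [S.adWeightSpace_zero] at hx
      exact Submodule.mem_sup_right (by rw [b_toSubmodule]; exact Submodule.mem_sup_left hx)
    have hr := S.isRootOf_of_mem hβ0 hx hx0
    by_cases hβ : β ∈ S.pos
    · exact Submodule.mem_sup_right
        (by rw [b_toSubmodule]; exact Submodule.mem_sup_right (mem_nplus hβ hx))
    · exact Submodule.mem_sup_left (mem_nminus (S.neg_mem_pos hr hβ) (by rwa [neg_neg]))

variable (S) in
/-- The projection onto the Cartan subalgebra. -/
def projH : g →ₗ[K] S.h :=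
  (S.proj 0).codRestrict S.h.toSubmodule fun x => by
    rw [← S.adWeightSpace_zero]; exact S.proj_mem 0 x

lemma projH_coe (x : g) : (S.projH x : g) = S.proj 0 x := rfl

lemma projH_of_h (H : S.h) : S.projH (H : g) = H := by
  refine Subtype.ext ?_
  rw [projH_coe, S.proj_of_mem]
  rw [S.adWeightSpace_zero]
  exact H.2

lemma projH_of_nplus {x : g} (hx : x ∈ S.nplus) : S.projH x = 0 := by
  refine nplus_induction (p := fun x => S.projH x = 0) (map_zero _)
    (fun a b ha hb => by rw [map_add, ha, hb, add_zero]) (fun α hα x hx => ?_) hx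
  refine Subtype.ext ?_
  rw [projH_coe, S.proj_of_mem_ne hx (S.pos_ne_zero hα)]
  rfl

lemma lie_h_mem_nplus {x y : g} (hx : x ∈ S.h) (hy : y ∈ S.nplus) : ⁅x, y⁆ ∈ S.nplus := by
  refine nplus_induction (p := fun y => ⁅x, y⁆ ∈ S.nplus) (by simp)
    (fun a b ha hb => by rw [lie_add]; exact add_mem ha hb) (fun α hα y hy => ?_) hy
  have : ⁅x, y⁆ = α ⟨x, hx⟩ • y := hy ⟨x, hx⟩
  rw [this]
  exact Submodule.smul_mem _ _ (mem_nplus hα hy)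

lemma nplus_lie {x y : g} (hx : x ∈ S.nplus) (hy : y ∈ S.nplus) :
    ⁅x, y⁆ ∈ S.nplus := by
  refine nplus_induction (p := fun x => ⁅x, y⁆ ∈ S.nplus) (by simp)
    (fun a b ha hb => by rw [add_lie]; exact add_mem ha hb) (fun α hα x hx => ?_) hx
  refine nplus_induction (p := fun y => ⁅x, y⁆ ∈ S.nplus) (by simp)
    (fun a b ha hb => by rw [lie_add]; exact add_mem ha hb) (fun β hβ y hy => ?_) hy
  by_cases h0 : ⁅x, y⁆ = 0
  · rw [h0]; exact zero_mem _
  have hm := lie_mem_adWeightSpace hx hy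
  exact mem_nplus (S.pos_add α hα β hβ
    (S.isRootOf_of_mem (S.pos_add_ne_zero hα hβ) hm h0)) hm

lemma lie_b_mem_nplus {x y : g} (hx : x ∈ S.b.toSubmodule) (hy : y ∈ S.b.toSubmodule) :
    ⁅x, y⁆ ∈ S.nplus := by
  rw [b_toSubmodule] at hx hy
  obtain ⟨x1, hx1, x2, hx2, rfl⟩ := Submodule.mem_sup.1 hx
  obtain ⟨y1, hy1, y2, hy2, rfl⟩ := Submodule.mem_sup.1 hy
  rw [add_lie, lie_add, lie_add, S.lie_h_h hx1 hy1, zero_add, ← lie_skew x2 y1]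
  exact add_mem (lie_h_mem_nplus hx1 hy2)
    (add_mem (neg_mem (lie_h_mem_nplus hy1 hx2)) (nplus_lie hx2 hy2))

lemma vermaIdeal_eq (mu : Dual K S.h) :
    S.vermaIdeal mu = inducedIdeal S.b.toSubmodule (mu ∘ₗ S.projH) := by
  refine le_antisymm (Submodule.span_le.2 ?_) (Submodule.span_le.2 ?_)
  · rintro _ (⟨x, hx, rfl⟩ | ⟨H, rfl⟩)
    · refine Submodule.subset_span ⟨x, ?_, ?_⟩
      · exact (b_toSubmodule (S := S)).ge (Submodule.mem_sup_right hx)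
      · rw [shiftMap_apply, LinearMap.comp_apply, projH_of_nplus hx, map_zero, map_zero, sub_zero]
    · refine Submodule.subset_span ⟨H, ?_, ?_⟩
      · exact (b_toSubmodule (S := S)).ge (Submodule.mem_sup_left H.2)
      · rw [shiftMap_apply, LinearMap.comp_apply, projH_of_h]
  · rintro _ ⟨x, hx, rfl⟩
    have hx := (b_toSubmodule (S := S)).le hx
    obtain ⟨x1, hx1, x2, hx2, rfl⟩ := Submodule.mem_sup.1 hx
    rw [map_add]
    refine add_mem (Submodule.subset_span (Or.inr ⟨⟨x1, hx1⟩, ?_⟩))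
      (Submodule.subset_span (Or.inl ⟨x2, hx2, ?_⟩))
    · rw [shiftMap_apply, LinearMap.comp_apply]
      exact congrArg (fun z => _ - algebraMap K (Env K g) (mu z)) (projH_of_h ⟨x1, hx1⟩).symm
    · rw [shiftMap_apply, LinearMap.comp_apply, projH_of_nplus hx2, map_zero, map_zero, sub_zero]

variable {M : Type} [AddCommGroup M] [Module K M] [Module (Env K g) M] [IsScalarTower K (Env K g) M]

variable (S) in
/-- The vectors of a given weight. -/
def wt (M : Type) [AddCommGroup M] [Module K M] [Module (Env K g) M] [IsScalarTower K (Env K g) M]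
    (κ : Dual K S.h) : Submodule K M where
  carrier := {w | ∀ H : S.h, UniversalEnvelopingAlgebra.ι K (H : g) • w = κ H • w}
  add_mem' {a b} ha hb H := by rw [smul_add, ha H, hb H, smul_add]
  zero_mem' H := by rw [smul_zero, smul_zero]
  smul_mem' c x hx H := by
    rw [← algebraMap_smul (Env K g) c x, ← mul_smul, ← Algebra.commutes, mul_smul, hx H,
      algebraMap_smul, algebraMap_smul, smul_comm]

/-- A highest weight vector freely generating a module over the lower subalgebra. -/
structure IsVermaVec (mu : Dual K S.h) (v : M) : Prop where
  weight : v ∈ S.wt M mu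
  pos : ∀ γ ∈ S.pos, ∀ x ∈ adWeightSpace K g S.h γ, UniversalEnvelopingAlgebra.ι K x • v = 0
  free : ∀ a ∈ S.lowerAlg, a • v = 0 → a = 0
  gen : ∀ w : M, ∃ a ∈ S.lowerAlg, a • v = w

lemma isVermaVec_mk [S.HasTriples] (mu : Dual K S.h) :
    IsVermaVec mu (Submodule.Quotient.mk (p := S.vermaIdeal mu) (1 : Env K g)) := by
  have htri := triangular_decomposition (AdjoinAb K g) (mu ∘ₗ S.projH) S.adjoinAb_faithful
    (isCompl_nminus (S := S)) (fun _ ha _ hb => nminus_lie ha hb)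
    (fun a ha b hb => S.b.lie_mem ha hb)
    (fun a ha b hb => by
      rw [LinearMap.comp_apply, projH_of_nplus (lie_b_mem_nplus ha hb), map_zero])
  rw [← vermaIdeal_eq] at htri
  refine ⟨fun H => ?_, fun γ hγ x hx => ?_, fun a ha h => ?_, fun w => ?_⟩
  · rw [← Submodule.Quotient.mk_smul, ← Submodule.Quotient.mk_smul, ← sub_eq_zero,
      ← Submodule.Quotient.mk_sub, Submodule.Quotient.mk_eq_zero, smul_eq_mul, mul_one,
      ← Algebra.algebraMap_eq_smul_one]
    exact Submodule.subset_span (Or.inr ⟨H, rfl⟩)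
  · rw [← Submodule.Quotient.mk_smul, Submodule.Quotient.mk_eq_zero, smul_eq_mul, mul_one]
    exact Submodule.subset_span (Or.inl ⟨x, mem_nplus hγ hx, rfl⟩)
  · rw [← Submodule.Quotient.mk_smul, Submodule.Quotient.mk_eq_zero, smul_eq_mul, mul_one] at h
    exact htri.1 a ha h
  · obtain ⟨u, rfl⟩ := Submodule.Quotient.mk_surjective _ w
    obtain ⟨a, ha, h⟩ := htri.2 u
    refine ⟨a, ha, ?_⟩
    rw [← Submodule.Quotient.mk_smul, smul_eq_mul, mul_one]
    exact ((Submodule.Quotient.eq _).2 h).symm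

end Setup

end Application

section Graded

variable {K M ι : Type} [Field K] [AddCommGroup M] [Module K M] {W : ι → Submodule K M}

lemma span_range_le_iSup {T : Type} (m : T → M) (c : T → ι) :
    Submodule.span K (Set.range m) ≤ ⨆ i, Submodule.span K (m '' {t | c t = i}) := by
  refine Submodule.span_le.2 ?_
  rintro _ ⟨t, rfl⟩
  exact Submodule.mem_iSup_of_mem (c t) (Submodule.subset_span ⟨t, rfl, rfl⟩)

lemma span_fiber_le {T : Type} {m : T → M} {c : T → ι} (hm : ∀ t, m t ∈ W (c t)) (i : ι) :
    Submodule.span K (m '' {t | c t = i}) ≤ W i := by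
  refine Submodule.span_le.2 ?_
  rintro _ ⟨t, rfl, rfl⟩
  exact hm t

/-- Uniqueness of the homogeneous components. -/
lemma finsupp_eq_of_sum_eq (hW : iSupIndep W) {f f' : ι →₀ M} (hf : ∀ i, f i ∈ W i)
    (hf' : ∀ i, f' i ∈ W i) (h : (f.sum fun _ x => x) = f'.sum fun _ x => x) : f = f' := by
  classical
  rw [← sub_eq_zero]
  have h0 : ((f - f').sum fun _ x => x) = 0 := by
    rw [Finsupp.sum_sub_index fun _ _ _ => rfl, h, sub_self]
  have := (iSupIndep_iff_finsetSum_eq_zero_imp_eq_zero W).1 hW (f - f').support (f - f')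
    (fun i _ => sub_mem (hf i) (hf' i)) h0
  ext i
  by_cases hi : i ∈ (f - f').support
  · exact this i hi
  · exact Finsupp.notMem_support_iff.1 hi

/-- A homogeneous element of the span of homogeneous elements is in the span of those of the
same degree. -/
lemma mem_span_fiber (hW : iSupIndep W) {T : Type} {m : T → M} {c : T → ι}
    (hm : ∀ t, m t ∈ W (c t)) {i : ι} {x : M} (hx : x ∈ Submodule.span K (Set.range m))
    (hxi : x ∈ W i) : x ∈ Submodule.span K (m '' {t | c t = i}) := by
  classical
  obtain ⟨f, hf, hfx⟩ := (Submodule.mem_iSup_iff_exists_finsupp _ _).1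
    (span_range_le_iSup m c hx)
  have h := finsupp_eq_of_sum_eq hW (f := f) (f' := Finsupp.single i x)
    (fun j => span_fiber_le hm j (hf j)) (fun j => ?_)
    (by rw [hfx, Finsupp.sum_single_index rfl])
  · have h2 := hf i
    rwa [h, Finsupp.single_eq_same] at h2
  · rw [Finsupp.single_apply]
    split_ifs with hij
    · exact hij ▸ hxi
    · exact zero_mem _

/-- Two spans of homogeneous elements with a common nonzero element have a common nonzero
homogeneous element. -/
lemma exists_homogeneous_mem (hW : iSupIndep W) {T T' : Type} {m : T → M} {c : T → ι}
    (hm : ∀ t, m t ∈ W (c t)) {m' : T' → M} {c' : T' → ι} (hm' : ∀ t, m' t ∈ W (c' t)) {x : M}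
    (hx : x ∈ Submodule.span K (Set.range m)) (hx' : x ∈ Submodule.span K (Set.range m'))
    (hx0 : x ≠ 0) : ∃ i, ∃ y ∈ W i, y ≠ 0 ∧ y ∈ Submodule.span K (Set.range m) ∧
      y ∈ Submodule.span K (Set.range m') := by
  obtain ⟨f, hf, hfx⟩ := (Submodule.mem_iSup_iff_exists_finsupp _ _).1
    (span_range_le_iSup m c hx)
  obtain ⟨f', hf', hfx'⟩ := (Submodule.mem_iSup_iff_exists_finsupp _ _).1
    (span_range_le_iSup m' c' hx')
  have h := finsupp_eq_of_sum_eq hW (fun j => span_fiber_le hm j (hf j))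
    (fun j => span_fiber_le hm' j (hf' j)) (hfx.trans hfx'.symm)
  have hne : f ≠ 0 := by
    rintro rfl
    exact hx0 (by rw [← hfx, Finsupp.sum_zero_index])
  obtain ⟨i, hi⟩ := Finsupp.ne_iff.1 hne
  refine ⟨i, f i, span_fiber_le hm i (hf i), hi, ?_, ?_⟩
  · exact Submodule.span_mono (Set.image_subset_range _ _) (hf i)
  · rw [h]
    exact Submodule.span_mono (Set.image_subset_range _ _) (hf' i)

end Graded

section Wqo

/-- A relation on multisets over a finite type, decreasing in the sense of sums, is well founded. -/
lemma wellFounded_sum {T G : Type} [Finite T] [AddCommGroup G] (s : T → G)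
    (hs : ∀ m : Multiset T, (m.map s).sum = 0 → m = 0) :
    WellFounded fun m' m : Multiset T =>
      ∃ d : Multiset T, d ≠ 0 ∧ (m'.map s).sum + (d.map s).sum = (m.map s).sum := by
  classical
  set r := fun m' m : Multiset T =>
      ∃ d : Multiset T, d ≠ 0 ∧ (m'.map s).sum + (d.map s).sum = (m.map s).sum with hr
  have htrans : ∀ a b c, r a b → r b c → r a c := by
    rintro a b c ⟨d, hd, h⟩ ⟨e, he, h'⟩
    refine ⟨d + e, fun h0 => hd (add_eq_zero.1 h0).1, ?_⟩
    rw [Multiset.map_add, Multiset.sum_add, ← add_assoc, h, h']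
  rw [wellFounded_iff_isEmpty_descending_chain]
  refine ⟨fun ⟨f, hf⟩ => ?_⟩
  obtain ⟨i, j, hij, hle⟩ := wellQuasiOrdered_le fun k => Finsupp.orderIsoMultiset.symm (f k)
  have hle : f i ≤ f j := Finsupp.orderIsoMultiset.symm.le_iff_le.1 hle
  obtain ⟨e, he⟩ := Multiset.le_iff_exists_add.1 hle
  obtain ⟨d, hd, h⟩ : r (f j) (f i) := by
    have : ∀ j, i < j → r (f j) (f i) := by
      intro j hj
      induction j, hj using Nat.le_induction with
      | base => exact hf i
      | succ j _ ih => exact htrans _ _ _ (hf j) ih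
    exact this j hij
  rw [he, Multiset.map_add, Multiset.sum_add, add_assoc, add_eq_left, ← Multiset.sum_add,
    ← Multiset.map_add] at h
  exact hd (add_eq_zero.1 (hs _ h)).2

end Wqo

section Weights

open LieAlgebra LieModule Module

variable {K : Type} [Field K] [IsAlgClosed K] [CharZero K]
variable {g : Type} [LieRing g] [LieAlgebra K g]

namespace Setup

variable {S : Setup K g}
variable {M : Type} [AddCommGroup M] [Module K M] [Module (Env K g) M] [IsScalarTower K (Env K g) M]

variable (S M) in
lemma iSupIndep_wt : iSupIndep (S.wt M) := by
  let f : S.h → Module.End K M := fun H => Algebra.lsmul K K M (UniversalEnvelopingAlgebra.ι K (H : g))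
  have hcomm : ∀ H H', Commute (f H) (f H') := by
    intro H H'
    refine Commute.map ?_ _
    have := ι_lie (K := K) (H : g) (H' : g)
    rw [S.lie_h_h H.2 H'.2, map_zero] at this
    exact (sub_eq_zero.1 this.symm)
  have h := Module.End.independent_iInf_maxGenEigenspace_of_forall_mapsTo f
    fun i j φ => Module.End.mapsTo_maxGenEigenspace_of_comm (hcomm j i) φ
  have h2 := h.comp (f := fun κ : Dual K S.h => (κ : S.h → K)) DFunLike.coe_injective
  refine h2.mono fun κ w hw => ?_
  refine (Submodule.mem_iInf _).2 fun H => ?_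
  refine (Module.End.mem_maxGenEigenspace _ _ _).2 ⟨1, ?_⟩
  rw [pow_one, LinearMap.sub_apply, sub_eq_zero]
  exact hw H

lemma smul_mem_wt {α κ : Dual K S.h} {x : g} (hx : x ∈ adWeightSpace K g S.h α) {w : M}
    (hw : w ∈ S.wt M κ) : UniversalEnvelopingAlgebra.ι K x • w ∈ S.wt M (κ + α) := by
  intro H
  have h := ι_lie (K := K) (H : g) x
  rw [hx H, map_smul] at h
  rw [← mul_smul, ← sub_add_cancel (UniversalEnvelopingAlgebra.ι K (H : g) *
    UniversalEnvelopingAlgebra.ι K x) (UniversalEnvelopingAlgebra.ι K x *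
    UniversalEnvelopingAlgebra.ι K (H : g)), ← h, add_smul, mul_smul, hw H, smul_comm _ (κ H),
    LinearMap.add_apply, add_smul, add_comm, smul_assoc]

end Setup

end Weights

section Levels

open LieAlgebra LieModule Module

variable {K : Type} [Field K] [IsAlgClosed K] [CharZero K]
variable {g : Type} [LieRing g] [LieAlgebra K g]

namespace Setup

variable (S : Setup K g)

/-- The positive roots of a finite level. -/
abbrev PosIdx (k : ℕ) : Type := {γ : Dual K S.h // γ ∈ S.rootsIn k ∧ γ ∈ S.pos}

variable [S.HasTriples]

instance (k : ℕ) : Finite (S.PosIdx k) :=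
  ((S.rootsIn_finite k).subset fun _ h => h.1 : {γ | γ ∈ S.rootsIn k ∧ γ ∈ S.pos}.Finite)

lemma exists_dual_pair (k : ℕ) (γ : Dual K S.h) : ∃ p : g × g, γ ∈ S.rootsIn k →
    p.1 ∈ adWeightSpace K g S.h γ ∧ p.2 ∈ adWeightSpace K g S.h (-γ) ∧ S.form k p.1 p.2 = 1 := by
  by_cases hγ : γ ∈ S.rootsIn k
  · obtain ⟨e, he, f, hf, h⟩ := exists_form_eq_one hγ
    exact ⟨(e, f), fun _ => ⟨he, hf, h⟩⟩
  · exact ⟨0, fun h => absurd h hγ⟩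

/-- A root vector. -/
def eV (k : ℕ) (γ : Dual K S.h) : g := (S.exists_dual_pair k γ).choose.1

/-- The dual root vector. -/
def fV (k : ℕ) (γ : Dual K S.h) : g := (S.exists_dual_pair k γ).choose.2

variable {S} {k : ℕ} {γ δ : Dual K S.h}

lemma eV_mem (hγ : γ ∈ S.rootsIn k) : S.eV k γ ∈ adWeightSpace K g S.h γ :=
  ((S.exists_dual_pair k γ).choose_spec hγ).1

lemma fV_mem (hγ : γ ∈ S.rootsIn k) : S.fV k γ ∈ adWeightSpace K g S.h (-γ) :=
  ((S.exists_dual_pair k γ).choose_spec hγ).2.1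

lemma form_eV_fV (hγ : γ ∈ S.rootsIn k) : S.form k (S.eV k γ) (S.fV k γ) = 1 :=
  ((S.exists_dual_pair k γ).choose_spec hγ).2.2

lemma fV_ne_zero (hγ : γ ∈ S.rootsIn k) : S.fV k γ ≠ 0 := by
  intro h
  have := form_eV_fV hγ
  rw [h, map_zero] at this
  exact zero_ne_one this

lemma eV_ne_zero (hγ : γ ∈ S.rootsIn k) : S.eV k γ ≠ 0 := by
  intro h
  have := form_eV_fV hγ
  rw [h, map_zero, LinearMap.zero_apply] at this
  exact zero_ne_one this

lemma exists_smul_fV (hγ : γ ∈ S.rootsIn k) {x : g} (hx : x ∈ adWeightSpace K g S.h (-γ)) :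
    ∃ c : K, x = c • S.fV k γ :=
  exists_smul_of_mem (neg_ne_zero.2 hγ.1.1) (fV_mem hγ) (fV_ne_zero hγ) hx

lemma exists_smul_eV (hγ : γ ∈ S.rootsIn k) {x : g} (hx : x ∈ adWeightSpace K g S.h γ) :
    ∃ c : K, x = c • S.eV k γ :=
  exists_smul_of_mem hγ.1.1 (eV_mem hγ) (eV_ne_zero hγ) hx

variable (S k) in
/-- The generators of the lower subalgebra of a finite level. -/
def lowVec (γ : S.PosIdx k) : Env K g := UniversalEnvelopingAlgebra.ι K (S.fV k γ.1)

variable (S k) in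
/-- The lower subalgebra of a finite level. -/
def lowAlg : Submodule K (Env K g) := wordSpan K (S.lowVec k)

lemma lowVec_mem (i : S.PosIdx k) : S.lowVec k i ∈ S.lowAlg k :=
  Submodule.subset_span ⟨[i], by simp⟩

lemma one_mem_lowAlg : (1 : Env K g) ∈ S.lowAlg k := Submodule.subset_span ⟨[], by simp⟩

lemma ι_mem_span_lowVec (hγ : γ ∈ S.rootsIn k) (hp : γ ∈ S.pos) {x : g}
    (hx : x ∈ adWeightSpace K g S.h (-γ)) :
    UniversalEnvelopingAlgebra.ι K x ∈ Submodule.span K (Set.range (S.lowVec k)) := by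
  obtain ⟨c, rfl⟩ := exists_smul_fV hγ hx
  rw [map_smul]
  exact Submodule.smul_mem _ _ (Submodule.subset_span ⟨⟨γ, hγ, hp⟩, rfl⟩)

lemma span_lowVec_le : Submodule.span K (Set.range (S.lowVec k)) ≤ S.lowAlg k := by
  refine Submodule.span_le.2 ?_
  rintro _ ⟨i, rfl⟩
  exact lowVec_mem i

lemma lowVec_comm (i j : S.PosIdx k) : S.lowVec k i * S.lowVec k j - S.lowVec k j * S.lowVec k i ∈
    Submodule.span K (Set.range (S.lowVec k)) := by
  rw [lowVec, lowVec, ← ι_lie]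
  by_cases h0 : ⁅S.fV k i.1, S.fV k j.1⁆ = 0
  · rw [h0, map_zero]; exact zero_mem _
  have hm := lie_mem_adWeightSpace (fV_mem i.2.1) (fV_mem j.2.1)
  have hne := S.pos_add_ne_zero i.2.2 j.2.2
  rw [← _root_.neg_add] at hm
  have hr := isRootOf_neg (S.isRootOf_of_mem (neg_ne_zero.2 hne) hm h0)
  rw [neg_neg] at hr
  exact ι_mem_span_lowVec (add_mem_rootsIn i.2.1 j.2.1 hr) (S.pos_add _ i.2.2 _ j.2.2 hr) hm

lemma lowAlg_le_lowerAlg {a : Env K g} (ha : a ∈ S.lowAlg k) : a ∈ S.lowerAlg := by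
  have : S.lowAlg k ≤ S.lowerAlg.toSubmodule := by
    refine Submodule.span_le.2 ?_
    rintro _ ⟨w, rfl⟩
    refine Subalgebra.list_prod_mem _ fun r hr => ?_
    obtain ⟨i, -, rfl⟩ := List.mem_map.1 hr
    exact Algebra.subset_adjoin ⟨_, mem_nminus i.2.2 (fV_mem i.2.1), rfl⟩
  exact this ha

lemma exists_level {a : Env K g} (ha : a ∈ S.lowerAlg) : ∃ k₀, ∀ k ≥ k₀, a ∈ S.lowAlg k := by
  have hadd : ∀ a b : Env K g, (∃ k₀, ∀ k ≥ k₀, a ∈ S.lowAlg k) →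
      (∃ k₀, ∀ k ≥ k₀, b ∈ S.lowAlg k) → ∃ k₀, ∀ k ≥ k₀, a ∈ S.lowAlg k ∧ b ∈ S.lowAlg k := by
    rintro a b ⟨m, hm⟩ ⟨n, hn⟩
    exact ⟨max m n, fun k hk => ⟨hm k (le_of_max_le_left hk), hn k (le_of_max_le_right hk)⟩⟩
  induction ha using Algebra.adjoin_induction with
  | mem r h =>
    obtain ⟨x, hx, rfl⟩ := h
    refine nminus_induction
      (p := fun x => ∃ k₀, ∀ k ≥ k₀, UniversalEnvelopingAlgebra.ι K x ∈ S.lowAlg k) ?_ ?_ ?_ hx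
    · exact ⟨0, fun k _ => by rw [map_zero]; exact zero_mem _⟩
    · intro x y hx hy
      obtain ⟨k₀, h⟩ := hadd _ _ hx hy
      exact ⟨k₀, fun k hk => by rw [map_add]; exact add_mem (h k hk).1 (h k hk).2⟩
    · intro α hα x hx
      obtain ⟨n, hn⟩ := exists_mem_rootsIn (S.pos_root α hα)
      exact ⟨n, fun k hk => span_lowVec_le (ι_mem_span_lowVec (S.rootsIn_mono hk hn) hα hx)⟩
  | algebraMap c =>
    refine ⟨0, fun k _ => ?_⟩
    rw [Algebra.algebraMap_eq_smul_one]
    exact Submodule.smul_mem _ _ one_mem_lowAlg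
  | add a b _ _ ha hb =>
    obtain ⟨k₀, h⟩ := hadd a b ha hb
    exact ⟨k₀, fun k hk => add_mem (h k hk).1 (h k hk).2⟩
  | mul a b _ _ ha hb =>
    obtain ⟨k₀, h⟩ := hadd a b ha hb
    exact ⟨k₀, fun k hk => wordSpan_mul _ (h k hk).1 (h k hk).2⟩

variable {M : Type} [AddCommGroup M] [Module K M] [Module (Env K g) M] [IsScalarTower K (Env K g) M]

variable (k) in
/-- A vector of weight `κ` killed by the positive root vectors of a finite level. -/
def Sing (κ : Dual K S.h) (w : M) : Prop :=
  w ∈ S.wt M κ ∧ ∀ γ ∈ S.rootsIn k, γ ∈ S.pos → ∀ x ∈ adWeightSpace K g S.h γ,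
    UniversalEnvelopingAlgebra.ι K x • w = 0

variable (k) in
/-- The span of the lower words applied to a vector. -/
def orbit (S : Setup K g) [S.HasTriples] (k : ℕ) (w : M) : Submodule K M :=
  Submodule.span K (Set.range fun l : List (S.PosIdx k) => (l.map (S.lowVec k)).prod • w)

lemma mem_orbit {w x : M} : x ∈ orbit S k w ↔ ∃ a ∈ S.lowAlg k, a • w = x := by
  have h : orbit S k w = (S.lowAlg k).map ((LinearMap.toSpanSingleton (Env K g) M w).restrictScalars K) := by
    rw [lowAlg, wordSpan, Submodule.map_span, orbit]
    congr 1
    ext y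
    constructor
    · rintro ⟨l, rfl⟩
      exact ⟨_, ⟨l, rfl⟩, rfl⟩
    · rintro ⟨_, ⟨l, rfl⟩, rfl⟩
      exact ⟨l, rfl⟩
  rw [h]
  rfl

lemma word_smul_mem_wt {κ : Dual K S.h} {w : M} (hw : w ∈ S.wt M κ) (l : List (S.PosIdx k)) :
    (l.map (S.lowVec k)).prod • w ∈ S.wt M (κ - (Multiset.map Subtype.val (l : Multiset (S.PosIdx k))).sum) := by
  induction l with
  | nil => simpa using hw
  | cons i l ih =>
    rw [List.map_cons, List.prod_cons, mul_smul, ← Multiset.cons_coe, Multiset.map_cons,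
      Multiset.sum_cons]
    have := smul_mem_wt (fV_mem i.2.1) ih
    rw [← sub_eq_add_neg, sub_sub, add_comm _ i.1] at this
    exact this

/-- The weight of a nonzero weight vector in an orbit. -/
lemma exists_weight_of_mem_orbit {κ κ' : Dual K S.h} {w x : M} (hw : w ∈ S.wt M κ)
    (hx : x ∈ orbit S k w) (hx' : x ∈ S.wt M κ') (hx0 : x ≠ 0) :
    ∃ m : Multiset (S.PosIdx k), κ' = κ - (m.map Subtype.val).sum := by
  have h := mem_span_fiber (S.iSupIndep_wt M) (fun l => word_smul_mem_wt hw l) hx hx'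
  by_contra! hne
  have : {l : List (S.PosIdx k) | κ - (Multiset.map Subtype.val (l : Multiset (S.PosIdx k))).sum = κ'} = ∅ :=
    Set.eq_empty_of_forall_notMem fun l hl => hne l hl.symm
  rw [this, Set.image_empty, Submodule.span_empty] at h
  exact hx0 h

lemma eq_zero_of_map_sum_eq_zero {m : Multiset (S.PosIdx k)} (h : (m.map Subtype.val).sum = 0) :
    m = 0 := by
  have := eq_zero_of_sum_pos_eq_zero (S := S) (s := m.map Subtype.val) (fun γ hγ => by
    obtain ⟨i, -, rfl⟩ := Multiset.mem_map.1 hγ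
    exact i.2.2) h
  exact Multiset.map_eq_zero.1 this

lemma exists_smul_of_mem_orbit {κ : Dual K S.h} {w x : M} (hw : w ∈ S.wt M κ)
    (hx : x ∈ orbit S k w) (hx' : x ∈ S.wt M κ) : ∃ c : K, c • w = x := by
  have h := mem_span_fiber (S.iSupIndep_wt M) (fun l => word_smul_mem_wt hw l) hx hx'
  refine Submodule.mem_span_singleton.1 (Submodule.span_mono ?_ h)
  rintro _ ⟨l, hl, rfl⟩
  have : (l : Multiset (S.PosIdx k)) = 0 := eq_zero_of_map_sum_eq_zero (sub_eq_self.1 hl)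
  rw [(Multiset.coe_eq_zero l).1 this]
  simp

/-- Elements of a finite level map an orbit of a singular vector to itself, in a way which depends
only on the weight of the singular vector. -/
lemma exists_lower_action (κ : Dual K S.h) {a : Env K g} (ha : a ∈ S.lowAlg k) {δ : Dual K S.h}
    (hδ : δ = 0 ∨ δ ∈ S.rootsIn k) {x : g} (hx : x ∈ adWeightSpace K g S.h δ) :
    ∃ a' ∈ S.lowAlg k, ∀ w : M, Sing k κ w →
      UniversalEnvelopingAlgebra.ι K x • a • w = a' • w := by
  induction ha using Submodule.span_induction with
  | zero => exact ⟨0, zero_mem _, fun w _ => by rw [zero_smul, smul_zero]⟩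
  | add a b _ _ ha hb =>
    obtain ⟨a', ha', ha⟩ := ha
    obtain ⟨b', hb', hb⟩ := hb
    exact ⟨a' + b', add_mem ha' hb', fun w hw => by
      rw [add_smul, smul_add, ha w hw, hb w hw, add_smul]⟩
  | smul c a _ ha =>
    obtain ⟨a', ha', ha⟩ := ha
    exact ⟨c • a', Submodule.smul_mem _ _ ha', fun w hw => by
      rw [smul_assoc, smul_comm, ha w hw, smul_assoc]⟩
  | mem r hr =>
    obtain ⟨l, rfl⟩ := hr
    induction l generalizing δ x with
    | nil =>
      rw [List.map_nil, List.prod_nil]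
      rcases hδ with rfl | hδ
      · rw [S.adWeightSpace_zero] at hx
        refine ⟨κ ⟨x, hx⟩ • 1, Submodule.smul_mem _ _ one_mem_lowAlg, fun w hw => ?_⟩
        rw [one_smul, smul_assoc, one_smul]
        exact hw.1 ⟨x, hx⟩
      · by_cases hp : δ ∈ S.pos
        · exact ⟨0, zero_mem _, fun w hw => by rw [one_smul, zero_smul, hw.2 δ hδ hp x hx]⟩
        · exact ⟨_, span_lowVec_le (ι_mem_span_lowVec (neg_mem_rootsIn hδ)
            (S.neg_mem_pos hδ.1 hp) (by rwa [neg_neg])), fun w _ => by rw [one_smul]⟩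
    | cons i l ih =>
      obtain ⟨a, ha, h1⟩ := ih hδ hx
      obtain ⟨b, hb, h2⟩ : ∃ a' ∈ S.lowAlg k, ∀ w : M, Sing k κ w →
          UniversalEnvelopingAlgebra.ι K ⁅x, S.fV k i.1⁆ • (l.map (S.lowVec k)).prod • w = a' • w := by
        by_cases h0 : ⁅x, S.fV k i.1⁆ = 0
        · exact ⟨0, zero_mem _, fun w _ => by rw [h0, map_zero, zero_smul, zero_smul]⟩
        have hm := lie_mem_adWeightSpace hx (fV_mem i.2.1)
        refine ih ?_ hm
        rcases hδ with rfl | hδ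
        · rw [zero_add]; exact Or.inr (neg_mem_rootsIn i.2.1)
        · by_cases h : δ + -i.1 = 0
          · exact Or.inl h
          · exact Or.inr (add_mem_rootsIn hδ (neg_mem_rootsIn i.2.1) (S.isRootOf_of_mem h hm h0))
      refine ⟨S.lowVec k i * a + b, add_mem (wordSpan_mul _ (lowVec_mem i) ha) hb, fun w hw => ?_⟩
      rw [add_smul, ← h2 w hw, mul_smul, ← h1 w hw, List.map_cons, List.prod_cons, ι_lie, lowVec]
      simp only [sub_smul, mul_smul]
      abel

lemma orbit_stable {κ δ : Dual K S.h} {w y : M} (hw : Sing k κ w) (hy : y ∈ orbit S k w)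
    (hδ : δ = 0 ∨ δ ∈ S.rootsIn k) {x : g} (hx : x ∈ adWeightSpace K g S.h δ) :
    UniversalEnvelopingAlgebra.ι K x • y ∈ orbit S k w := by
  obtain ⟨a, ha, rfl⟩ := mem_orbit.1 hy
  obtain ⟨a', ha', h⟩ := exists_lower_action (M := M) κ ha hδ hx
  exact mem_orbit.2 ⟨a', ha', (h w hw).symm⟩

/-- Whether a lower element maps a singular vector to a singular vector depends only on the
weight. -/
lemma sing_transfer {κ κ' : Dual K S.h} {w w' : M} (hw : Sing k κ w) (hw' : Sing k κ w')
    (hfree : ∀ a ∈ S.lowAlg k, a • w = 0 → a = 0) {a : Env K g} (ha : a ∈ S.lowAlg k)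
    (h : Sing k κ' (a • w)) : Sing k κ' (a • w') := by
  refine ⟨fun H => ?_, fun γ hγ hp x hx => ?_⟩
  · obtain ⟨b, hb, h1⟩ := exists_lower_action (M := M) κ ha (Or.inl rfl)
      (x := (H : g)) (by rw [S.adWeightSpace_zero]; exact H.2)
    have h2 := h.1 H
    rw [h1 w hw, ← sub_eq_zero, ← smul_assoc, ← sub_smul] at h2
    have h3 := hfree _ (sub_mem hb (Submodule.smul_mem _ _ ha)) h2
    rw [h1 w' hw', sub_eq_zero.1 h3, smul_assoc]
  · obtain ⟨b, hb, h1⟩ := exists_lower_action (M := M) κ ha (Or.inr hγ) hx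
    have h2 := h.2 γ hγ hp x hx
    rw [h1 w hw] at h2
    rw [h1 w' hw', hfree b hb h2, zero_smul]

end Setup

end Levels

section Casimir

open LieAlgebra LieModule Module

variable {K : Type} [Field K] [IsAlgClosed K] [CharZero K]
variable {g : Type} [LieRing g] [LieAlgebra K g]

namespace Setup

variable {S : Setup K g} [S.HasTriples] {k : ℕ} {γ δ η : Dual K S.h}

lemma form_eq_zero {x y : g} (hx' : x ∈ S.levi k) (hy' : y ∈ S.levi k)
    (hx : x ∈ adWeightSpace K g S.h γ) (hy : y ∈ adWeightSpace K g S.h δ) (h : γ + δ ≠ 0) :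
    S.form k x y = 0 := by
  obtain ⟨H, hH⟩ : ∃ H, (γ + δ) H ≠ 0 := by
    by_contra! h0
    exact h (LinearMap.ext h0)
  have h1 := form_lie hx' (mem_levi_of_mem_h H.2) hy'
  rw [← lie_skew, hx H, hy H, map_neg, map_smul, map_smul, LinearMap.neg_apply,
    LinearMap.smul_apply, smul_eq_mul, smul_eq_mul] at h1
  have h2 : (γ + δ) H * S.form k x y = 0 := by
    rw [LinearMap.add_apply]
    linear_combination -h1
  exact (mul_eq_zero.1 h2).resolve_left hH

lemma eV_mem_levi (hγ : γ ∈ S.rootsIn k) : S.eV k γ ∈ S.levi k :=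
  mem_levi_of_mem_adWeightSpace hγ (eV_mem hγ)

lemma fV_mem_levi (hγ : γ ∈ S.rootsIn k) : S.fV k γ ∈ S.levi k :=
  mem_levi_of_mem_adWeightSpace (neg_mem_rootsIn hγ) (fV_mem hγ)

lemma sum_form_smul_eV (hγ : γ ∈ S.rootsIn k) {z : g} (hz : z ∈ adWeightSpace K g S.h γ) :
    ∑ ε ∈ S.roots k, S.form k z (S.fV k ε) • S.eV k ε = z := by
  rw [Finset.sum_eq_single γ]
  · obtain ⟨c, rfl⟩ := exists_smul_eV hγ hz
    rw [map_smul, LinearMap.smul_apply, form_eV_fV hγ, smul_eq_mul, mul_one]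
  · intro ε hε hne
    rw [mem_roots] at hε
    rw [form_eq_zero (mem_levi_of_mem_adWeightSpace hγ hz) (fV_mem_levi hε) hz (fV_mem hε)
      (by rw [← sub_eq_add_neg]; exact sub_ne_zero.2 hne.symm), zero_smul]
  · exact fun h => absurd (mem_roots.2 hγ) h

lemma sum_form_smul_fV (hγ : γ ∈ S.rootsIn k) {z : g} (hz : z ∈ adWeightSpace K g S.h (-γ)) :
    ∑ ε ∈ S.roots k, S.form k z (S.eV k ε) • S.fV k ε = z := by
  rw [Finset.sum_eq_single γ]
  · obtain ⟨c, rfl⟩ := exists_smul_fV hγ hz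
    rw [map_smul, LinearMap.smul_apply, form_comm, form_eV_fV hγ, smul_eq_mul, mul_one]
  · intro ε hε hne
    rw [mem_roots] at hε
    rw [form_eq_zero (mem_levi_of_mem_adWeightSpace (neg_mem_rootsIn hγ) hz) (eV_mem_levi hε) hz
      (eV_mem hε) (by rw [neg_add_eq_sub]; exact sub_ne_zero.2 hne), zero_smul]
  · exact fun h => absurd (mem_roots.2 hγ) h

open Classical in
lemma lie_eV_eq (hγ : γ ∈ S.rootsIn k) (hη : η ∈ S.rootsIn k) {y : g}
    (hy : y ∈ adWeightSpace K g S.h η) :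
    ⁅S.eV k γ, y⁆ = ∑ ε ∈ S.roots k, S.form k ⁅S.eV k γ, y⁆ (S.fV k ε) • S.eV k ε +
      if γ = -η then S.form k (S.eV k γ) y • (S.tv k (-η) : g) else 0 := by
  have hm := lie_mem_adWeightSpace (eV_mem hγ) hy
  by_cases h : γ = -η
  · subst h
    rw [if_pos rfl, Finset.sum_eq_zero, zero_add, lie_eq_form_smul hγ (eV_mem hγ) (by rwa [neg_neg])]
    intro ε hε
    rw [mem_roots] at hε
    rw [form_eq_zero ((S.levi k).lie_mem (eV_mem_levi hγ) (mem_levi_of_mem_adWeightSpace hη hy))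
      (fV_mem_levi hε) hm (fV_mem hε)
      (by rw [neg_add_cancel, zero_add]; exact neg_ne_zero.2 hε.1.1), zero_smul]
  · rw [if_neg h, add_zero]
    by_cases h0 : ⁅S.eV k γ, y⁆ = 0
    · rw [h0]
      simp
    have hne : γ + η ≠ 0 := fun h' => h (eq_neg_of_add_eq_zero_left h')
    exact (sum_form_smul_eV (add_mem_rootsIn hγ hη (S.isRootOf_of_mem hne hm h0)) hm).symm

open Classical in
lemma lie_fV_eq (hγ : γ ∈ S.rootsIn k) (hη : η ∈ S.rootsIn k) {y : g}
    (hy : y ∈ adWeightSpace K g S.h η) :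
    ⁅S.fV k γ, y⁆ = ∑ ε ∈ S.roots k, S.form k ⁅S.fV k γ, y⁆ (S.eV k ε) • S.fV k ε +
      if γ = η then S.form k (S.fV k γ) y • (S.tv k (-η) : g) else 0 := by
  have hm := lie_mem_adWeightSpace (fV_mem hγ) hy
  by_cases h : γ = η
  · subst h
    rw [if_pos rfl, Finset.sum_eq_zero, zero_add,
      lie_eq_form_smul (neg_mem_rootsIn hγ) (fV_mem hγ) (by rwa [neg_neg])]
    intro ε hε
    rw [mem_roots] at hε
    rw [form_eq_zero ((S.levi k).lie_mem (fV_mem_levi hγ) (mem_levi_of_mem_adWeightSpace hη hy))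
      (eV_mem_levi hε) hm (eV_mem hε)
      (by rw [neg_add_cancel, zero_add]; exact hε.1.1), zero_smul]
  · rw [if_neg h, add_zero]
    by_cases h0 : ⁅S.fV k γ, y⁆ = 0
    · rw [h0]
      simp
    have hne : -γ + η ≠ 0 := fun h' => h (neg_add_eq_zero.1 h')
    have hr := add_mem_rootsIn (neg_mem_rootsIn hγ) hη (S.isRootOf_of_mem hne hm h0)
    exact (sum_form_smul_fV (neg_mem_rootsIn hr) (by rwa [neg_neg])).symm

variable (S k) in
/-- The part of the Casimir element which comes from the root spaces. -/
def casimir : Env K g := ∑ γ ∈ S.roots k,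
  UniversalEnvelopingAlgebra.ι K (S.fV k γ) * UniversalEnvelopingAlgebra.ι K (S.eV k γ)

lemma casimir_comm (hη : η ∈ S.rootsIn k) {y : g} (hy : y ∈ adWeightSpace K g S.h η) :
    S.casimir k * UniversalEnvelopingAlgebra.ι K y = UniversalEnvelopingAlgebra.ι K y * S.casimir k +
      (UniversalEnvelopingAlgebra.ι K y * UniversalEnvelopingAlgebra.ι K (S.tv k (-η) : g) +
        UniversalEnvelopingAlgebra.ι K (S.tv k (-η) : g) * UniversalEnvelopingAlgebra.ι K y) := by
  classical
  set i : g → Env K g := fun x => UniversalEnvelopingAlgebra.ι K x with hi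
  have hsplit : S.casimir k * i y - i y * S.casimir k =
      ∑ γ ∈ S.roots k, (i (S.fV k γ) * i ⁅S.eV k γ, y⁆ + i ⁅S.fV k γ, y⁆ * i (S.eV k γ)) := by
    rw [casimir, Finset.sum_mul, Finset.mul_sum, ← Finset.sum_sub_distrib]
    refine Finset.sum_congr rfl fun γ _ => ?_
    simp only [hi, ι_lie]
    noncomm_ring
  have hE : ∀ γ ∈ S.roots k, i (S.fV k γ) * i ⁅S.eV k γ, y⁆ =
      ∑ ε ∈ S.roots k, S.form k ⁅S.eV k γ, y⁆ (S.fV k ε) • (i (S.fV k γ) * i (S.eV k ε)) +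
      if γ = -η then i y * i (S.tv k (-η)) else 0 := by
    intro γ hγ
    rw [mem_roots] at hγ
    conv_lhs => rw [lie_eV_eq hγ hη hy]
    simp only [hi, map_add, mul_add, map_sum, Finset.mul_sum, map_smul, mul_smul_comm]
    congr 1
    by_cases h : γ = -η
    · subst h
      obtain ⟨c, hc⟩ := exists_smul_fV hγ (by rwa [neg_neg])
      simp only [if_pos, hc, map_smul, form_eV_fV hγ, smul_eq_mul, mul_one, mul_smul_comm,
        smul_mul_assoc]
    · rw [if_neg h, if_neg h, map_zero, mul_zero]
  have hF : ∀ γ ∈ S.roots k, i ⁅S.fV k γ, y⁆ * i (S.eV k γ) =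
      ∑ ε ∈ S.roots k, S.form k ⁅S.fV k γ, y⁆ (S.eV k ε) • (i (S.fV k ε) * i (S.eV k γ)) +
      if γ = η then i (S.tv k (-η)) * i y else 0 := by
    intro γ hγ
    rw [mem_roots] at hγ
    conv_lhs => rw [lie_fV_eq hγ hη hy]
    simp only [hi, map_add, add_mul, map_sum, Finset.sum_mul, map_smul, smul_mul_assoc]
    congr 1
    by_cases h : γ = η
    · subst h
      obtain ⟨c, hc⟩ := exists_smul_eV hγ hy
      rw [if_pos rfl, if_pos rfl, form_comm]
      simp only [hc, map_smul, LinearMap.smul_apply, form_eV_fV hγ, smul_eq_mul, mul_one,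
        mul_smul_comm, smul_mul_assoc]
    · rw [if_neg h, if_neg h, map_zero, zero_mul]
  have hcancel : ∑ γ ∈ S.roots k, ∑ ε ∈ S.roots k,
        S.form k ⁅S.eV k γ, y⁆ (S.fV k ε) • (i (S.fV k γ) * i (S.eV k ε)) +
      ∑ γ ∈ S.roots k, ∑ ε ∈ S.roots k,
        S.form k ⁅S.fV k γ, y⁆ (S.eV k ε) • (i (S.fV k ε) * i (S.eV k γ)) = 0 := by
    rw [Finset.sum_comm (f := fun γ ε =>
      S.form k ⁅S.fV k γ, y⁆ (S.eV k ε) • (i (S.fV k ε) * i (S.eV k γ))), ← Finset.sum_add_distrib]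
    refine Finset.sum_eq_zero fun γ hγ => ?_
    rw [← Finset.sum_add_distrib]
    refine Finset.sum_eq_zero fun ε hε => ?_
    rw [mem_roots] at hγ hε
    rw [← add_smul, form_lie (eV_mem_levi hγ) (mem_levi_of_mem_adWeightSpace hη hy) (fV_mem_levi hε),
      ← lie_skew, map_neg, form_comm, neg_add_cancel, zero_smul]
  rw [← sub_eq_iff_eq_add', hsplit, Finset.sum_congr rfl fun γ hγ => by rw [hE γ hγ, hF γ hγ],
    Finset.sum_add_distrib, Finset.sum_add_distrib, Finset.sum_add_distrib, add_add_add_comm,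
    hcancel, zero_add, Finset.sum_ite_eq' , Finset.sum_ite_eq',
    if_pos (mem_roots.2 (neg_mem_rootsIn hη)), if_pos (mem_roots.2 hη)]

open Classical in
variable (S k) in
/-- The sum of the coroot vectors of the positive roots of a finite level. -/
def posSum : S.h := ∑ γ ∈ S.roots k, if γ ∈ S.pos then 0 else S.tv k (-γ)

variable {M : Type} [AddCommGroup M] [Module K M] [Module (Env K g) M] [IsScalarTower K (Env K g) M]

lemma casimir_smul_of_sing {κ : Dual K S.h} {w : M} (hw : Sing k κ w) :
    S.casimir k • w = κ (S.posSum k) • w := by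
  classical
  rw [casimir, posSum, Finset.sum_smul, map_sum, Finset.sum_smul]
  refine Finset.sum_congr rfl fun γ hγ => ?_
  rw [mem_roots] at hγ
  by_cases hp : γ ∈ S.pos
  · rw [if_pos hp, map_zero, zero_smul, mul_smul, hw.2 γ hγ hp _ (eV_mem hγ), smul_zero]
  · have h1 := lie_eq_form_smul (neg_mem_rootsIn hγ) (fV_mem hγ) (by rw [neg_neg]; exact eV_mem hγ)
    rw [form_comm, form_eV_fV hγ, one_smul] at h1
    have h2 := congrArg (fun z => UniversalEnvelopingAlgebra.ι K z • w) h1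
    simp only [ι_lie, sub_smul] at h2
    rw [mul_smul (UniversalEnvelopingAlgebra.ι K (S.eV k γ)), hw.2 _ (neg_mem_rootsIn hγ)
      (S.neg_mem_pos hγ.1 hp) _ (fV_mem hγ), smul_zero, sub_zero, hw.1] at h2
    rw [if_neg hp, h2]

lemma tv_sum_swap {s t : Multiset (Dual K S.h)} (hs : ∀ γ ∈ s, γ ∈ S.rootsIn k)
    (ht : ∀ γ ∈ t, γ ∈ S.rootsIn k) : t.sum (s.map (S.tv k)).sum = s.sum (t.map (S.tv k)).sum := by
  rw [← form_sum_tv hs, ← form_sum_tv ht, form_comm]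

lemma tv_sum_congr {s t : Multiset (Dual K S.h)} (hs : ∀ γ ∈ s, γ ∈ S.rootsIn k)
    (ht : ∀ γ ∈ t, γ ∈ S.rootsIn k) (h : s.sum = t.sum) :
    (s.map (S.tv k)).sum = (t.map (S.tv k)).sum := by
  have h1 : (t.map Neg.neg).sum = -t.sum := Multiset.sum_map_neg' t
  have h2 : ((t.map Neg.neg).map (S.tv k)).sum = -(t.map (S.tv k)).sum := by
    rw [← Multiset.sum_map_neg', Multiset.map_map, Multiset.map_map]
    exact congrArg _ (Multiset.map_congr rfl fun γ hγ => tv_neg (ht γ hγ))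
  have h3 := sum_tv_eq_zero (n := k) (s := s + t.map Neg.neg) (fun γ hγ => by
    rcases Multiset.mem_add.1 hγ with hγ | hγ
    · exact hs γ hγ
    · obtain ⟨δ, hδ, rfl⟩ := Multiset.mem_map.1 hγ
      exact neg_mem_rootsIn (ht δ hδ)) (by rw [Multiset.sum_add, h1, h, add_neg_cancel])
  rw [Multiset.map_add, Multiset.sum_add, h2] at h3
  exact add_neg_eq_zero.1 h3

lemma mem_rootsIn_of_mem_map {m : Multiset (S.PosIdx k)} :
    ∀ γ ∈ m.map Subtype.val, γ ∈ S.rootsIn k := by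
  intro γ hγ
  obtain ⟨i, -, rfl⟩ := Multiset.mem_map.1 hγ
  exact i.2.1

lemma casimir_smul_word {κ : Dual K S.h} {w : M} (hw : Sing k κ w) (l : List (S.PosIdx k))
    {s : Multiset (Dual K S.h)} (hs : Multiset.map Subtype.val (l : Multiset (S.PosIdx k)) = s) :
    S.casimir k • (l.map (S.lowVec k)).prod • w =
      (κ (S.posSum k) + 2 * κ (s.map (S.tv k)).sum - s.sum (s.map (S.tv k)).sum) •
        (l.map (S.lowVec k)).prod • w := by
  subst hs
  induction l with
  | nil => simpa using casimir_smul_of_sing hw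
  | cons i l ih =>
    have hw1 := word_smul_mem_wt hw.1 l
    have hw2 := word_smul_mem_wt hw.1 (i :: l)
    rw [List.map_cons, List.prod_cons, mul_smul] at hw2 ⊢
    rw [← Multiset.cons_coe, Multiset.map_cons, Multiset.sum_cons] at hw2 ⊢
    set s := Multiset.map Subtype.val (l : Multiset (S.PosIdx k)) with hs
    have hsr : ∀ γ ∈ s, γ ∈ S.rootsIn k := mem_rootsIn_of_mem_map
    have hsw := tv_sum_swap (k := k) (s := s) (t := {i.1}) hsr (fun γ hγ => by
      rw [Multiset.mem_singleton.1 hγ]; exact i.2.1)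
    rw [Multiset.map_singleton, Multiset.sum_singleton, Multiset.sum_singleton] at hsw
    have h := casimir_comm (neg_mem_rootsIn i.2.1) (fV_mem i.2.1)
    rw [neg_neg] at h
    have h' := congrArg (· • (l.map (S.lowVec k)).prod • w) h
    simp only [add_smul, mul_smul] at h'
    rw [ih, hw1] at h'
    change _ = _ + (_ + UniversalEnvelopingAlgebra.ι K ((S.tv k i.1 : S.h) : g) • S.lowVec k i • _) at h'
    rw [hw2] at h'
    change S.casimir k • S.lowVec k i • _ = S.lowVec k i • _ + (S.lowVec k i • _ + _) at h'
    rw [h', smul_comm (S.lowVec k i) (_ : K), smul_comm (S.lowVec k i) (_ : K), ← add_smul, ← add_smul]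
    congr 1
    rw [Multiset.map_cons, Multiset.sum_cons, map_add, map_add]
    simp only [LinearMap.sub_apply, LinearMap.add_apply]
    rw [hsw]
    ring

/-- An orbit of a singular vector has finitely many weights of singular vectors. -/
theorem finite_sing_weights {κ : Dual K S.h} {v : M} (hv : Sing k κ v) :
    {κ' : Dual K S.h | ∃ w ∈ orbit S k v, w ≠ 0 ∧ Sing k κ' w}.Finite := by
  refine ((S.finite_root_sums k ((2 : K) • κ + (S.form k).flip (S.posSum k) ∘ₗ
    S.h.toSubmodule.subtype)).image fun β => κ - β).subset ?_
  rintro κ' ⟨w, hw, hw0, hs⟩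
  obtain ⟨m, hm⟩ := exists_weight_of_mem_orbit hv.1 hw hs.1 hw0
  set s := m.map Subtype.val with hsdef
  have hsr : ∀ γ ∈ s, γ ∈ S.rootsIn k := mem_rootsIn_of_mem_map
  refine ⟨s.sum, ⟨s, hsr, rfl, ?_⟩, hm.symm⟩
  have h := mem_span_fiber (S.iSupIndep_wt M) (fun l => word_smul_mem_wt hv.1 l) hw hs.1
  have hcas : S.casimir k • w = (κ (S.posSum k) + 2 * κ (s.map (S.tv k)).sum -
      s.sum (s.map (S.tv k)).sum) • w := by
    clear hw hw0 hs
    induction h using Submodule.span_induction with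
    | zero => rw [smul_zero, smul_zero]
    | add x y _ _ hx hy => rw [smul_add, smul_add, hx, hy]
    | smul c x _ hx => rw [smul_comm, hx, smul_comm]
    | mem x hx =>
      obtain ⟨l, hl, rfl⟩ := hx
      have hsum : (Multiset.map Subtype.val (l : Multiset (S.PosIdx k))).sum = s.sum := by
        have := (show κ - _ = κ' from hl).trans hm
        exact sub_right_injective this
      have := casimir_smul_word hv l rfl
      rw [hsum, tv_sum_congr mem_rootsIn_of_mem_map hsr hsum] at this
      exact this
  rw [casimir_smul_of_sing hs] at hcas
  have h1 := smul_left_injective K hw0 hcas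
  have h2 := form_sum_tv hsr (S.posSum k)
  rw [hm, LinearMap.sub_apply] at h1
  simp only [LinearMap.add_apply, LinearMap.smul_apply, smul_eq_mul, LinearMap.comp_apply,
    LinearMap.flip_apply]
  change _ = _ + S.form k ((s.map (S.tv k)).sum : S.h) (S.posSum k)
  rw [h2]
  linear_combination h1

end Setup

end Casimir

section Uniqueness

open LieAlgebra LieModule Module

variable {K : Type} [Field K] [IsAlgClosed K] [CharZero K]
variable {g : Type} [LieRing g] [LieAlgebra K g]

namespace Setup

variable {S : Setup K g} [S.HasTriples] {k : ℕ}
variable {M : Type} [AddCommGroup M] [Module K M] [Module (Env K g) M] [IsScalarTower K (Env K g) M]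

lemma orbit_le {v w : M} (hw : w ∈ orbit S k v) : orbit S k w ≤ orbit S k v := by
  intro x hx
  obtain ⟨a, ha, rfl⟩ := mem_orbit.1 hw
  obtain ⟨b, hb, rfl⟩ := mem_orbit.1 hx
  exact mem_orbit.2 ⟨b * a, wordSpan_mul _ hb ha, mul_smul _ _ _⟩

lemma IsVermaVec.sing {mu : Dual K S.h} {v : M} (hv : IsVermaVec mu v) (k : ℕ) : Sing k mu v :=
  ⟨hv.weight, fun γ _ hp x hx => hv.pos γ hp x hx⟩

lemma IsVermaVec.eq_zero_of_smul {mu : Dual K S.h} {v w : M} (hv : IsVermaVec mu v) (hw0 : w ≠ 0)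
    {a : Env K g} (ha : a ∈ S.lowerAlg) (h : a • w = 0) : a = 0 := by
  obtain ⟨u, hu, rfl⟩ := hv.gen w
  rw [← mul_smul] at h
  rcases S.env_mul_eq_zero (hv.free _ (mul_mem ha hu) h) with h | h
  · exact h
  · rw [h, zero_smul] at hw0
    exact absurd rfl hw0

/-- Two nonzero submodules generated by singular vectors of the same weight which meet have a
common singular vector. -/
lemma exists_common_sing {κ : Dual K S.h} {w₁ w₂ x : M} (h₁ : Sing k κ w₁) (h₂ : Sing k κ w₂)
    (hx₁ : x ∈ orbit S k w₁) (hx₂ : x ∈ orbit S k w₂) (hx0 : x ≠ 0) :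
    ∃ κ' : Dual K S.h, ∃ y ∈ orbit S k w₁, y ∈ orbit S k w₂ ∧ y ≠ 0 ∧ Sing k κ' y := by
  let X : Set (Multiset (S.PosIdx k)) := {m | ∃ y ∈ S.wt M (κ - (m.map Subtype.val).sum),
    y ∈ orbit S k w₁ ∧ y ∈ orbit S k w₂ ∧ y ≠ 0}
  have hX : X.Nonempty := by
    obtain ⟨κ', y, hy, hy0, hy₁, hy₂⟩ := exists_homogeneous_mem (S.iSupIndep_wt M)
      (fun l => word_smul_mem_wt h₁.1 l) (fun l => word_smul_mem_wt h₂.1 l) hx₁ hx₂ hx0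
    obtain ⟨m, rfl⟩ := exists_weight_of_mem_orbit h₁.1 hy₁ hy hy0
    exact ⟨m, y, hy, hy₁, hy₂, hy0⟩
  obtain ⟨m, ⟨y, hy, hy₁, hy₂, hy0⟩, hmin⟩ := (wellFounded_sum (Subtype.val : S.PosIdx k → _)
    fun _ h => eq_zero_of_map_sum_eq_zero h).has_min X hX
  refine ⟨_, y, hy₁, hy₂, hy0, hy, fun γ hγ hp x hx => ?_⟩
  by_contra hne
  have hw := smul_mem_wt hx hy
  have hm₁ := orbit_stable h₁ hy₁ (Or.inr hγ) hx
  have hm₂ := orbit_stable h₂ hy₂ (Or.inr hγ) hx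
  obtain ⟨m', hm'⟩ := exists_weight_of_mem_orbit h₁.1 hm₁ hw hne
  rw [hm'] at hw
  refine hmin m' ⟨_, hw, hm₁, hm₂, hne⟩ ⟨{⟨γ, hγ, hp⟩}, Multiset.singleton_ne_zero _, ?_⟩
  rw [Multiset.map_singleton, Multiset.sum_singleton]
  have h := sub_add_eq_add_sub κ (m.map Subtype.val).sum γ
  rw [hm'] at h
  have h' : (m.map Subtype.val).sum - γ = (m'.map Subtype.val).sum := by
    refine sub_right_injective (b := κ) ?_
    change κ - (_ - γ) = κ - _
    rw [h]
    abel
  rw [← h', sub_add_cancel]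

variable (k) in
/-- The weights of the singular vectors having two independent lower elements mapping them to
singular vectors of the same weight. -/
def doubleWeights (v : M) : Set (Dual K S.h) :=
  {κ | ∃ w ∈ orbit S k v, w ≠ 0 ∧ Sing k κ w ∧ ∃ κ' : Dual K S.h, ∃ b₁ ∈ S.lowAlg k,
    ∃ b₂ ∈ S.lowAlg k, (∀ c₁ c₂ : K, c₁ • b₁ + c₂ • b₂ = 0 → c₁ = 0 ∧ c₂ = 0) ∧
      Sing k κ' (b₁ • w) ∧ Sing k κ' (b₂ • w)}

/-- A member of `doubleWeights` gives rise to a strictly smaller one. -/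
lemma exists_lt_of_mem_doubleWeights {mu κ : Dual K S.h} {v : M} (hv : IsVermaVec mu v)
    (hκ : κ ∈ doubleWeights k v) : ∃ κ' ∈ doubleWeights k v, ∃ m : Multiset (S.PosIdx k),
      m ≠ 0 ∧ κ' = κ - (m.map Subtype.val).sum := by
  obtain ⟨w, hwv, hw0, hw, κ', b₁, hb₁, b₂, hb₂, hind, hs₁, hs₂⟩ := hκ
  have hb₁0 : b₁ ≠ 0 := fun h => one_ne_zero (hind 1 0 (by rw [h, smul_zero, zero_smul, add_zero])).1
  have hb₂0 : b₂ ≠ 0 := fun h => one_ne_zero (hind 0 1 (by rw [h, smul_zero, zero_smul, add_zero])).2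
  have hw₁0 : b₁ • w ≠ 0 := fun h => hb₁0 (hv.eq_zero_of_smul hw0 (lowAlg_le_lowerAlg hb₁) h)
  have hw₂0 : b₂ • w ≠ 0 := fun h => hb₂0 (hv.eq_zero_of_smul hw0 (lowAlg_le_lowerAlg hb₂) h)
  have hw₁ : b₁ • w ∈ orbit S k w := mem_orbit.2 ⟨b₁, hb₁, rfl⟩
  have hw₂ : b₂ • w ∈ orbit S k w := mem_orbit.2 ⟨b₂, hb₂, rfl⟩
  obtain ⟨c₁, hc₁, c₂, hc₂, hc, hc0⟩ := exists_common_multiple (fun _ _ h => S.env_mul_eq_zero h)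
    (S.lowVec k) lowVec_comm hb₁ hb₂ hb₁0 hb₂0
  obtain ⟨κ'', x, hx₁, hx₂, hx0, hx⟩ := exists_common_sing (x := (c₁ * b₁) • w) hs₁ hs₂
    (mem_orbit.2 ⟨c₁, hc₁, (mul_smul _ _ _).symm⟩)
    (mem_orbit.2 ⟨c₂, hc₂, by rw [hc, mul_smul]⟩)
    (fun h => hc0 (hv.eq_zero_of_smul hw0 (lowAlg_le_lowerAlg (wordSpan_mul _ hc₁ hb₁)) h))
  obtain ⟨a₁, ha₁, h₁⟩ := mem_orbit.1 hx₁
  obtain ⟨a₂, ha₂, h₂⟩ := mem_orbit.1 hx₂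
  have ha₂0 : a₂ ≠ 0 := by
    rintro rfl
    rw [zero_smul] at h₂
    exact hx0 h₂.symm
  have hab : a₁ * b₁ = a₂ * b₂ := by
    have h : (a₁ * b₁ - a₂ * b₂) • w = 0 := by
      rw [sub_smul, mul_smul, mul_smul, h₁, h₂, sub_self]
    exact sub_eq_zero.1 (hv.eq_zero_of_smul hw0 (lowAlg_le_lowerAlg
      (sub_mem (wordSpan_mul _ ha₁ hb₁) (wordSpan_mul _ ha₂ hb₂))) h)
  refine ⟨κ', ⟨b₁ • w, orbit_le hwv hw₁, hw₁0, hs₁, κ'', a₁, ha₁, a₂, ha₂, fun d₁ d₂ h => ?_,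
    h₁ ▸ hx, sing_transfer hs₂ hs₁
      (fun a ha h => hv.eq_zero_of_smul hw₂0 (lowAlg_le_lowerAlg ha) h) ha₂ (h₂ ▸ hx)⟩, ?_⟩
  · have h' : a₂ * (d₁ • b₂ + d₂ • b₁) = 0 := by
      rw [mul_add, mul_smul_comm, mul_smul_comm, ← hab, ← smul_mul_assoc, ← smul_mul_assoc,
        ← add_mul, h, zero_mul]
    have h'' := hind d₂ d₁ (by rw [add_comm]; exact (S.env_mul_eq_zero h').resolve_left ha₂0)
    exact ⟨h''.2, h''.1⟩
  · obtain ⟨m, hm⟩ := exists_weight_of_mem_orbit hw.1 hw₁ hs₁.1 hw₁0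
    refine ⟨m, ?_, hm⟩
    rintro rfl
    rw [Multiset.map_zero, Multiset.sum_zero, sub_zero] at hm
    obtain ⟨d₁, hd₁⟩ := exists_smul_of_mem_orbit hw.1 hw₁ (hm ▸ hs₁.1)
    obtain ⟨d₂, hd₂⟩ := exists_smul_of_mem_orbit hw.1 hw₂ (hm ▸ hs₂.1)
    have hd₁0 : d₁ ≠ 0 := by
      rintro rfl
      rw [zero_smul] at hd₁
      exact hw₁0 hd₁.symm
    have h : (d₂ • b₁ + -d₁ • b₂) • w = 0 := by
      rw [add_smul, smul_assoc, smul_assoc, ← hd₁, ← hd₂, smul_smul, smul_smul, neg_mul,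
        neg_smul, mul_comm, add_neg_cancel]
    have h' := hv.eq_zero_of_smul hw0 (lowAlg_le_lowerAlg
      (add_mem (Submodule.smul_mem _ _ hb₁) (Submodule.smul_mem _ _ hb₂))) h
    exact hd₁0 (neg_eq_zero.1 (hind _ _ h').2)

lemma doubleWeights_eq_empty {mu : Dual K S.h} {v : M} (hv : IsVermaVec mu v) :
    doubleWeights k v = (∅ : Set (Dual K S.h)) := by
  let X : Set (Dual K S.h) := doubleWeights k v
  have hfin : X.Finite :=
    (finite_sing_weights (hv.sing k)).subset fun κ ⟨w, hw, hw0, hs, _⟩ => ⟨w, hw, hw0, hs⟩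
  have := hfin.to_subtype
  let r : X → X → Prop := fun κ' κ =>
    ∃ m : Multiset (S.PosIdx k), m ≠ 0 ∧ (κ' : Dual K S.h) = κ - (m.map Subtype.val).sum
  have : IsTrans X r := ⟨by
    rintro κ₁ κ₂ κ₃ ⟨m, hm, h⟩ ⟨m', hm', h'⟩
    refine ⟨m' + m, fun h0 => hm (add_eq_zero.1 h0).2, ?_⟩
    rw [h, h', Multiset.map_add, Multiset.sum_add, sub_sub]⟩
  have : Std.Irrefl r := ⟨by
    rintro κ ⟨m, hm, h⟩
    exact hm (eq_zero_of_map_sum_eq_zero (sub_eq_self.1 h.symm))⟩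
  have hwf : WellFounded r := Finite.wellFounded_of_trans_of_irrefl r
  by_contra hne
  obtain ⟨κ, hκ⟩ := Set.nonempty_iff_ne_empty.2 hne
  obtain ⟨κ, -, hmin⟩ := hwf.has_min Set.univ ⟨⟨κ, hκ⟩, trivial⟩
  obtain ⟨κ', hκ', m, hm, h⟩ := exists_lt_of_mem_doubleWeights hv κ.2
  exact hmin ⟨κ', hκ'⟩ trivial ⟨m, hm, h⟩

/-- The singular vectors of a given weight in a Verma module are proportional. -/
theorem exists_smul_eq_of_singular {mu lam : Dual K S.h} {v w₁ w₂ : M} (hv : IsVermaVec mu v)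
    (h₁ : ∀ k, Sing k lam w₁) (h₂ : ∀ k, Sing k lam w₂) (hw₁ : w₁ ≠ 0) : ∃ c : K, c • w₁ = w₂ := by
  obtain ⟨u₁, hu₁, rfl⟩ := hv.gen w₁
  obtain ⟨u₂, hu₂, rfl⟩ := hv.gen w₂
  obtain ⟨k₁, hk₁⟩ := exists_level hu₁
  obtain ⟨k₂, hk₂⟩ := exists_level hu₂
  by_contra! hne
  have hv0 : v ≠ 0 := by
    rintro rfl
    rw [smul_zero] at hw₁
    exact hw₁ rfl
  have h := doubleWeights_eq_empty (k := max k₁ k₂) hv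
  refine Set.eq_empty_iff_forall_notMem.1 h mu ⟨v, mem_orbit.2 ⟨1, one_mem_lowAlg, one_smul _ _⟩,
    hv0, hv.sing _, lam, u₁, hk₁ _ (le_max_left _ _), u₂, hk₂ _ (le_max_right _ _),
    fun c₁ c₂ hc => ?_, h₁ _, h₂ _⟩
  have hc' : c₁ • u₁ • v + c₂ • u₂ • v = 0 := by
    rw [← smul_assoc, ← smul_assoc, ← add_smul, hc, zero_smul]
  have hc₂ : c₂ = 0 := by
    by_contra hc₂
    refine hne (-(c₂⁻¹ * c₁)) ?_
    rw [neg_smul, mul_smul, eq_neg_of_add_eq_zero_left hc', smul_neg, neg_neg, smul_smul,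
      inv_mul_cancel₀ hc₂, one_smul]
  rw [hc₂, zero_smul, add_zero] at hc'
  exact ⟨(smul_eq_zero.1 hc').resolve_right hw₁, hc₂⟩

end Setup

end Uniqueness

/-- For `lam, mu ∈ h^*`, the space `Hom_{U(g)}(M(lam), M(mu))` is zero- or
one-dimensional over `K`, every nonzero homomorphism `M(lam) → M(mu)` is an embedding, and
if a nonzero homomorphism exists then `lam ≼ mu`. -/
theorem verma_hom_space
    (K : Type) [Field K] [IsAlgClosed K] [CharZero K]
    (g : Type) [LieRing g] [LieAlgebra K g] (S : Setup K g) (hDynkin : S.IsDynkin)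
    (lam mu : Module.Dual K S.h) :
    Module.rank K (S.Verma lam →ₗ[Env K g] S.Verma mu) ≤ 1 ∧
    (∀ f : S.Verma lam →ₗ[Env K g] S.Verma mu, f ≠ 0 → Function.Injective f) ∧
    ((∃ f : S.Verma lam →ₗ[Env K g] S.Verma mu, f ≠ 0) → S.wle lam mu) := by
  have := hDynkin.hasTriples
  have hl := Setup.isVermaVec_mk (S := S) lam
  have hm := Setup.isVermaVec_mk (S := S) mu
  set vl : S.Verma lam := Submodule.Quotient.mk 1
  set vm : S.Verma mu := Submodule.Quotient.mk 1
  have hext : ∀ f f' : S.Verma lam →ₗ[Env K g] S.Verma mu, f vl = f' vl → f = f' := by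
    refine fun f f' h => LinearMap.ext fun x => ?_
    obtain ⟨a, -, rfl⟩ := hl.gen x
    rw [map_smul, map_smul, h]
  have hf0 : ∀ f : S.Verma lam →ₗ[Env K g] S.Verma mu, f ≠ 0 → f vl ≠ 0 :=
    fun f hf h => hf (hext f 0 h)
  have hsing : ∀ (f : S.Verma lam →ₗ[Env K g] S.Verma mu) (k : ℕ), Setup.Sing k lam (f vl) := by
    refine fun f k => ⟨fun H => ?_, fun γ _ hp x hx => ?_⟩
    · rw [← map_smul, hl.weight H, LinearMap.map_smul_of_tower]
    · rw [← map_smul, hl.pos γ hp x hx, map_zero]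
  refine ⟨?_, fun f hf => ?_, fun ⟨f, hf⟩ => ?_⟩
  · rw [rank_le_one_iff]
    by_cases h : ∃ f : S.Verma lam →ₗ[Env K g] S.Verma mu, f ≠ 0
    · obtain ⟨f, hf⟩ := h
      refine ⟨f, fun f' => ?_⟩
      obtain ⟨c, hc⟩ := Setup.exists_smul_eq_of_singular hm (hsing f) (hsing f') (hf0 f hf)
      exact ⟨c, hext _ _ hc⟩
    · push Not at h
      exact ⟨0, fun f => ⟨0, by rw [h f, smul_zero]⟩⟩
  · rw [injective_iff_map_eq_zero]
    intro x hx
    obtain ⟨a, ha, rfl⟩ := hl.gen x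
    rw [map_smul] at hx
    rw [hm.eq_zero_of_smul (hf0 f hf) ha hx, zero_smul]
  · obtain ⟨u, hu, h⟩ := hm.gen (f vl)
    obtain ⟨k, hk⟩ := Setup.exists_level hu
    obtain ⟨m, hm'⟩ := Setup.exists_weight_of_mem_orbit hm.weight
      (Setup.mem_orbit.2 ⟨u, hk k le_rfl, h⟩) (hsing f 0).1 (hf0 f hf)
    refine ⟨m.map Subtype.val, fun β hβ => ?_, by rw [hm', sub_sub_cancel]⟩
    obtain ⟨i, -, rfl⟩ := Multiset.mem_map.1 hβ
    exact i.2.2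

end Paper
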